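/- Let n ≥ 2 and let Ω ⊂ ℝⁿ be a connected bounded open set with smooth boundary, and let Γ ⊊ ∂Ω be a closed proper subset of the boundary. Then the linear span of the set of products u·v, where u and v range over functions in C^∞(Ω̄) that are harmonic in Ω and vanish identically on Γ, is dense in L¹(Ω). -/

import Mathlib

open MeasureTheory

noncomputable section

/-- The Laplacian of `u : ℝⁿ → ℝ`, as the sum of the second partial derivatives. -/
def lap {n : ℕ} (u : EuclideanSpace ℝ (Fin n) → ℝ) (x : EuclideanSpace ℝ (Fin n)) : ℝ :=
  ∑ i, iteratedFDeriv ℝ 2 u x ![EuclideanSpace.single i 1, EuclideanSpace.single i 1]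

/-- `u` is harmonic on `s`: twice continuously differentiable with vanishing Laplacian. -/
def IsHarmonicOn {n : ℕ} (u : EuclideanSpace ℝ (Fin n) → ℝ)
    (s : Set (EuclideanSpace ℝ (Fin n))) : Prop :=
  ContDiffOn ℝ 2 u s ∧ ∀ x ∈ s, lap u x = 0

/-- `Ω` has smooth boundary: near each boundary point there is a smooth local defining
function with nonvanishing differential. -/
def HasSmoothBoundary {n : ℕ} (Ω : Set (EuclideanSpace ℝ (Fin n))) : Prop :=
  ∀ x ∈ frontier Ω, ∃ (U : Set (EuclideanSpace ℝ (Fin n))) (ρ : EuclideanSpace ℝ (Fin n) → ℝ),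
    IsOpen U ∧ x ∈ U ∧ ContDiffOn ℝ (⊤ : ℕ∞) ρ U ∧ (∀ y ∈ U, fderiv ℝ ρ y ≠ 0) ∧
    Ω ∩ U = {y ∈ U | ρ y < 0} ∧ frontier Ω ∩ U = {y ∈ U | ρ y = 0}

/-- The set of products of two smooth-up-to-the-boundary functions, harmonic in `Ω`,
vanishing identically on `Γ`. -/
def HarmonicProducts {n : ℕ} (Ω Γ : Set (EuclideanSpace ℝ (Fin n))) :
    Set (EuclideanSpace ℝ (Fin n) → ℝ) :=
  {p | ∃ u v : EuclideanSpace ℝ (Fin n) → ℝ,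
    ContDiffOn ℝ (⊤ : ℕ∞) u (closure Ω) ∧ IsHarmonicOn u Ω ∧ (∀ x ∈ Γ, u x = 0) ∧
    ContDiffOn ℝ (⊤ : ℕ∞) v (closure Ω) ∧ IsHarmonicOn v Ω ∧ (∀ x ∈ Γ, v x = 0) ∧
    p = fun x => u x * v x}

namespace LC
open Set Filter Topology Metric
open scoped ContDiff Gradient RealInnerProductSpace
abbrev E (n : ℕ) := EuclideanSpace ℝ (Fin n)
scoped instance {n : ℕ} : MeasureSpace (E n) := inferInstance
scoped instance {n : ℕ} : MeasurableSpace (E n) := inferInstance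
scoped instance {n : ℕ} : NormedAddCommGroup (E n) := inferInstance
scoped instance {n : ℕ} : SeminormedAddCommGroup (E n) := inferInstance
scoped instance {n : ℕ} : AddCommGroup (E n) := inferInstance
scoped instance {n : ℕ} : AddCommMonoid (E n) := inferInstance
scoped instance {n : ℕ} : TopologicalSpace (E n) := inferInstance
scoped instance {n : ℕ} : UniformSpace (E n) := inferInstance
scoped instance {n : ℕ} : PseudoMetricSpace (E n) := inferInstance
scoped instance {n : ℕ} : NormedSpace ℝ (E n) := inferInstance
scoped instance {n : ℕ} : Module ℝ (E n) := inferInstance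
scoped instance {n : ℕ} : SMul ℝ (E n) := inferInstance
scoped instance {n : ℕ} : InnerProductSpace ℝ (E n) := inferInstance
scoped instance {n : ℕ} : BorelSpace (E n) := inferInstance
scoped instance {n : ℕ} : CompleteSpace (E n) := inferInstance
scoped instance {n : ℕ} : FiniteDimensional ℝ (E n) := inferInstance
def pd {n : ℕ} {F : Type*} [NormedAddCommGroup F] [NormedSpace ℝ F] (v : E n) (f : E n → F) :
    E n → F := fun x => fderiv ℝ f x v
def eb {n : ℕ} (i : Fin n) : E n := EuclideanSpace.single i 1
def Lap {n : ℕ} {F : Type*} [NormedAddCommGroup F] [NormedSpace ℝ F] (f : E n → F) (x : E n) : F :=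
  ∑ i, pd (eb i) (pd (eb i) f) x
structure IsTest {n : ℕ} (O : Set (E n)) (φ : E n → ℝ) : Prop where
  cd : ContDiff ℝ ∞ φ
  cs : HasCompactSupport φ
  ts : tsupport φ ⊆ O
section basics
variable {n : ℕ} {F : Type*} [NormedAddCommGroup F] [NormedSpace ℝ F]
lemma cd_pd {f : E n → F} (hf : ContDiff ℝ ∞ f) (v : E n) : ContDiff ℝ ∞ (pd v f) :=
  (hf.fderiv_right (m := ∞) le_rfl).clm_apply contDiff_const
lemma cdo_pd {f : E n → F} {O : Set (E n)} (hO : IsOpen O) (hf : ContDiffOn ℝ ∞ f O) (v : E n) :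
    ContDiffOn ℝ ∞ (pd v f) O :=
  (hf.fderiv_of_isOpen (m := ∞) hO le_rfl).clm_apply contDiffOn_const
lemma tsupport_pd (f : E n → F) (v : E n) : tsupport (pd v f) ⊆ tsupport f :=
  (closure_mono (fun x hx => by
    simp only [Function.mem_support, pd] at hx ⊢
    intro h; exact hx (by simp [h]))).trans (tsupport_fderiv_subset ℝ)
lemma hcs_pd {f : E n → F} (hf : HasCompactSupport f) (v : E n) : HasCompactSupport (pd v f) :=
  hf.of_isClosed_subset (isClosed_tsupport _) (tsupport_pd f v)
lemma pd_congr {f g : E n → F} {x : E n} (h : f =ᶠ[𝓝 x] g) (v : E n) :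
    pd v f =ᶠ[𝓝 x] pd v g := by
  filter_upwards [h.fderiv (𝕜 := ℝ)] with y hy
  simp [pd, hy]
lemma Lap_congr {f g : E n → F} {x : E n} (h : f =ᶠ[𝓝 x] g) : Lap f x = Lap g x := by
  unfold Lap
  exact Finset.sum_congr rfl fun i _ => (pd_congr (pd_congr h _) _).self_of_nhds
lemma Lap_eq_zero_of_notMem {f : E n → F} {x : E n} (h : x ∉ tsupport f) : Lap f x = 0 := by
  have : f =ᶠ[𝓝 x] fun _ => 0 := notMem_tsupport_iff_eventuallyEq.mp h
  rw [Lap_congr this]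
  have h0 : ∀ v : E n, pd v (fun _ : E n => (0:F)) = fun _ => 0 := by
    intro v; ext y; simp [pd]
  simp [Lap, h0]
lemma tsupport_Lap (f : E n → F) : tsupport (Lap f) ⊆ tsupport f := by
  refine closure_minimal (fun x hx => ?_) (isClosed_tsupport _)
  by_contra h
  exact hx (Lap_eq_zero_of_notMem h)
lemma cd_Lap {f : E n → F} (hf : ContDiff ℝ ∞ f) : ContDiff ℝ ∞ (Lap f) := by
  unfold Lap
  exact ContDiff.sum fun i _ => cd_pd (cd_pd hf _) _
lemma lap_eq_Lap {f : E n → ℝ} {x : E n} (hf : ContDiffAt ℝ 2 f x) : lap f x = Lap f x := by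
  unfold lap Lap
  refine Finset.sum_congr rfl fun i _ => ?_
  rw [iteratedFDeriv_two_apply]
  simp only [Matrix.cons_val_zero, Matrix.cons_val_one]
  unfold pd
  have h1 : DifferentiableAt ℝ (fderiv ℝ f) x :=
    (hf.fderiv_right (m := 1) (by norm_num)).differentiableAt (by norm_num)
  rw [show (fun x => fderiv ℝ f x (eb i)) = fun x => (fderiv ℝ f x) ((fun _ => eb i) x) from rfl,
    fderiv_clm_apply h1 (differentiableAt_const _)]
  simp [eb]
lemma IsTest.pd {O : Set (E n)} {φ : E n → ℝ} (h : IsTest O φ) (v : E n) : IsTest O (LC.pd v φ) :=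
  ⟨cd_pd h.cd v, hcs_pd h.cs v, (tsupport_pd φ v).trans h.ts⟩
lemma IsTest.Lap {O : Set (E n)} {φ : E n → ℝ} (h : IsTest O φ) : IsTest O (LC.Lap φ) :=
  ⟨cd_Lap h.cd, h.cs.of_isClosed_subset (isClosed_tsupport _) (tsupport_Lap φ),
    (tsupport_Lap φ).trans h.ts⟩
lemma IsTest.mono {O O' : Set (E n)} {φ : E n → ℝ} (h : IsTest O φ) (hO : O ⊆ O') : IsTest O' φ :=
  ⟨h.cd, h.cs, h.ts.trans hO⟩
lemma ibp {φ ψ : E n → ℝ} (hφ : ContDiff ℝ ∞ φ) (hc : HasCompactSupport φ) (hψ : ContDiff ℝ ∞ ψ)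
    (v : E n) : ∫ x, φ x * pd v ψ x = - ∫ x, pd v φ x * ψ x := by
  refine integral_mul_fderiv_eq_neg_fderiv_mul_of_integrable ?_ ?_ ?_ ?_ ?_
  · exact ((cd_pd hφ v).continuous.mul hψ.continuous).integrable_of_hasCompactSupport
      ((hcs_pd hc v).mul_right)
  · exact (hφ.continuous.mul (cd_pd hψ v).continuous).integrable_of_hasCompactSupport hc.mul_right
  · exact (hφ.continuous.mul hψ.continuous).integrable_of_hasCompactSupport hc.mul_right
  · exact fun x _ => (hφ.differentiable (by simp)).differentiableAt
  · exact fun x _ => (hψ.differentiable (by simp)).differentiableAt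
lemma inner_grad (f : E n → ℝ) (x v : E n) : ⟪∇ f x, v⟫ = pd v f x := inner_gradient_left ..
lemma inner_eq_sum (v w : E n) : ⟪v, w⟫ = ∑ i, ⟪v, eb i⟫ * ⟪w, eb i⟫ := by
  simp [PiLp.inner_apply, eb, mul_comm]
lemma cd_grad {f : E n → ℝ} (hf : ContDiff ℝ ∞ f) : ContDiff ℝ ∞ (∇ f) := by
  unfold gradient
  exact (InnerProductSpace.toDual ℝ (E n)).symm.contDiff.comp (hf.fderiv_right (m := ∞) le_rfl)
lemma tsupport_grad (f : E n → ℝ) : tsupport (∇ f) ⊆ tsupport f :=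
  (closure_mono (fun x hx => by
    simp only [Function.mem_support] at hx ⊢
    intro h; exact hx (by simp [gradient, h]))).trans (tsupport_fderiv_subset ℝ)
lemma hcs_grad {f : E n → ℝ} (hf : HasCompactSupport f) : HasCompactSupport (∇ f) :=
  hf.of_isClosed_subset (isClosed_tsupport _) (tsupport_grad f)
lemma green {φ ψ : E n → ℝ} (hφ : ContDiff ℝ ∞ φ) (hc : HasCompactSupport φ)
    (hψ : ContDiff ℝ ∞ ψ) : ∫ x, ⟪∇ φ x, ∇ ψ x⟫ = - ∫ x, Lap φ x * ψ x := by
  have h1 : ∀ x, ⟪∇ φ x, ∇ ψ x⟫ = ∑ i, pd (eb i) φ x * pd (eb i) ψ x := by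
    intro x; rw [inner_eq_sum]; simp only [inner_grad]
  simp_rw [h1, Lap, Finset.sum_mul]
  rw [integral_finsetSum, integral_finsetSum, ← Finset.sum_neg_distrib]
  · exact Finset.sum_congr rfl fun i _ => ibp (cd_pd hφ _) (hcs_pd hc _) hψ _
  · exact fun i _ => ((cd_pd (cd_pd hφ _) _).continuous.mul
      hψ.continuous).integrable_of_hasCompactSupport (hcs_pd (hcs_pd hc _) _).mul_right
  · exact fun i _ => ((cd_pd hφ _).continuous.mul
      (cd_pd hψ _).continuous).integrable_of_hasCompactSupport (hcs_pd hc _).mul_right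
end basics
open scoped ContDiff Gradient RealInnerProductSpace InnerProduct
section hilb
set_option linter.unusedSectionVars false
variable {n : ℕ} {F : Type*} [NormedAddCommGroup F] [InnerProductSpace ℝ F]
abbrev L2 (n : ℕ) := Lp ℝ 2 (volume : Measure (E n))
abbrev L2E (n : ℕ) := Lp (E n) 2 (volume : Measure (E n))
abbrev HH (n : ℕ) := WithLp 2 (L2 n × L2E n)
scoped instance : NormedAddCommGroup (L2 n) := inferInstance
scoped instance : InnerProductSpace ℝ (L2 n) := inferInstance
scoped instance : NormedSpace ℝ (L2 n) := inferInstance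
scoped instance : CompleteSpace (L2 n) := inferInstance
scoped instance : NormedAddCommGroup (L2E n) := inferInstance
scoped instance : InnerProductSpace ℝ (L2E n) := inferInstance
scoped instance : NormedSpace ℝ (L2E n) := inferInstance
scoped instance : CompleteSpace (L2E n) := inferInstance
scoped instance : NormedAddCommGroup (HH n) := inferInstance
scoped instance : InnerProductSpace ℝ (HH n) := inferInstance
scoped instance : NormedSpace ℝ (HH n) := inferInstance
scoped instance : TopologicalSpace (L2 n) := inferInstance
scoped instance : AddCommGroup (L2 n) := inferInstance
scoped instance : AddCommMonoid (L2 n) := inferInstance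
scoped instance : Module ℝ (L2 n) := inferInstance
scoped instance : SeminormedAddCommGroup (L2 n) := inferInstance
scoped instance : UniformSpace (L2 n) := inferInstance
scoped instance : PseudoMetricSpace (L2 n) := inferInstance
scoped instance : ContinuousConstSMul ℝ (L2 n) := inferInstance
scoped instance : ContinuousSMul ℝ (L2 n) := inferInstance
scoped instance : TopologicalSpace (L2E n) := inferInstance
scoped instance : AddCommGroup (L2E n) := inferInstance
scoped instance : AddCommMonoid (L2E n) := inferInstance
scoped instance : Module ℝ (L2E n) := inferInstance
scoped instance : SeminormedAddCommGroup (L2E n) := inferInstance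
scoped instance : UniformSpace (L2E n) := inferInstance
scoped instance : PseudoMetricSpace (L2E n) := inferInstance
scoped instance : ContinuousConstSMul ℝ (L2E n) := inferInstance
scoped instance : ContinuousSMul ℝ (L2E n) := inferInstance
scoped instance : TopologicalSpace (HH n) := inferInstance
scoped instance : AddCommGroup (HH n) := inferInstance
scoped instance : AddCommMonoid (HH n) := inferInstance
scoped instance : Module ℝ (HH n) := inferInstance
scoped instance : SeminormedAddCommGroup (HH n) := inferInstance
scoped instance : UniformSpace (HH n) := inferInstance
scoped instance : PseudoMetricSpace (HH n) := inferInstance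
scoped instance : ContinuousConstSMul ℝ (HH n) := inferInstance
scoped instance : ContinuousSMul ℝ (HH n) := inferInstance
abbrev M2 (f : E n → F) : Prop := MemLp f 2 (volume : Measure (E n))
open Classical in
def l2 (f : E n → F) : Lp F 2 (volume : Measure (E n)) := if h : M2 f then h.toLp f else 0
lemma l2_coe {f : E n → F} (h : M2 f) : l2 f =ᵐ[volume] f := by
  rw [l2, dif_pos h]; exact h.coeFn_toLp
lemma l2_eq {f : E n → F} {g : Lp F 2 (volume : Measure (E n))} (h : g =ᵐ[volume] f) : l2 f = g := by
  have hf : M2 f := (memLp_congr_ae h).mp (Lp.memLp g)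
  exact Lp.ext ((l2_coe hf).trans h.symm)
lemma l2_self (g : Lp F 2 (volume : Measure (E n))) : l2 (g : E n → F) = g := l2_eq ae_eq_rfl
lemma l2_congr {f g : E n → F} (hg : M2 g) (h : f =ᵐ[volume] g) : l2 f = l2 g :=
  l2_eq ((l2_coe hg).trans h.symm)
lemma l2_add {f g : E n → F} (hf : M2 f) (hg : M2 g) : l2 (f + g) = l2 f + l2 g :=
  l2_eq ((Lp.coeFn_add _ _).trans ((l2_coe hf).add (l2_coe hg)))
lemma l2_smul {f : E n → F} (c : ℝ) (hf : M2 f) : l2 (c • f) = c • l2 f :=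
  l2_eq ((Lp.coeFn_smul _ _).trans ((l2_coe hf).const_smul c))
lemma l2_neg {f : E n → F} (hf : M2 f) : l2 (-f) = - l2 f :=
  l2_eq ((Lp.coeFn_neg _).trans (l2_coe hf).neg)
lemma l2_sub {f g : E n → F} (hf : M2 f) (hg : M2 g) : l2 (f - g) = l2 f - l2 g :=
  l2_eq ((Lp.coeFn_sub _ _).trans ((l2_coe hf).sub (l2_coe hg)))
lemma inner_l2 {f g : E n → F} (hf : M2 f) (hg : M2 g) : ⟪l2 f, l2 g⟫ = ∫ x, ⟪f x, g x⟫ := by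
  rw [L2.inner_def]
  refine integral_congr_ae ?_
  filter_upwards [l2_coe hf, l2_coe hg] with x h1 h2
  rw [h1, h2]
lemma inner_l2' {f g : E n → ℝ} (hf : M2 f) (hg : M2 g) : ⟪l2 f, l2 g⟫ = ∫ x, f x * g x := by
  rw [inner_l2 hf hg]; simp [mul_comm]
lemma inner_Lp (f g : L2 n) : ⟪f, g⟫ = ∫ x, f x * g x := by
  rw [L2.inner_def]; simp [mul_comm]
lemma norm_l2_sq {f : E n → F} (hf : M2 f) : ‖l2 f‖ ^ 2 = ∫ x, ‖f x‖ ^ 2 := by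
  rw [← real_inner_self_eq_norm_sq, inner_l2 hf hf]; simp
lemma norm_Lp_sq (f : Lp F 2 (volume : Measure (E n))) : ‖f‖ ^ 2 = ∫ x, ‖f x‖ ^ 2 := by
  rw [← real_inner_self_eq_norm_sq, L2.inner_def]; simp
lemma m2_cc {f : E n → F} (hf : Continuous f) (hc : HasCompactSupport f) : M2 f :=
  hf.memLp_of_hasCompactSupport hc
lemma IsTest.m2 {O : Set (E n)} {φ : E n → ℝ} (h : IsTest O φ) : M2 φ := m2_cc h.cd.continuous h.cs
lemma IsTest.gm2 {O : Set (E n)} {φ : E n → ℝ} (h : IsTest O φ) : M2 (∇ φ) :=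
  m2_cc (cd_grad h.cd).continuous (hcs_grad h.cs)
lemma IsTest.add {O : Set (E n)} {φ ψ : E n → ℝ} (h : IsTest O φ) (h' : IsTest O ψ) :
    IsTest O (φ + ψ) :=
  ⟨h.cd.add h'.cd, h.cs.add h'.cs, (tsupport_add φ ψ).trans (union_subset h.ts h'.ts)⟩
lemma IsTest.smul {O : Set (E n)} {φ : E n → ℝ} (h : IsTest O φ) (c : ℝ) : IsTest O (c • φ) :=
  ⟨contDiff_const.smul h.cd, h.cs.smul_left (f := fun _ => c),
    (closure_mono (Function.support_const_smul_subset c φ)).trans h.ts⟩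
lemma IsTest.diff {O : Set (E n)} {φ : E n → ℝ} (h : IsTest O φ) (x : E n) :
    DifferentiableAt ℝ φ x := (h.cd.differentiable (by simp)).differentiableAt
lemma grad_add {φ ψ : E n → ℝ} {x : E n} (h : DifferentiableAt ℝ φ x)
    (h' : DifferentiableAt ℝ ψ x) : ∇ (φ + ψ) x = ∇ φ x + ∇ ψ x := by
  simp [gradient, fderiv_add h h']
lemma grad_smul {φ : E n → ℝ} {x : E n} (h : DifferentiableAt ℝ φ x) (c : ℝ) :
    ∇ (c • φ) x = c • ∇ φ x := by
  simp [gradient, fderiv_const_smul h]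
variable (O : Set (E n))
def testSub : Submodule ℝ (E n → ℝ) where
  carrier := {φ | IsTest O φ}
  add_mem' := fun h h' => h.add h'
  zero_mem' := ⟨contDiff_const, HasCompactSupport.zero, by simp⟩
  smul_mem' := fun c _ h => h.smul c
def J : testSub O →ₗ[ℝ] HH n where
  toFun φ := WithLp.toLp 2 (l2 (φ : E n → ℝ), l2 (∇ (φ : E n → ℝ)))
  map_add' φ ψ := by
    have h : IsTest O φ := φ.2
    have h' : IsTest O ψ := ψ.2
    rw [Submodule.coe_add, l2_add h.m2 h'.m2,
      show ∇ ((φ : E n → ℝ) + (ψ : E n → ℝ)) = ∇ (φ : E n → ℝ) + ∇ (ψ : E n → ℝ) from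
        funext fun x => grad_add (h.diff x) (h'.diff x), l2_add h.gm2 h'.gm2]
    rfl
  map_smul' c φ := by
    have h : IsTest O φ := φ.2
    rw [Submodule.coe_smul, l2_smul c h.m2,
      show ∇ (c • (φ : E n → ℝ)) = c • ∇ (φ : E n → ℝ) from
        funext fun x => grad_smul (h.diff x) c, l2_smul c h.gm2]
    rfl
def KK : Submodule ℝ (HH n) := (LinearMap.range (J O)).topologicalClosure
scoped instance : NormedAddCommGroup (KK O) := inferInstance
scoped instance : InnerProductSpace ℝ (KK O) := inferInstance
scoped instance : NormedSpace ℝ (KK O) := inferInstance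
scoped instance : TopologicalSpace (KK O) := inferInstance
scoped instance : AddCommGroup (KK O) := inferInstance
scoped instance : AddCommMonoid (KK O) := inferInstance
scoped instance : Module ℝ (KK O) := inferInstance
scoped instance : SeminormedAddCommGroup (KK O) := inferInstance
scoped instance : UniformSpace (KK O) := inferInstance
scoped instance : PseudoMetricSpace (KK O) := inferInstance
scoped instance : ContinuousConstSMul ℝ (KK O) := inferInstance
scoped instance : ContinuousSMul ℝ (KK O) := inferInstance
scoped instance : CompleteSpace (KK O) := (Submodule.isClosed_topologicalClosure _).completeSpace_coe
def fK : KK O →L[ℝ] L2 n := (WithLp.fstL 2 ℝ (L2 n) (L2E n)).comp (KK O).subtypeL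
def sK : KK O →L[ℝ] L2E n := (WithLp.sndL 2 ℝ (L2 n) (L2E n)).comp (KK O).subtypeL
variable {O}
def jK {φ : E n → ℝ} (h : IsTest O φ) : KK O :=
  ⟨J O ⟨φ, h⟩, Submodule.le_topologicalClosure _ ⟨_, rfl⟩⟩
lemma fK_jK {φ : E n → ℝ} (h : IsTest O φ) : fK O (jK h) = l2 φ := rfl
lemma sK_jK {φ : E n → ℝ} (h : IsTest O φ) : sK O (jK h) = l2 (∇ φ) := rfl
lemma K_norm (κ : KK O) : ‖κ‖ ^ 2 = ‖fK O κ‖ ^ 2 + ‖sK O κ‖ ^ 2 :=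
  WithLp.prod_norm_sq_eq_of_L2 (κ : HH n)
lemma K_ext {κ κ' : KK O} (h : fK O κ = fK O κ') (h' : sK O κ = sK O κ') : κ = κ' := by
  have := K_norm (κ - κ')
  rw [map_sub, map_sub, h, h', sub_self, sub_self] at this
  simpa [sub_eq_zero] using this
lemma K_seq (κ : KK O) : ∃ (φ : ℕ → E n → ℝ) (h : ∀ k, IsTest O (φ k)),
    Tendsto (fun k => jK (h k)) atTop (𝓝 κ) := by
  obtain ⟨x, hx, hl⟩ := mem_closure_iff_seq_limit.mp κ.2
  choose ψ hψ using hx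
  refine ⟨fun k => ψ k, fun k => (ψ k).2, tendsto_subtype_rng.mpr ?_⟩
  convert hl using 2 with k
  exact hψ k
lemma K_ind {P : KK O → Prop} (hP : IsClosed {κ | P κ})
    (h : ∀ φ (h : IsTest O φ), P (jK h)) (κ : KK O) : P κ := by
  obtain ⟨φ, hφ, hl⟩ := K_seq κ
  exact hP.mem_of_tendsto hl (Eventually.of_forall fun k => h _ (hφ k))
lemma poincare_test {R : ℝ} (hn : 0 < n) (hO : O ⊆ closedBall 0 R) {φ : E n → ℝ}
    (h : IsTest O φ) : ∫ x, φ x ^ 2 ≤ 4 * R ^ 2 * ∫ x, ‖∇ φ x‖ ^ 2 := by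
  let e : E n := eb ⟨0, hn⟩
  have he : ‖e‖ = 1 := by simp [e, eb]
  have hl : ∀ x, pd e (fun y : E n => ⟪e, y⟫) x = 1 := by
    intro x
    have : fderiv ℝ (fun y : E n => ⟪e, y⟫) x = innerSL ℝ e := (innerSL ℝ e).fderiv
    simp [pd, this, he]
  have h2 : ∀ x, pd e (fun y => φ y ^ 2) x = 2 * φ x * pd e φ x := by
    intro x
    simp only [pd]
    rw [((h.diff x).hasFDerivAt.pow 2).fderiv]
    simp
  have hci : HasCompactSupport (fun x => φ x ^ 2) := by
    simp_rw [pow_two]; exact h.cs.mul_left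
  have := ibp (h.cd.pow 2) hci (ψ := fun y : E n => ⟪e, y⟫) (innerSL ℝ e).contDiff e
  simp_rw [hl, h2, mul_one] at this
  have i1 : Integrable (fun x => φ x ^ 2) :=
    (h.cd.continuous.pow 2).integrable_of_hasCompactSupport hci
  have i2 : Integrable (fun x => ‖∇ φ x‖ ^ 2) := by
    refine ((cd_grad h.cd).continuous.norm.pow 2).integrable_of_hasCompactSupport ?_
    simp_rw [pow_two]; exact (hcs_grad h.cs).norm.mul_left
  have key : ∫ x, φ x ^ 2 ≤ ∫ x, ((1/2) * φ x ^ 2 + 2 * R ^ 2 * ‖∇ φ x‖ ^ 2) := by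
    rw [this, ← integral_neg]
    refine integral_mono_of_nonneg_aux ?_ ((i1.const_mul _).add (i2.const_mul _)) ?_
    · refine (Continuous.integrable_of_hasCompactSupport ?_ ?_)
      · exact (((continuous_const.mul h.cd.continuous).mul (cd_pd h.cd e).continuous).mul
          (innerSL ℝ e).continuous).neg
      · exact ((h.cs.mul_left (f := fun _ => 2)).mul_right.mul_right).neg
    intro x
    by_cases hx : x ∈ tsupport φ
    · have hx1 : |⟪e, x⟫| ≤ R := by
        refine (abs_real_inner_le_norm e x).trans ?_
        rw [he, one_mul]; simpa using hO (h.ts hx)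
      have hx2 : |pd e φ x| ≤ ‖∇ φ x‖ := by
        rw [← inner_grad]; simpa [he] using abs_real_inner_le_norm (∇ φ x) e
      have : -(2 * φ x * pd e φ x * ⟪e, x⟫) ≤ 2 * |φ x| * ‖∇ φ x‖ * R := by
        refine (neg_le_abs _).trans ?_
        rw [abs_mul, abs_mul, abs_mul, abs_two]
        gcongr
      have h3 := sq_nonneg (|φ x| - 2 * R * ‖∇ φ x‖)
      nlinarith [sq_abs (φ x)]
    · have : φ x = 0 := image_eq_zero_of_notMem_tsupport hx
      simp only [this]
      have : 0 ≤ 2 * R ^ 2 * ‖∇ φ x‖ ^ 2 := by positivity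
      simpa
  rw [integral_add (i1.const_mul _) (i2.const_mul _), integral_const_mul, integral_const_mul] at key
  linarith
where
  integral_mono_of_nonneg_aux {f g : E n → ℝ} (hf : Integrable f) (hg : Integrable g)
      (h : ∀ x, f x ≤ g x) : ∫ x, f x ≤ ∫ x, g x := integral_mono hf hg h
lemma poincare {R : ℝ} (hn : 0 < n) (hO : O ⊆ closedBall 0 R) (κ : KK O) :
    ‖fK O κ‖ ^ 2 ≤ 4 * R ^ 2 * ‖sK O κ‖ ^ 2 := by
  refine K_ind (P := fun κ => ‖fK O κ‖ ^ 2 ≤ 4 * R ^ 2 * ‖sK O κ‖ ^ 2)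
    (isClosed_le ((fK O).continuous.norm.pow 2) (continuous_const.mul ((sK O).continuous.norm.pow 2))) (fun φ h => ?_) κ
  rw [fK_jK, sK_jK, norm_l2_sq h.m2, norm_l2_sq h.gm2]
  simpa using poincare_test hn hO h
lemma isUnit_of_coercive {V : Type*} [NormedAddCommGroup V] [InnerProductSpace ℝ V]
    [CompleteSpace V] (T : V →L[ℝ] V) {c : ℝ} (hc : 0 < c) (h : ∀ v, c * ‖v‖ ^ 2 ≤ ⟪T v, v⟫) :
    IsUnit T := by
  have hB : IsCoercive ((innerSL ℝ (E := V)).comp T) :=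
    ⟨c, hc, fun v => by have := h v; rw [pow_two, ← mul_assoc] at this; exact this⟩
  have : T = (hB.continuousLinearEquivOfBilin : V →L[ℝ] V) := by
    ext v
    exact hB.unique_continuousLinearEquivOfBilin (fun w => rfl)
  rw [this]
  exact ⟨ContinuousLinearEquiv.toUnit _, rfl⟩
section abs
variable {V L M : Type*} [NormedAddCommGroup V] [InnerProductSpace ℝ V] [CompleteSpace V]
  [NormedAddCommGroup L] [InnerProductSpace ℝ L] [CompleteSpace L]
  [NormedAddCommGroup M] [InnerProductSpace ℝ M] [CompleteSpace M]
  (f : V →L[ℝ] L) (s : V →L[ℝ] M)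
def aT (A : M →L[ℝ] M) : V →L[ℝ] V := (s†).comp (A.comp s)
def asol (A : M →L[ℝ] M) (h : L) : V := Ring.inverse (aT s A) ((f†) h)
def aG : L →L[ℝ] L := f.comp ((Ring.inverse (aT s (ContinuousLinearMap.id ℝ M))).comp (f†))
lemma aT_inner (A : M →L[ℝ] M) (κ κ' : V) : ⟪aT s A κ, κ'⟫ = ⟪A (s κ), s κ'⟫ := by
  simp only [aT, ContinuousLinearMap.comp_apply]
  exact ContinuousLinearMap.adjoint_inner_left _ _ _
variable {s}
lemma aT_unit {R : ℝ} (hp : ∀ κ, ‖κ‖ ^ 2 ≤ (R ^ 2 + 1) * ‖s κ‖ ^ 2) {A : M →L[ℝ] M}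
    {c : ℝ} (hc : 0 < c) (hA : ∀ v, c * ‖v‖ ^ 2 ≤ ⟪A v, v⟫) : IsUnit (aT s A) := by
  refine isUnit_of_coercive (c := c / (R ^ 2 + 1)) _ (by positivity) fun κ => ?_
  rw [aT_inner]
  refine le_trans ?_ (hA _)
  rw [div_mul_eq_mul_div, div_le_iff₀ (by positivity), mul_assoc]
  gcongr
  linarith [hp κ]
lemma asol_spec {A : M →L[ℝ] M} (hA : IsUnit (aT s A)) (h : L) (κ : V) :
    ⟪A (s (asol f s A h)), s κ⟫ = ⟪h, f κ⟫ := by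
  rw [← aT_inner, asol, ← mul_apply_eq_comp, Ring.mul_inverse_cancel _ hA]
  exact ContinuousLinearMap.adjoint_inner_left _ _ _
lemma asol_unique {A : M →L[ℝ] M} (hA : IsUnit (aT s A)) {h : L} {κ : V}
    (hκ : ∀ κ', ⟪A (s κ), s κ'⟫ = ⟪h, f κ'⟫) : asol f s A h = κ := by
  have : aT s A κ = (f†) h := by
    refine ext_inner_right ℝ fun κ' => ?_
    rw [aT_inner, ContinuousLinearMap.adjoint_inner_left, hκ]
  rw [asol, ← this, ← mul_apply_eq_comp, Ring.inverse_mul_cancel _ hA]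
  rfl
lemma aG_symm (hA : IsUnit (aT s (ContinuousLinearMap.id ℝ M))) (h k : L) :
    ⟪aG f s h, k⟫ = ⟪h, aG f s k⟫ := by
  have h1 := asol_spec f hA k (asol f s (ContinuousLinearMap.id ℝ _) h)
  have h2 := asol_spec f hA h (asol f s (ContinuousLinearMap.id ℝ _) k)
  change ⟪f (asol f s _ h), k⟫ = ⟪h, f (asol f s _ k)⟫
  rw [← h2, real_inner_comm, ← h1, real_inner_comm]
  rfl
end abs
variable (O)
def TT (A : L2E n →L[ℝ] L2E n) : KK O →L[ℝ] KK O := aT (sK O) A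
def sol (A : L2E n →L[ℝ] L2E n) (h : L2 n) : KK O := asol (fK O) (sK O) A h
variable {O}
lemma TT_unit {R : ℝ} (hn : 0 < n) (hO : O ⊆ closedBall 0 R) {A : L2E n →L[ℝ] L2E n}
    {c : ℝ} (hc : 0 < c) (hA : ∀ v, c * ‖v‖ ^ 2 ≤ ⟪A v, v⟫) : IsUnit (TT O A) :=
  aT_unit (R := 2 * R) (fun κ => by linarith [poincare hn hO κ, K_norm κ]) hc hA
lemma sol_spec {A : L2E n →L[ℝ] L2E n} (hA : IsUnit (TT O A)) (h : L2 n) (κ : KK O) :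
    ⟪A (sK O (sol O A h)), sK O κ⟫ = ⟪h, fK O κ⟫ := asol_spec (fK O) hA h κ
lemma sol_unique {A : L2E n →L[ℝ] L2E n} (hA : IsUnit (TT O A)) {h : L2 n} {κ : KK O}
    (hκ : ∀ φ, IsTest O φ → ⟪A (sK O κ), l2 (∇ φ)⟫ = ⟪h, l2 φ⟫) : sol O A h = κ :=
  asol_unique (fK O) hA fun κ' => K_ind
    (P := fun κ' => ⟪A (sK O κ), sK O κ'⟫ = ⟪h, fK O κ'⟫)
      (isClosed_eq (continuous_const.inner (sK O).continuous)
        (continuous_const.inner (fK O).continuous)) hκ κ'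
variable (O) in
def GG : L2 n →L[ℝ] L2 n := aG (fK O) (sK O)
lemma GG_eq (h : L2 n) : GG O h = fK O (sol O (ContinuousLinearMap.id ℝ _) h) := rfl
lemma id_unit (hn : 0 < n) (hO : Bornology.IsBounded O) :
    IsUnit (TT O (ContinuousLinearMap.id ℝ (L2E n))) := by
  obtain ⟨R, hR⟩ := hO.subset_closedBall 0
  exact TT_unit hn hR one_pos (fun v => by simp)
lemma GG_symm (hn : 0 < n) (hO : Bornology.IsBounded O) (h k : L2 n) :
    ⟪GG O h, k⟫ = ⟪h, GG O k⟫ := aG_symm (fK O) (id_unit hn hO) h k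
lemma sol_neg_Lap (hn : 0 < n) (hO : Bornology.IsBounded O) {φ : E n → ℝ} (hφ : IsTest O φ) :
    sol O (ContinuousLinearMap.id ℝ _) (l2 (-Lap φ)) = jK hφ := by
  refine sol_unique (id_unit hn hO) fun ψ hψ => ?_
  change ⟪l2 (∇ φ), l2 (∇ ψ)⟫ = _
  rw [inner_l2 hφ.gm2 hψ.gm2, inner_l2' hφ.Lap.m2.neg hψ.m2, green hφ.cd hφ.cs hψ.cd]
  simp [integral_neg]
lemma GG_neg_Lap (hn : 0 < n) (hO : Bornology.IsBounded O) {φ : E n → ℝ} (hφ : IsTest O φ) :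
    GG O (l2 (-Lap φ)) = l2 φ := by
  rw [GG_eq, sol_neg_Lap hn hO hφ, fK_jK]
lemma inner_Lp_l2 (h : L2 n) {φ : E n → ℝ} (hφ : M2 φ) : ⟪h, l2 φ⟫ = ∫ x, h x * φ x := by
  have := inner_l2' (Lp.memLp h) hφ
  rwa [l2_self] at this
lemma GG_weak (hn : 0 < n) (hO : Bornology.IsBounded O) (h : L2 n) {φ : E n → ℝ}
    (hφ : IsTest O φ) : ∫ x, GG O h x * Lap φ x = - ∫ x, h x * φ x := by
  have h1 := GG_symm hn hO h (l2 (-Lap φ))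
  rw [GG_neg_Lap hn hO hφ, inner_Lp_l2 _ hφ.Lap.m2.neg, inner_Lp_l2 _ hφ.m2] at h1
  rw [← h1, ← integral_neg]
  simp
lemma K_weak (κ : KK O) {b : E n → ℝ} (hb : IsTest univ b) (v : E n) :
    ⟪fK O κ, l2 (pd v b)⟫ = - ⟪sK O κ, l2 (fun x => b x • v)⟫ := by
  refine K_ind (P := fun κ => ⟪fK O κ, l2 (pd v b)⟫ = - ⟪sK O κ, l2 (fun x => b x • v)⟫)
    (isClosed_eq ((fK O).continuous.inner continuous_const)
      ((sK O).continuous.inner continuous_const).neg) (fun φ h => ?_) κ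
  have hm : M2 (fun x => b x • v) :=
    m2_cc (hb.cd.continuous.smul continuous_const) hb.cs.smul_right
  rw [fK_jK, sK_jK, inner_l2' h.m2 (hb.pd v).m2, inner_l2 h.gm2 hm, ibp h.cd h.cs hb.cd]
  simp_rw [inner_smul_right, inner_grad, mul_comm]
lemma K_zero_off (hO : IsOpen O) (κ : KK O) : ∀ᵐ x, x ∉ O → fK O κ x = 0 := by
  have hm : ∀ f : L2 n, M2 (Oᶜ.indicator (f : E n → ℝ)) :=
    fun f => (Lp.memLp f).indicator hO.measurableSet.compl
  have h1 : ∀ f : L2 n, ⟪fK O κ, l2 (Oᶜ.indicator (f : E n → ℝ))⟫ = 0 := by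
    intro f
    refine K_ind (P := fun κ => ⟪fK O κ, l2 (Oᶜ.indicator (f : E n → ℝ))⟫ = 0)
      (isClosed_eq ((fK O).continuous.inner continuous_const) continuous_const) (fun φ h => ?_) κ
    rw [fK_jK, inner_l2' h.m2 (hm f)]
    refine (integral_congr_ae (Eventually.of_forall fun x => ?_)).trans (integral_zero (E n) ℝ)
    by_cases hx : x ∈ O
    · simp [hx]
    · have : φ x = 0 := image_eq_zero_of_notMem_tsupport fun h' => hx (h.ts h')
      simp [this]
  have h2 := h1 (fK O κ)
  have h3 : ⟪l2 (Oᶜ.indicator (fK O κ : E n → ℝ)), l2 (Oᶜ.indicator (fK O κ : E n → ℝ))⟫ = 0 := by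
    rw [inner_Lp_l2 _ (hm _)] at h2
    rw [← h2, inner_l2' (hm _) (hm _)]
    refine integral_congr_ae (Eventually.of_forall fun x => ?_)
    by_cases hx : x ∈ O <;> simp [hx]
  rw [inner_self_eq_zero] at h3
  have h4 := (l2_coe (hm (fK O κ))).symm
  rw [h3] at h4
  filter_upwards [h4, Lp.coeFn_zero ℝ 2 (volume : Measure (E n))] with x hx hx' hxO
  rw [hx', indicator_of_mem (by exact hxO)] at hx
  simpa using hx
end hilb
section kelvin
variable {n : ℕ}
lemma pd_of_line {F : Type*} [NormedAddCommGroup F] [NormedSpace ℝ F] {f : E n → F} {x v : E n}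
    {f' : F} (hf : DifferentiableAt ℝ f x) (h : HasDerivAt (fun t : ℝ => f (x + t • v)) f' 0) :
    pd v f x = f' := by
  rw [pd, ← hf.lineDeriv_eq_fderiv]
  exact h.deriv
lemma hasDerivAt_nsq (d v : E n) : HasDerivAt (fun t : ℝ => ‖d + t • v‖ ^ 2) (2 * ⟪d, v⟫) 0 := by
  have h1 : HasDerivAt (fun t : ℝ => d + t • v) v 0 := by
    simpa using ((hasDerivAt_id (0:ℝ)).smul_const v).const_add d
  have := h1.norm_sq
  simpa using this
lemma hasDerivAt_nsqC (d v : E n) :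
    HasDerivAt (fun t : ℝ => ((‖d + t • v‖ ^ 2 : ℝ) : ℂ)) (2 * (⟪d, v⟫ : ℝ) : ℂ) 0 := by
  simpa using (hasDerivAt_nsq d v).ofReal_comp
def kph (q : E n) (L : E n →L[ℝ] ℂ) (x : E n) : ℂ :=
  L (x - q) / ((‖x - q‖ ^ 2 : ℝ) : ℂ) - (((n : ℝ) - 2) / 2 * Real.log (‖x - q‖ ^ 2) : ℝ)
def kdv (q : E n) (L : E n →L[ℝ] ℂ) (v x : E n) : ℂ :=
  L v / ((‖x - q‖ ^ 2 : ℝ) : ℂ) - 2 * ((⟪x - q, v⟫ : ℝ) : ℂ) * L (x - q) / ((‖x - q‖ ^ 2 : ℝ) : ℂ) ^ 2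
    - ((n : ℂ) - 2) * ((⟪x - q, v⟫ : ℝ) : ℂ) / ((‖x - q‖ ^ 2 : ℝ) : ℂ)
def kel (q : E n) (L : E n →L[ℝ] ℂ) (x : E n) : ℂ := Complex.exp (kph q L x)
lemma nsq_ne {q x : E n} (hx : x ≠ q) : ‖x - q‖ ^ 2 ≠ 0 := by
  simpa [sub_eq_zero] using hx
lemma cd_nsq (q : E n) : ContDiff ℝ ∞ (fun x : E n => ‖x - q‖ ^ 2) :=
  (contDiff_id.sub contDiff_const).norm_sq ℝ
lemma cd_ofReal {f : E n → ℝ} {x : E n} (hf : ContDiffAt ℝ ∞ f x) :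
    ContDiffAt ℝ ∞ (fun x => ((f x : ℝ) : ℂ)) x :=
  Complex.ofRealCLM.contDiff.contDiffAt.comp x hf
lemma cd_kph {q x : E n} (L : E n →L[ℝ] ℂ) (hx : x ≠ q) : ContDiffAt ℝ ∞ (kph q L) x := by
  have hs := nsq_ne hx
  have h1 : ContDiffAt ℝ ∞ (fun x : E n => ‖x - q‖ ^ 2) x := (cd_nsq q).contDiffAt
  unfold kph
  refine ContDiffAt.sub ?_ (cd_ofReal (contDiffAt_const.mul (h1.log hs)))
  simp_rw [div_eq_mul_inv]
  refine ContDiffAt.mul ?_ (ContDiffAt.inv (cd_ofReal h1) (by exact_mod_cast hs))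
  exact L.contDiff.contDiffAt.comp x (contDiffAt_id.sub contDiffAt_const)
lemma cd_kel {q x : E n} (L : E n →L[ℝ] ℂ) (hx : x ≠ q) : ContDiffAt ℝ ∞ (kel q L) x :=
  (cd_kph L hx).cexp
lemma cd_kdv {q x : E n} (L : E n →L[ℝ] ℂ) (v : E n) (hx : x ≠ q) :
    ContDiffAt ℝ ∞ (kdv q L v) x := by
  have hs := nsq_ne hx
  have h1 : ContDiffAt ℝ ∞ (fun x : E n => ‖x - q‖ ^ 2) x := (cd_nsq q).contDiffAt
  have h2 : ContDiffAt ℝ ∞ (fun x : E n => (((‖x - q‖ ^ 2 : ℝ) : ℂ))⁻¹) x :=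
    ContDiffAt.inv (cd_ofReal h1) (by exact_mod_cast hs)
  have h3 : ContDiffAt ℝ ∞ (fun x : E n => ((⟪x - q, v⟫ : ℝ) : ℂ)) x :=
    cd_ofReal ((contDiffAt_id.sub contDiffAt_const).inner ℝ contDiffAt_const)
  have h4 : ContDiffAt ℝ ∞ (fun x : E n => L (x - q)) x :=
    L.contDiff.contDiffAt.comp x (contDiffAt_id.sub contDiffAt_const)
  unfold kdv
  simp_rw [div_eq_mul_inv, ← inv_pow]
  exact (((contDiffAt_const.mul h2).sub (((contDiffAt_const.mul h3).mul h4).mul (h2.pow 2)))).sub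
    ((contDiffAt_const.mul h3).mul h2)
lemma hasDerivAt_L (L : E n →L[ℝ] ℂ) (d v : E n) :
    HasDerivAt (fun t : ℝ => L (d + t • v)) (L v) 0 := by
  simp only [map_add, map_smul]
  simpa using ((hasDerivAt_id (0:ℝ)).smul_const (L v)).const_add (L d)
lemma hasDerivAt_in (d v : E n) :
    HasDerivAt (fun t : ℝ => ((⟪d + t • v, v⟫ : ℝ) : ℂ)) ((‖v‖ ^ 2 : ℝ) : ℂ) 0 := by
  have : HasDerivAt (fun t : ℝ => ⟪d + t • v, v⟫) (‖v‖ ^ 2) 0 := by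
    simp only [inner_add_left, real_inner_smul_left, real_inner_self_eq_norm_sq]
    simpa using ((hasDerivAt_id (0:ℝ)).mul_const (‖v‖ ^ 2)).const_add ⟪d, v⟫
  exact this.ofReal_comp
lemma line_sub (x q v : E n) (t : ℝ) : x + t • v - q = (x - q) + t • v := by abel
lemma pd_kph {q x : E n} (L : E n →L[ℝ] ℂ) (hx : x ≠ q) (v : E n) :
    pd v (kph q L) x = kdv q L v x := by
  have hs := nsq_ne hx
  have hs' : ((‖x - q‖ ^ 2 : ℝ) : ℂ) ≠ 0 := by exact_mod_cast hs
  refine pd_of_line ((cd_kph L hx).differentiableAt (by simp)) ?_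
  unfold kph kdv
  simp_rw [line_sub]
  have h1 := (hasDerivAt_L L (x - q) v).div (hasDerivAt_nsqC (x - q) v) (by simpa using hs')
  have h2 := (((hasDerivAt_nsq (x - q) v).log (by simpa using hs)).const_mul
    (((n : ℝ) - 2) / 2)).ofReal_comp
  refine (h1.sub h2).congr_deriv ?_
  simp only [zero_smul, add_zero] at *
  push_cast at *
  field_simp
lemma pd_kdv {q x : E n} (L : E n →L[ℝ] ℂ) (hx : x ≠ q) (v : E n) :
    pd v (kdv q L v) x = - 4 * (⟪x - q, v⟫ : ℝ) * L v / ((‖x - q‖ ^ 2 : ℝ) : ℂ) ^ 2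
      - 2 * ((‖v‖ ^ 2 : ℝ) : ℂ) * L (x - q) / ((‖x - q‖ ^ 2 : ℝ) : ℂ) ^ 2
      + 8 * ((⟪x - q, v⟫ : ℝ) : ℂ) ^ 2 * L (x - q) / ((‖x - q‖ ^ 2 : ℝ) : ℂ) ^ 3
      - ((n : ℂ) - 2) * ((‖v‖ ^ 2 : ℝ) : ℂ) / ((‖x - q‖ ^ 2 : ℝ) : ℂ)
      + 2 * ((n : ℂ) - 2) * ((⟪x - q, v⟫ : ℝ) : ℂ) ^ 2 / ((‖x - q‖ ^ 2 : ℝ) : ℂ) ^ 2 := by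
  have hs := nsq_ne hx
  have hs' : ((‖x - q‖ ^ 2 : ℝ) : ℂ) ≠ 0 := by exact_mod_cast hs
  refine pd_of_line ((cd_kdv L v hx).differentiableAt (by simp)) ?_
  unfold kdv
  simp_rw [line_sub]
  have k1 := hasDerivAt_nsqC (x - q) v
  have k2 := hasDerivAt_in (x - q) v
  have k3 := hasDerivAt_L L (x - q) v
  have h1 := (hasDerivAt_const (0:ℝ) (L v)).div k1 (by simpa using hs')
  have h2 := ((k2.const_mul (2:ℂ)).mul k3).div (k1.pow 2) (by simpa using hs')
  have h3 := (k2.const_mul ((n : ℂ) - 2)).div k1 (by simpa using hs')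
  refine ((h1.sub h2).sub h3).congr_deriv ?_
  simp only [zero_smul, add_zero, Pi.pow_apply, Pi.mul_apply]
  clear h1 h2 h3 k1 k2 k3
  generalize ((‖x - q‖ ^ 2 : ℝ) : ℂ) = s at *
  generalize ((⟪x - q, v⟫ : ℝ) : ℂ) = a
  generalize ((‖v‖ ^ 2 : ℝ) : ℂ) = b
  generalize L (x - q) = c
  generalize L v = d
  field_simp
  ring
lemma pd_kel {q x : E n} (L : E n →L[ℝ] ℂ) (hx : x ≠ q) (v : E n) :
    pd v (kel q L) x = kdv q L v x * kel q L x := by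
  have := ((cd_kph L hx).differentiableAt (by simp)).hasFDerivAt.cexp
  rw [← pd_kph L hx, pd, pd]
  unfold kel
  rw [this.fderiv]
  simp [mul_comm]
lemma ev_ne {q x : E n} (hx : x ≠ q) : ∀ᶠ y in 𝓝 x, y ≠ q := isOpen_ne.mem_nhds hx
lemma pd_mul {f g : E n → ℂ} {x : E n} (hf : DifferentiableAt ℝ f x) (hg : DifferentiableAt ℝ g x)
    (v : E n) : pd v (fun y => f y * g y) x = pd v f x * g x + f x * pd v g x := by
  unfold pd
  rw [HasFDerivAt.fderiv (f := fun y => f y * g y) (hf.hasFDerivAt.mul hg.hasFDerivAt)]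
  simp; ring
lemma pdpd_kel {q x : E n} (L : E n →L[ℝ] ℂ) (hx : x ≠ q) (v : E n) :
    pd v (pd v (kel q L)) x = (pd v (kdv q L v) x + kdv q L v x ^ 2) * kel q L x := by
  have : pd v (kel q L) =ᶠ[𝓝 x] fun y => kdv q L v y * kel q L y := by
    filter_upwards [ev_ne hx] with y hy using pd_kel L hy v
  rw [(pd_congr this v).self_of_nhds, pd_mul ((cd_kdv L v hx).differentiableAt (by simp))
    ((cd_kel L hx).differentiableAt (by simp)), pd_kel L hx]
  ring
lemma sum_inner_L (L : E n →L[ℝ] ℂ) (d : E n) : ∑ i, ((⟪d, eb i⟫ : ℝ) : ℂ) * L (eb i) = L d := by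
  have : d = ∑ i, (⟪d, eb i⟫ : ℝ) • eb i := by
    ext j; simp [eb, Pi.single_apply, Finset.sum_apply, EuclideanSpace.inner_single_right]
  conv_rhs => rw [this]
  simp
lemma sum_inner_sq (d : E n) : ∑ i, ((⟪d, eb i⟫ : ℝ) : ℂ) ^ 2 = ((‖d‖ ^ 2 : ℝ) : ℂ) := by
  rw [← real_inner_self_eq_norm_sq, inner_eq_sum]
  push_cast
  exact Finset.sum_congr rfl fun i _ => by ring
lemma Lap_kel {q x : E n} (L : E n →L[ℝ] ℂ) (hx : x ≠ q) :
    Lap (kel q L) x = (∑ i, L (eb i) ^ 2) / ((‖x - q‖ ^ 2 : ℝ) : ℂ) ^ 2 * kel q L x := by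
  have hs' : ((‖x - q‖ ^ 2 : ℝ) : ℂ) ≠ 0 := by exact_mod_cast nsq_ne hx
  unfold Lap
  simp_rw [pdpd_kel L hx]
  rw [← Finset.sum_mul]
  congr 1
  have e1 := sum_inner_L L (x - q)
  have e2 := sum_inner_sq (x - q)
  have e3 : ∀ i : Fin n, ((‖(eb i : E n)‖ ^ 2 : ℝ) : ℂ) = 1 := by intro i; simp [eb]
  simp_rw [pd_kdv L hx, e3, kdv]
  generalize ((‖x - q‖ ^ 2 : ℝ) : ℂ) = s at *
  generalize L (x - q) = c at *
  have key : ∀ i : Fin n, (-4 * ((⟪x - q, eb i⟫ : ℝ) : ℂ) * L (eb i) / s ^ 2 - 2 * 1 * c / s ^ 2 +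
      8 * ((⟪x - q, eb i⟫ : ℝ) : ℂ) ^ 2 * c / s ^ 3 - ((n : ℂ) - 2) * 1 / s +
      2 * ((n : ℂ) - 2) * ((⟪x - q, eb i⟫ : ℝ) : ℂ) ^ 2 / s ^ 2 +
      (L (eb i) / s - 2 * ((⟪x - q, eb i⟫ : ℝ) : ℂ) * c / s ^ 2 -
        ((n : ℂ) - 2) * ((⟪x - q, eb i⟫ : ℝ) : ℂ) / s) ^ 2) =
      L (eb i) ^ 2 * (1 / s ^ 2) + (((⟪x - q, eb i⟫ : ℝ) : ℂ) * L (eb i)) *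
        (-4 / s ^ 2 - 4 * c / s ^ 3 - 2 * ((n : ℂ) - 2) / s ^ 2) +
      ((⟪x - q, eb i⟫ : ℝ) : ℂ) ^ 2 * (8 * c / s ^ 3 + 2 * ((n : ℂ) - 2) / s ^ 2 +
        (2 * c / s ^ 2 + ((n : ℂ) - 2) / s) ^ 2) + (- 2 * c / s ^ 2 - ((n : ℂ) - 2) / s) := by
    intro i; field_simp; ring
  rw [Finset.sum_congr rfl fun i _ => key i]
  simp only [Finset.sum_add_distrib, ← Finset.sum_mul, e1, e2, Finset.sum_const, Finset.card_univ,
    Fintype.card_fin, nsmul_eq_mul]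
  field_simp
  ring
lemma pd_smul {F : Type*} [NormedAddCommGroup F] [NormedSpace ℝ F] {f : E n → ℝ} {g : E n → F}
    {x : E n} (hf : DifferentiableAt ℝ f x) (hg : DifferentiableAt ℝ g x)
    (v : E n) : pd v (fun y => f y • g y) x = f x • pd v g x + pd v f x • g x := by
  unfold pd
  rw [HasFDerivAt.fderiv (f := fun y => f y • g y) (hf.hasFDerivAt.smul hg.hasFDerivAt)]
  simp
lemma pd_add {F : Type*} [NormedAddCommGroup F] [NormedSpace ℝ F] {f g : E n → F}
    {x : E n} (hf : DifferentiableAt ℝ f x) (hg : DifferentiableAt ℝ g x)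
    (v : E n) : pd v (fun y => f y + g y) x = pd v f x + pd v g x := by
  unfold pd
  rw [HasFDerivAt.fderiv (f := fun y => f y + g y) (hf.hasFDerivAt.add hg.hasFDerivAt)]
  simp
lemma Lap_smul {F : Type*} [NormedAddCommGroup F] [NormedSpace ℝ F] {f : E n → ℝ} {g : E n → F}
    {O : Set (E n)} (hO : IsOpen O) {x : E n} (hx : x ∈ O) (hf : ContDiffOn ℝ ∞ f O)
    (hg : ContDiffOn ℝ ∞ g O) :
    Lap (fun y => f y • g y) x = f x • Lap g x +
      ((2:ℝ) • ∑ i, pd (eb i) f x • pd (eb i) g x + Lap f x • g x) := by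
  have df : ∀ {h : E n → ℝ},
      ContDiffOn ℝ ∞ h O → ∀ y ∈ O, DifferentiableAt ℝ h y := fun hh y hy =>
    (hh.contDiffAt (hO.mem_nhds hy)).differentiableAt (by simp)
  have df' : ∀ {h : E n → F}, ContDiffOn ℝ ∞ h O → ∀ y ∈ O, DifferentiableAt ℝ h y :=
    fun hh y hy => (hh.contDiffAt (hO.mem_nhds hy)).differentiableAt (by simp)
  have key : ∀ v : E n, pd v (pd v (fun y => f y • g y)) x =
      f x • pd v (pd v g) x + ((2:ℝ) • (pd v f x • pd v g x) + pd v (pd v f) x • g x) := by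
    intro v
    have : pd v (fun y => f y • g y) =ᶠ[𝓝 x] fun y => f y • pd v g y + pd v f y • g y := by
      filter_upwards [hO.mem_nhds hx] with y hy
      exact pd_smul (df hf y hy) (df' hg y hy) v
    have d1 := df hf x hx
    have d2 := df' hg x hx
    have d3 := df (cdo_pd hO hf v) x hx
    have d4 := df' (cdo_pd hO hg v) x hx
    rw [(pd_congr this v).self_of_nhds, pd_add (f := fun y => f y • pd v g y)
      (g := fun y => pd v f y • g y) (d1.smul d4) (d3.smul d2), pd_smul d1 d4,
      pd_smul d3 d2, two_smul]
    abel
  unfold Lap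
  simp_rw [key, Finset.sum_add_distrib, Finset.smul_sum, Finset.sum_smul]
end kelvin
section LLs
open Complex
variable {α : Type*} [MeasurableSpace α] {μ : Measure α}
lemma norm_cexp_le {z : ℂ} {y M : ℝ} (hy : |y| ≤ M) : ‖cexp (z * y)‖ ≤ Real.exp (M * ‖z‖) := by
  rw [norm_exp, Real.exp_le_exp]
  calc (z * y).re ≤ ‖z * (y:ℂ)‖ := re_le_norm _
    _ = ‖z‖ * |y| := by simp
    _ ≤ M * ‖z‖ := by rw [mul_comm]; gcongr
lemma int_cexp {F : α → ℂ} (hF : Integrable F μ) {Y : α → ℝ} (hY : Measurable Y) {M : ℝ}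
    (hM : ∀ x, |Y x| ≤ M) (z : ℂ) : Integrable (fun x => F x * cexp (z * Y x)) μ := by
  refine hF.mul_bdd (c := Real.exp (M * ‖z‖)) ?_ (.of_forall fun x => norm_cexp_le (hM x))
  exact (Measurable.cexp (by fun_prop)).aestronglyMeasurable
lemma ent {F : α → ℂ} (hF : Integrable F μ) {Y : α → ℝ} (hY : Measurable Y) {M : ℝ}
    (hM : ∀ x, |Y x| ≤ M) : Differentiable ℂ (fun z : ℂ => ∫ x, F x * cexp (z * Y x) ∂μ) := by
  intro z₀
  have hM' : ∀ x, 0 ≤ M := fun x => (abs_nonneg _).trans (hM x)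
  refine (hasDerivAt_integral_of_dominated_loc_of_deriv_le (F' := fun z x => F x * (cexp (z * Y x) * Y x))
    (bound := fun x => ‖F x‖ * (Real.exp (M * (‖z₀‖ + 1)) * M)) (ball_mem_nhds z₀ one_pos)
    (.of_forall fun z => (int_cexp hF hY hM z).1) (int_cexp hF hY hM z₀) ?_ ?_ ?_ ?_).2.differentiableAt
  · exact hF.1.mul (Measurable.aestronglyMeasurable (by fun_prop))
  · refine .of_forall fun x z hz => ?_
    have := hM' x
    rw [norm_mul, norm_mul]
    gcongr
    · refine (norm_cexp_le (hM x)).trans (Real.exp_le_exp.2 ?_)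
      gcongr
      have : ‖z - z₀‖ < 1 := by simpa [dist_eq_norm] using hz
      have := norm_le_norm_add_norm_sub' z z₀
      linarith
    · simpa using hM x
  · exact hF.norm.mul_const _
  · refine .of_forall fun x z hz => ?_
    have : HasDerivAt (fun z : ℂ => z * (Y x : ℂ)) (Y x) z := by simpa using (hasDerivAt_id z).mul_const (Y x : ℂ)
    exact this.cexp.const_mul _
lemma LL1 {F : α → ℂ} (hF : Integrable F μ) {Y : α → ℝ} (hY : Measurable Y) {M κ C Λ : ℝ}
    (hM : ∀ x, -M ≤ Y x) (h0 : ∀ x, Y x ≤ 0)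
    (hd : ∀ l : ℝ, Λ ≤ l → ‖∫ x, F x * cexp (l * Y x) ∂μ‖ ≤ C * Real.exp (-κ * l)) (z : ℂ) :
    ∫ x, {x | -κ < Y x}.indicator F x * cexp (z * Y x) ∂μ = 0 := by
  have hms : MeasurableSet {x | -κ < Y x} := measurableSet_lt measurable_const hY
  set s := {x | -κ < Y x} with hs
  have hF1 : Integrable (s.indicator F) μ := hF.indicator hms
  have hF2 : Integrable (sᶜ.indicator F) μ := hF.indicator hms.compl
  have hY' : Measurable fun x => Y x + κ := hY.add_const κ
  have hYa : ∀ x, |Y x + κ| ≤ M + |κ| := fun x => by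
    refine (abs_add_le _ _).trans ?_
    gcongr
    rw [abs_of_nonpos (h0 x)]; linarith [hM x]
  set N := ∫ x, ‖F x‖ ∂μ
  have bd : ∀ (t : Set α) (z : ℂ), (∀ x, x ∈ t → z.re * (Y x + κ) ≤ 0) → MeasurableSet t →
      ‖∫ x, t.indicator F x * cexp (z * ((Y x + κ : ℝ) : ℂ)) ∂μ‖ ≤ N := by
    intro t z ht htm
    refine norm_integral_le_of_norm_le hF.norm (.of_forall fun x => ?_)
    by_cases hx : x ∈ t
    · rw [indicator_of_mem hx, norm_mul]
      refine mul_le_of_le_one_right (norm_nonneg _) ?_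
      rw [norm_exp, Real.exp_le_one_iff, re_mul_ofReal]
      exact ht x hx
    · simp [hx]
  have e1 := ent hF1 hY' hYa
  have e0 := ent hF hY' hYa
  set Ψ : ℂ → ℂ := fun z => ∫ x, s.indicator F x * cexp (z * ((Y x + κ : ℝ) : ℂ)) ∂μ with hΨ
  set Φ : ℂ → ℂ := fun z => ∫ x, F x * cexp (z * ((Y x + κ : ℝ) : ℂ)) ∂μ with hΦ
  have hsplit : ∀ z, Ψ z = Φ z - ∫ x, sᶜ.indicator F x * cexp (z * ((Y x + κ : ℝ) : ℂ)) ∂μ := by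
    intro z
    simp only [hΨ, hΦ]
    rw [← integral_sub (int_cexp hF hY' hYa z) (int_cexp hF2 hY' hYa z)]
    congr 1; ext x
    by_cases hx : x ∈ s <;> simp [hx]
  have hΦb : ∀ z : ℂ, 0 ≤ z.re → ‖Φ z‖ ≤ N := by
    intro z hz
    refine PhragmenLindelof.right_half_plane_of_bounded_on_real e0.diffContOnCl
      ⟨1, by norm_num, M + |κ|, ?_⟩ ?_ ?_ hz
    · refine Asymptotics.IsBigO.of_bound N (.of_forall fun z => ?_)
      rw [Real.norm_of_nonneg (Real.exp_pos _).le, Real.rpow_one]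
      refine (norm_integral_le_of_norm_le (hF.norm.mul_const (Real.exp ((M + |κ|) * ‖z‖)))
        (.of_forall fun x => ?_)).trans_eq (integral_mul_const _ _)
      rw [norm_mul]; gcongr
      exact norm_cexp_le (hYa x)
    · refine ⟨C, ?_⟩
      rw [eventually_map]
      filter_upwards [eventually_ge_atTop Λ] with l hl
      have : Φ l = cexp (l * κ) * ∫ x, F x * cexp (l * Y x) ∂μ := by
        simp only [hΦ]
        rw [← integral_const_mul]
        congr 1; ext x
        push_cast
        rw [mul_add, Complex.exp_add]; ring
      rw [this, norm_mul, norm_exp]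
      have h2 : ((l:ℂ) * κ).re = l * κ := by simp
      rw [h2]
      calc _ ≤ Real.exp (l * κ) * (C * Real.exp (-κ * l)) := by gcongr; exact hd l hl
        _ = C := by
          rw [mul_left_comm, ← Real.exp_add]; ring_nf; simp
    · intro x
      have := bd univ (x * I) (by simp) .univ
      simpa [hΦ] using this
  have hΨb : ∀ z : ℂ, ‖Ψ z‖ ≤ N + N := by
    intro z
    rcases le_total 0 z.re with hz | hz
    · rw [hsplit]
      refine (norm_sub_le _ _).trans (add_le_add (hΦb z hz) (bd _ z (fun x hx => ?_) hms.compl))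
      have : Y x ≤ -κ := not_lt.1 hx
      exact mul_nonpos_of_nonneg_of_nonpos hz (by linarith)
    · have : 0 ≤ N := integral_nonneg fun _ => norm_nonneg _
      refine (bd s z (fun x hx => ?_) hms).trans (by linarith)
      have : -κ < Y x := hx
      exact mul_nonpos_of_nonpos_of_nonneg hz (by linarith)
  have hconst : ∀ z, Ψ z = Ψ 0 := fun z =>
    e1.apply_eq_apply_of_bounded (isBounded_iff_forall_norm_le.2 ⟨N + N, by rintro _ ⟨z, rfl⟩; exact hΨb z⟩) z 0
  have hlim : Tendsto (fun k : ℕ => Ψ (-(k:ℝ) : ℝ)) atTop (𝓝 (∫ x, (0:ℂ) ∂μ)) := by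
    refine tendsto_integral_of_dominated_convergence (fun x => ‖F x‖)
      (fun k => (int_cexp hF1 hY' hYa _).1) hF.norm (fun k => .of_forall fun x => ?_) (.of_forall fun x => ?_)
    · by_cases hx : x ∈ s
      · rw [indicator_of_mem hx, norm_mul]
        refine mul_le_of_le_one_right (norm_nonneg _) ?_
        rw [norm_exp, Real.exp_le_one_iff, re_mul_ofReal, ofReal_re]
        have : -κ < Y x := hx
        exact mul_nonpos_of_nonpos_of_nonneg (by simp) (by linarith)
      · simp [hx]
    · by_cases hx : x ∈ s
      · have hp : 0 < Y x + κ := by have : -κ < Y x := hx; linarith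
        rw [← mul_zero (s.indicator F x)]
        refine Tendsto.const_mul _ ?_
        rw [tendsto_zero_iff_norm_tendsto_zero]
        have : ∀ k : ℕ, ‖cexp (((-(k:ℝ) : ℝ) : ℂ) * ((Y x + κ : ℝ):ℂ))‖ = Real.exp (-((k:ℝ) * (Y x + κ))) := by
          intro k; rw [norm_exp, re_mul_ofReal, ofReal_re]; ring_nf
        simp only [this]
        exact Real.tendsto_exp_neg_atTop_nhds_zero.comp
          (tendsto_natCast_atTop_atTop.atTop_mul_const hp)
      · simp [hx]
  have hΨ0 : Ψ 0 = 0 := by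
    rw [integral_zero] at hlim
    refine tendsto_nhds_unique ?_ hlim
    simp only [hconst (((-(_:ℝ)):ℝ):ℂ)]
    exact tendsto_const_nhds
  have h3 : Ψ z = cexp (z * κ) * ∫ x, s.indicator F x * cexp (z * Y x) ∂μ := by
    simp only [hΨ]
    rw [← integral_const_mul]
    congr 1; ext x
    push_cast
    rw [mul_add, Complex.exp_add]; ring
  rw [hconst, hΨ0] at h3
  exact (mul_eq_zero.1 h3.symm).resolve_left (Complex.exp_ne_zero _)
lemma char_zero {n : ℕ} {F : E n → ℝ} (hF : Integrable F) {X Xi : E n → E n} (hX : Measurable X)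
    (hXi : Measurable Xi) (hinv : ∀ x, Xi (X x) = x)
    (h : ∀ t : E n, ∫ x, (F x : ℂ) * cexp ((⟪X x, t⟫ : ℝ) * I) = 0) : F =ᵐ[volume] 0 := by
  have hF' : Integrable (fun x => - F x) := hF.neg
  let P (g : E n → ℝ) : Measure (E n) := (volume.withDensity fun x => ENNReal.ofReal (g x)).map X
  have fin : ∀ g, Integrable g volume → IsFiniteMeasure (P g) := fun g hg => by
    have := isFiniteMeasure_withDensity_ofReal hg.2
    infer_instance
  have cf : ∀ g : E n → ℝ, Integrable g volume → ∀ t, charFun (P g) t =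
      ∫ x, (max (g x) 0 : ℝ) * cexp ((⟪X x, t⟫ : ℝ) * I) := by
    intro g hg t
    rw [charFun_apply, integral_map hX.aemeasurable (by fun_prop),
      integral_withDensity_eq_integral_toReal_smul₀ hg.1.aemeasurable.ennreal_ofReal (by simp)]
    congr 1
  have := fin F hF
  have := fin _ hF'
  have ci : ∀ g : E n → ℝ, Integrable g volume → ∀ t : E n, Integrable (fun x => (max (g x) 0 : ℝ) * cexp ((⟪X x, t⟫ : ℝ) * I)) := by
    intro g hg t
    refine hg.pos_part.ofReal.mul_bdd (c := 1) (Measurable.aestronglyMeasurable (by fun_prop)) (.of_forall fun x => ?_)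
    rw [norm_exp_ofReal_mul_I]
  have heq : P F = P fun x => - F x := by
    refine Measure.ext_of_charFun (funext fun t => ?_)
    rw [cf _ hF, cf _ hF', ← sub_eq_zero, ← integral_sub (ci _ hF t) (ci _ hF' t), ← h t]
    congr 1; ext x
    rw [← sub_mul]
    congr 1
    rw [← ofReal_sub]
    congr 1
    rcases le_total 0 (F x) with h | h
    · rw [max_eq_left h, max_eq_right (by linarith)]; ring
    · rw [max_eq_right h, max_eq_left (by linarith)]; ring
  refine hF.ae_eq_zero_of_forall_setIntegral_eq_zero fun s hs _ => ?_
  have h2 := congrArg (fun m : Measure (E n) => m (Xi ⁻¹' s)) heq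
  simp only [P] at h2
  rw [Measure.map_apply hX (hXi hs), Measure.map_apply hX (hXi hs)] at h2
  have h3 : X ⁻¹' (Xi ⁻¹' s) = s := by ext x; simp [hinv]
  rw [h3, withDensity_apply _ hs, withDensity_apply _ hs] at h2
  rw [integral_eq_lintegral_pos_part_sub_lintegral_neg_part hF.restrict, h2, sub_self]
lemma LL {n : ℕ} {F : E n → ℝ} (hF : Integrable F) {X Xi : E n → E n} (hX : Measurable X)
    (hXi : Measurable Xi) (hinv : ∀ x, Xi (X x) = x) {e1 : E n} (he : ‖e1‖ = 1) {c M κ : ℝ}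
    (hY : ∀ᵐ x, F x ≠ 0 → -M ≤ ⟪X x, e1⟫ - c ∧ ⟪X x, e1⟫ ≤ c)
    (hd : ∀ ξ : E n, ⟪ξ, e1⟫ = 0 → ∃ C Λ : ℝ, ∀ l : ℝ, Λ ≤ l →
      ‖∫ x, (F x : ℂ) * cexp ((l * (⟪X x, e1⟫ - c) : ℝ) + (⟪X x, ξ⟫ : ℝ) * I)‖ ≤ C * Real.exp (-κ * l)) :
    ∀ᵐ x, -κ < ⟪X x, e1⟫ - c → F x = 0 := by
  wlog hM : 0 ≤ M generalizing M
  · refine this (M := 0) ?_ le_rfl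
    filter_upwards [hY] with x hx h0
    have := hx h0
    constructor <;> linarith
  let Y : E n → ℝ := fun x => max (-M) (min (⟪X x, e1⟫ - c) 0)
  have hYm : Measurable Y := by fun_prop
  have hYe : ∀ᵐ x, F x ≠ 0 → Y x = ⟪X x, e1⟫ - c := by
    filter_upwards [hY] with x hx h0
    have := hx h0
    simp only [Y]
    rw [min_eq_left (by linarith), max_eq_right (by linarith)]
  let s := {x | -κ < Y x}
  have hms : MeasurableSet s := measurableSet_lt measurable_const hYm
  have hz : s.indicator F =ᵐ[volume] 0 := by
    refine char_zero (hF.indicator hms) hX hXi hinv fun t => ?_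
    let ξ := t - ⟪t, e1⟫ • e1
    have hξ : ⟪ξ, e1⟫ = 0 := by
      simp [ξ, inner_sub_left, inner_smul_left, he]
    obtain ⟨C, Λ, hC⟩ := hd ξ hξ
    have hFi : Integrable fun x => (F x : ℂ) * cexp ((⟪X x, ξ⟫ : ℝ) * I) := by
      refine hF.ofReal.mul_bdd (c := 1) (Measurable.aestronglyMeasurable (by fun_prop)) (.of_forall fun x => ?_)
      rw [norm_exp_ofReal_mul_I]
    have h1 := LL1 (M := M) (κ := κ) (C := C) (Λ := Λ) hFi hYm (fun x => le_max_left _ _)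
      (fun x => max_le (by linarith) (min_le_right _ _)) (fun l hl => by
        refine le_trans (le_of_eq ?_) (hC l hl)
        congr 1
        refine integral_congr_ae ?_
        filter_upwards [hYe] with x hx
        by_cases h0 : F x = 0
        · simp [h0]
        · rw [hx h0, mul_assoc, ← Complex.exp_add]
          push_cast; ring_nf) (⟪t, e1⟫ * I)
    have h2 : ∫ x, ((s.indicator F x : ℝ) : ℂ) * cexp ((⟪X x, t⟫ : ℝ) * I) =
        cexp ((⟪t, e1⟫ * c : ℝ) * I) * ∫ x, s.indicator (fun x => (F x : ℂ) * cexp ((⟪X x, ξ⟫ : ℝ) * I)) x *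
          cexp ((⟪t, e1⟫ * I) * Y x) := by
      rw [← integral_const_mul]
      refine integral_congr_ae ?_
      filter_upwards [hYe] with x hx
      by_cases hs : x ∈ s
      · by_cases h0 : F x = 0
        · simp [h0, hs]
        · rw [indicator_of_mem hs, indicator_of_mem hs, hx h0, mul_assoc, ← Complex.exp_add, mul_left_comm, ← Complex.exp_add]
          congr 2
          have : ⟪X x, ξ⟫ = ⟪X x, t⟫ - ⟪t, e1⟫ * ⟪X x, e1⟫ := by
            simp [ξ, inner_sub_right, inner_smul_right]
          rw [this]; push_cast; ring
      · simp [hs]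
    rw [h2, h1, mul_zero]
  filter_upwards [hz, hYe] with x h1 h2 h3
  by_contra h0
  have hs : x ∈ s := by show -κ < Y x; rw [h2 h0]; exact h3
  rw [indicator_of_mem hs] at h1
  exact h0 h1
end LLs
section geom
open Complex
variable {n : ℕ}
def ZZ (f : E n → ℝ) : Set (E n) := {x | ∃ U : Set (E n), IsOpen U ∧ x ∈ U ∧ ∀ᵐ y, y ∈ U → f y = 0}
lemma ZZ_open (f : E n → ℝ) : IsOpen (ZZ f) := by
  rw [isOpen_iff_mem_nhds]
  rintro x ⟨U, hU, hx, h⟩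
  exact mem_of_superset (hU.mem_nhds hx) fun y hy => ⟨U, hU, hy, h⟩
lemma ae_ZZ {f : E n → ℝ} {S : Set (E n)} (hS : S ⊆ ZZ f) : ∀ᵐ x, x ∈ S → f x = 0 := by
  have : volume {x | ¬ (x ∈ S → f x = 0)} = 0 := by
    refine measure_null_of_locally_null _ fun x hx => ?_
    rw [mem_ofPred_eq, Classical.not_imp] at hx
    obtain ⟨U, hU, hxU, h⟩ := hS hx.1
    refine ⟨{y | ¬ (y ∈ U → f y = 0)}, ?_, h⟩
    filter_upwards [mem_nhdsWithin_of_mem_nhds (hU.mem_nhds hxU), self_mem_nhdsWithin] with y hy hy'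
    simp only [mem_ofPred_eq, Classical.not_imp] at hy' ⊢
    exact ⟨hy, hy'.2⟩
  exact this
lemma touching {C W : Set (E n)} (hC : IsOpen C) (hCc : IsPreconnected C) (hW : IsOpen W)
    (hWn : W.Nonempty) (hWC : W ⊆ C) (hne : ¬ C ⊆ W) :
    ∃ q y0 : E n, ∃ R : ℝ, 0 < R ∧ ball q R ⊆ W ∧ ‖y0 - q‖ = R ∧ y0 ∈ C ∧ y0 ∉ W := by
  have h1 : ¬ closure W ∩ C ⊆ W := fun h =>
    hne (hCc.subset_of_closure_inter_subset hW (by rwa [inter_eq_right.2 hWC]) h)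
  obtain ⟨p, ⟨hpW, hpC⟩, hp⟩ := not_subset.1 h1
  obtain ⟨ε, hε, hb⟩ := Metric.isOpen_iff.1 hC p hpC
  obtain ⟨q, hq, hd⟩ := Metric.mem_closure_iff.1 hpW (ε / 2) (by linarith)
  have hcl : IsClosed Wᶜ := hW.isClosed_compl
  obtain ⟨y0, hy0, hR⟩ := hcl.exists_infDist_eq_dist ⟨p, hp⟩ q
  have hle : Metric.infDist q Wᶜ ≤ dist q p := Metric.infDist_le_dist_of_mem hp
  refine ⟨q, y0, Metric.infDist q Wᶜ, ?_, ?_, ?_, hb ?_, hy0⟩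
  · exact (hcl.notMem_iff_infDist_pos ⟨p, hp⟩).1 (by simpa using hq)
  · intro x hx
    by_contra hxW
    have : Metric.infDist q Wᶜ ≤ dist q x := Metric.infDist_le_dist_of_mem hxW
    rw [mem_ball, dist_comm] at hx
    linarith
  · rw [hR, dist_comm, dist_eq_norm]
  · rw [mem_ball]
    have := dist_triangle_left y0 p q
    rw [dist_comm p q] at hd
    linarith
def iv (q x : E n) : E n := (‖x - q‖ ^ 2)⁻¹ • (x - q)
def ivi (q y : E n) : E n := q + (‖y‖ ^ 2)⁻¹ • y
lemma iv_meas (q : E n) : Measurable (iv q) := by unfold iv; fun_prop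
lemma ivi_meas (q : E n) : Measurable (ivi q) := by unfold ivi; fun_prop
lemma ivi_iv (q x : E n) : ivi q (iv q x) = x := by
  by_cases h : x = q
  · simp [h, iv, ivi]
  · have := nsq_ne h
    have h' : ‖x - q‖ ≠ 0 := fun h0 => this (by simp [h0])
    have h3 : ‖iv q x‖ ^ 2 = (‖x - q‖ ^ 2)⁻¹ := by
      rw [iv, norm_smul, norm_inv, norm_pow, norm_norm]; field_simp
    rw [ivi, h3, inv_inv, iv, smul_smul, mul_inv_cancel₀ this, one_smul]; abel
lemma iv_cont {q x : E n} (h : x ≠ q) : ContinuousAt (iv q) x := by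
  unfold iv
  have h1 : ContinuousAt (fun x : E n => ‖x - q‖ ^ 2) x := (cd_nsq q).continuous.continuousAt
  exact (h1.inv₀ (nsq_ne h)).smul (f := fun x : E n => (‖x - q‖ ^ 2)⁻¹) (by fun_prop)
def k0 (q x : E n) : ℝ := Real.exp (-(((n : ℝ) - 2) / 2 * Real.log (‖x - q‖ ^ 2)))
lemma k0_pos (q x : E n) : 0 < k0 q x := Real.exp_pos _
lemma k0_cont {q x : E n} (h : x ≠ q) : ContinuousAt (k0 q) x := by
  unfold k0
  have h1 : ContinuousAt (fun x : E n => ‖x - q‖ ^ 2) x := (cd_nsq q).continuous.continuousAt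
  exact (continuousAt_const.mul (h1.log (nsq_ne h))).neg.rexp
lemma k0_meas (q : E n) : Measurable (k0 q) := by unfold k0; fun_prop
lemma kel_eq (q : E n) (L : E n →L[ℝ] ℂ) (x : E n) : kel q L x = k0 q x * cexp (L (iv q x)) := by
  rw [kel, kph, k0, iv, map_smul, sub_eq_add_neg, Complex.exp_add, mul_comm]
  push_cast
  congr 2
  rw [real_smul]
  push_cast
  rw [mul_comm]; rfl
def cl (a b : E n) : E n →L[ℝ] ℂ := ofRealCLM.comp (innerSL ℝ a) + (I : ℂ) • ofRealCLM.comp (innerSL ℝ b)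
lemma cl_apply (a b x : E n) : cl a b x = ((⟪x, a⟫ : ℝ) : ℂ) + I * ((⟪x, b⟫ : ℝ) : ℂ) := by
  simp [cl, real_inner_comm]
lemma cl_re (a b x : E n) : (cl a b x).re = ⟪x, a⟫ := by simp [cl_apply]
lemma cl_norm (a b v : E n) : ‖cl a b v‖ ≤ (‖a‖ + ‖b‖) * ‖v‖ := by
  rw [cl_apply]
  refine (norm_add_le _ _).trans ?_
  rw [norm_mul, norm_I, one_mul, norm_real, norm_real]
  have := norm_inner_le_norm (𝕜 := ℝ) v a
  have := norm_inner_le_norm (𝕜 := ℝ) v b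
  linarith
lemma cl_sq (a b : E n) : ∑ i, cl a b (eb i) ^ 2 = ((‖a‖ ^ 2 - ‖b‖ ^ 2 : ℝ) : ℂ) + 2 * I * ((⟪a, b⟫ : ℝ) : ℂ) := by
  have h1 := sum_inner_sq a
  have h2 := sum_inner_sq b
  have h3 : ((⟪a, b⟫ : ℝ) : ℂ) = ∑ i, ((⟪a, eb i⟫ : ℝ) : ℂ) * ((⟪b, eb i⟫ : ℝ) : ℂ) := by
    rw [inner_eq_sum]; push_cast; rfl
  push_cast
  push_cast at h1 h2
  rw [← h1, ← h2, h3, ← Finset.sum_sub_distrib, Finset.mul_sum, ← Finset.sum_add_distrib]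
  refine Finset.sum_congr rfl fun i _ => ?_
  rw [cl_apply, real_inner_comm a, real_inner_comm b]
  linear_combination ((⟪b, eb i⟫ : ℝ) : ℂ) ^ 2 * I_sq
structure Loc (q y0 : E n) (R r0 : ℝ) (χ : E n → ℝ) : Prop where
  r0pos : 0 < r0
  hR : 2 * r0 < R
  d : ‖y0 - q‖ = R
  cd : ContDiff ℝ ∞ χ
  one : ∀ x ∈ ball y0 r0, χ x = 1
  ts : tsupport χ ⊆ closedBall y0 (2 * r0)
lemma Loc.exists {q y0 : E n} {R r0 : ℝ} (h0 : 0 < r0) (hR : 2 * r0 < R) (hd : ‖y0 - q‖ = R) :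
    ∃ χ, Loc q y0 R r0 χ := by
  let χ : ContDiffBump y0 := ⟨r0, 2 * r0, h0, by linarith⟩
  exact ⟨χ, h0, hR, hd, χ.contDiff, fun x hx => χ.one_of_mem_closedBall (ball_subset_closedBall hx),
    χ.tsupport_eq.subset⟩
section loc
variable {q y0 : E n} {R r0 : ℝ} {χ : E n → ℝ}
lemma Loc.cs (h : Loc q y0 R r0 χ) : HasCompactSupport χ :=
  (isCompact_closedBall y0 (2 * r0)).of_isClosed_subset (isClosed_tsupport χ) h.ts
lemma Loc.Rpos (h : Loc q y0 R r0 χ) : 0 < R := by linarith [h.r0pos, h.hR]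
lemma Loc.far (h : Loc q y0 R r0 χ) {x : E n} (hx : x ∈ closedBall y0 (2 * r0)) :
    R - 2 * r0 ≤ ‖x - q‖ := by
  rw [mem_closedBall, dist_eq_norm, norm_sub_rev] at hx
  have := norm_add_le (y0 - x) (x - q)
  rw [sub_add_sub_cancel, h.d] at this
  linarith
lemma Loc.ne (h : Loc q y0 R r0 χ) {x : E n} (hx : x ∈ closedBall y0 (2 * r0)) : x ≠ q := by
  have := h.far hx
  have := h.hR
  rintro rfl
  simp at *
  linarith
def kD (q : E n) (χ : E n → ℝ) (L : E n →L[ℝ] ℂ) (x : E n) : ℂ :=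
  (2:ℝ) • ∑ i, pd (eb i) χ x • pd (eb i) (kel q L) x + Lap χ x • kel q L x
lemma Loc.kD_zero (h : Loc q y0 R r0 χ) (L : E n →L[ℝ] ℂ) {x : E n}
    (hx : x ∉ closedBall y0 (2 * r0) ∨ x ∈ ball y0 r0) : kD q χ L x = 0 := by
  have key : (∀ v, pd v χ x = 0) ∧ Lap χ x = 0 := by
    rcases hx with hx | hx
    · have hx' : x ∉ tsupport χ := fun hh => hx (h.ts hh)
      refine ⟨fun v => image_eq_zero_of_notMem_tsupport fun hh => hx' (tsupport_pd _ _ hh),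
        Lap_eq_zero_of_notMem hx'⟩
    · have : χ =ᶠ[𝓝 x] fun _ => (1:ℝ) := by
        filter_upwards [isOpen_ball.mem_nhds hx] with y hy using h.one y hy
      refine ⟨fun v => ?_, ?_⟩
      · rw [(pd_congr this v).self_of_nhds]; simp [pd]
      · rw [Lap_congr this]; 
        have : ∀ v : E n, pd v (fun _ : E n => (1:ℝ)) = fun _ => 0 := fun v => by ext; simp [pd]
        simp only [Lap, this]
        simp [pd]
  simp [kD, key.1, key.2]
lemma Loc.cd_g (h : Loc q y0 R r0 χ) (L : E n →L[ℝ] ℂ) : ContDiff ℝ ∞ fun x => χ x • kel q L x := by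
  rw [contDiff_iff_contDiffAt]
  intro x
  by_cases hx : x = q
  · have : x ∉ tsupport χ := fun hh => h.ne (h.ts hh) hx
    refine (contDiffAt_const (c := (0:ℂ))).congr_of_eventuallyEq ?_
    filter_upwards [notMem_tsupport_iff_eventuallyEq.1 this] with y hy
    simp [hy]
  · exact h.cd.contDiffAt.smul (cd_kel L hx)
lemma Loc.ts_g (h : Loc q y0 R r0 χ) (L : E n →L[ℝ] ℂ) :
    tsupport (fun x => χ x • kel q L x) ⊆ closedBall y0 (2 * r0) :=
  (closure_mono (Function.support_smul_subset_left χ (kel q L))).trans h.ts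
lemma Loc.Lap_g (h : Loc q y0 R r0 χ) (L : E n →L[ℝ] ℂ) (x : E n) :
    Lap (fun x => χ x • kel q L x) x =
      (∑ i, L (eb i) ^ 2) * (χ x / ((‖x - q‖ ^ 2 : ℝ) : ℂ) ^ 2 * kel q L x) + kD q χ L x := by
  by_cases hx : x = q
  · have h1 : x ∉ closedBall y0 (2 * r0) := fun hh => h.ne hh hx
    rw [h.kD_zero L (Or.inl h1), Lap_eq_zero_of_notMem fun hh => h1 (h.ts_g L hh),
      image_eq_zero_of_notMem_tsupport fun hh => h1 (h.ts hh)]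
    simp
  · rw [Lap_smul (O := {q}ᶜ) isOpen_compl_singleton hx h.cd.contDiffOn
      (fun y hy => (cd_kel L hy).contDiffWithinAt), kD, Lap_kel L hx, real_smul]
    ring
lemma Loc.geo (h : Loc q y0 R r0 χ) {x : E n} (hx : R ≤ ‖x - q‖) :
    ⟪iv q x, R⁻¹ • (y0 - q)⟫ ≤ R⁻¹ ∧
    (x ∉ ball y0 r0 → ⟪iv q x, R⁻¹ • (y0 - q)⟫ ≤ R⁻¹ - r0 ^ 2 / (2 * R ^ 3)) ∧
    -R⁻¹ ≤ ⟪iv q x, R⁻¹ • (y0 - q)⟫ := by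
  have hR := h.Rpos
  set ρ := ‖x - q‖ with hρ
  have hρ0 : 0 < ρ := hR.trans_le hx
  have h1 : ‖x - y0‖ ^ 2 = ρ ^ 2 + R ^ 2 - 2 * ⟪x - q, y0 - q⟫ := by
    rw [← h.d, hρ, show x - y0 = (x - q) - (y0 - q) by abel, norm_sub_sq_real]; ring
  have h2 : ⟪iv q x, R⁻¹ • (y0 - q)⟫ = R⁻¹ - R⁻¹ / 2 * (1 - (R ^ 2 - ‖x - y0‖ ^ 2) / ρ ^ 2) := by
    rw [iv, inner_smul_left, inner_smul_right, h1, ← hρ]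
    simp only [conj_trivial]
    field_simp
    ring
  have h3 : |⟪iv q x, R⁻¹ • (y0 - q)⟫| ≤ R⁻¹ := by
    refine (abs_real_inner_le_norm _ _).trans ?_
    rw [norm_smul, norm_inv, h.d, Real.norm_of_nonneg hR.le, inv_mul_cancel₀ hR.ne', mul_one, iv, norm_smul,
      norm_inv, norm_pow, norm_norm, ← hρ]
    calc (ρ ^ 2)⁻¹ * ρ = ρ⁻¹ := by field_simp
      _ ≤ R⁻¹ := inv_anti₀ hR hx
  refine ⟨(abs_le.1 h3).2, fun hr => ?_, (abs_le.1 h3).1⟩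
  rw [h2]
  have h4 : r0 ≤ ‖x - y0‖ := by simpa [dist_eq_norm] using hr
  have h5 : (R ^ 2 - ‖x - y0‖ ^ 2) / ρ ^ 2 ≤ (R ^ 2 - r0 ^ 2) / R ^ 2 := by
    have := h.r0pos
    have := h.hR
    have : r0 ^ 2 ≤ R ^ 2 := by gcongr; linarith
    apply div_le_div₀ (by linarith) _ (by positivity) (by gcongr)
    have : r0 ^ 2 ≤ ‖x - y0‖ ^ 2 := by gcongr
    linarith
  have h6 : r0 ^ 2 / (2 * R ^ 3) = R⁻¹ / 2 * (1 - (R ^ 2 - r0 ^ 2) / R ^ 2) := by field_simp; ring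
  rw [h6]
  gcongr
lemma kdv_bd {L : E n →L[ℝ] ℂ} {N m : ℝ} (hN : ∀ v, ‖L v‖ ≤ N * ‖v‖) (hm : 0 < m) {x : E n}
    (hx : m ≤ ‖x - q‖) {v : E n} (hv : ‖v‖ = 1) :
    ‖kdv q L v x‖ ≤ 3 * N / m ^ 2 + |(n:ℝ) - 2| / m := by
  have hN0 : 0 ≤ N := by have := hN v; rw [hv, mul_one] at this; exact (norm_nonneg _).trans this
  set ρ := ‖x - q‖ with hρ
  have hρ0 : 0 < ρ := hm.trans_le hx
  have hi : |⟪x - q, v⟫| ≤ ρ := by simpa [hv] using abs_real_inner_le_norm (x - q) v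
  have hn : ‖((n:ℂ) - 2)‖ = |(n:ℝ) - 2| := by
    rw [show ((n:ℂ) - 2) = (((n:ℝ) - 2 : ℝ) : ℂ) by push_cast; rfl, norm_real, Real.norm_eq_abs]
  unfold kdv
  rw [← hρ]
  have e1 : ‖L v / ((ρ ^ 2 : ℝ) : ℂ)‖ ≤ N / m ^ 2 := by
    rw [norm_div, norm_real, Real.norm_of_nonneg (by positivity)]
    have := hN v
    rw [hv, mul_one] at this
    gcongr
  have e2 : ‖2 * ((⟪x - q, v⟫ : ℝ) : ℂ) * L (x - q) / ((ρ ^ 2 : ℝ) : ℂ) ^ 2‖ ≤ 2 * N / m ^ 2 := by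
    rw [norm_div, norm_mul, norm_mul, norm_pow, norm_real, norm_real, Real.norm_of_nonneg (by positivity : 0 ≤ ρ ^ 2), Real.norm_eq_abs]
    calc _ ≤ ‖(2:ℂ)‖ * ρ * (N * ρ) / (ρ ^ 2) ^ 2 := by
          gcongr; exact hN _
      _ = 2 * N / ρ ^ 2 := by rw [Complex.norm_ofNat]; field_simp
      _ ≤ _ := by gcongr
  have e3 : ‖((n : ℂ) - 2) * ((⟪x - q, v⟫ : ℝ) : ℂ) / ((ρ ^ 2 : ℝ) : ℂ)‖ ≤ |(n:ℝ) - 2| / m := by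
    rw [norm_div, norm_mul, hn, norm_real, norm_real, Real.norm_of_nonneg (by positivity : 0 ≤ ρ ^ 2), Real.norm_eq_abs]
    calc _ ≤ |(n:ℝ) - 2| * ρ / ρ ^ 2 := by gcongr
      _ = |(n:ℝ) - 2| / ρ := by field_simp
      _ ≤ _ := by gcongr
  refine (norm_sub_le _ _).trans ((add_le_add ((norm_sub_le _ _).trans (add_le_add e1 e2)) e3).trans (le_of_eq ?_))
  ring
lemma bdd_cc {F : Type*} [NormedAddCommGroup F] {f : E n → F} (hf : Continuous f) (hc : HasCompactSupport f) :
    ∃ B, 0 ≤ B ∧ ∀ x, ‖f x‖ ≤ B := by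
  obtain ⟨B, hB⟩ := hc.exists_bound_of_continuous hf
  exact ⟨B, (norm_nonneg _).trans (hB 0), hB⟩
lemma Loc.bd (h : Loc q y0 R r0 χ) : ∃ C : ℝ, 0 ≤ C ∧ (∀ x, ‖χ x‖ ≤ C) ∧
    (∀ x ∈ closedBall y0 (2 * r0), k0 q x ≤ C) ∧
    ∀ (t : ℝ) (b : E n) (x : E n), 0 ≤ t → R ≤ ‖x - q‖ →
      ‖χ x • kel q (cl (t • R⁻¹ • (y0 - q)) b) x‖ ≤ C * Real.exp (t * R⁻¹) ∧
      ‖kD q χ (cl (t • R⁻¹ • (y0 - q)) b) x‖ ≤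
        C * (1 + t + ‖b‖) * Real.exp (t * (R⁻¹ - r0 ^ 2 / (2 * R ^ 3))) := by
  have hR := h.Rpos
  have hm : 0 < R - 2 * r0 := by linarith [h.hR]
  obtain ⟨K0, hK⟩ := (isCompact_closedBall y0 (2 * r0)).exists_bound_of_continuousOn
    (f := k0 q) (fun x hx => (k0_cont (h.ne hx)).continuousWithinAt)
  have hK0 : 0 ≤ K0 := (norm_nonneg _).trans (hK y0 (by simp [h.r0pos.le]))
  obtain ⟨B0, hB0, hb0⟩ := bdd_cc h.cd.continuous h.cs
  have hB1 : ∀ i : Fin n, ∃ B, 0 ≤ B ∧ ∀ x, ‖pd (eb i) χ x‖ ≤ B := fun i =>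
    bdd_cc (cd_pd h.cd _).continuous (hcs_pd h.cs _)
  choose B1 hB1 hb1 using hB1
  obtain ⟨B2, hB2, hb2⟩ := bdd_cc (cd_Lap h.cd).continuous (h.cs.mono' (subset_closure.trans (tsupport_Lap χ)))
  set m := R - 2 * r0 with hmdef
  set A := 3 / m ^ 2 + |(n:ℝ) - 2| / m with hA
  have hA0 : 0 ≤ A := by positivity
  have hS : 0 ≤ ∑ i, B1 i := Finset.sum_nonneg fun i _ => hB1 i
  set C := B0 + K0 + B0 * K0 + (2 * (∑ i, B1 i) * A + B2) * K0 with hC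
  have c1 : 0 ≤ B0 * K0 := by positivity
  have c2 : 0 ≤ (2 * (∑ i, B1 i) * A + B2) * K0 := by positivity
  refine ⟨C, by positivity, fun x => (hb0 x).trans (by linarith), fun x hx => ?_, fun t b x ht hx => ?_⟩
  · have := hK x hx
    rw [Real.norm_of_nonneg (k0_pos _ _).le] at this
    linarith
  set L := cl (t • R⁻¹ • (y0 - q)) b with hL
  have hLn : ∀ v, ‖L v‖ ≤ (t + ‖b‖) * ‖v‖ := fun v => by
    refine (cl_norm _ _ v).trans (le_of_eq ?_)
    rw [norm_smul, norm_smul, norm_inv, h.d, Real.norm_of_nonneg ht, Real.norm_of_nonneg hR.le,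
      inv_mul_cancel₀ hR.ne', mul_one]
  have hkn : x ∈ closedBall y0 (2 * r0) → ‖kel q L x‖ ≤ K0 * Real.exp (t * ⟪iv q x, R⁻¹ • (y0 - q)⟫) := by
    intro hxk
    rw [kel_eq, norm_mul, norm_exp, hL, cl_re, norm_real, inner_smul_right]
    gcongr
    exact hK x hxk
  obtain ⟨g1, g2, -⟩ := h.geo hx
  have hep := Real.exp_pos (t * R⁻¹)
  have hep' := Real.exp_pos (t * (R⁻¹ - r0 ^ 2 / (2 * R ^ 3)))
  by_cases hxk : x ∈ closedBall y0 (2 * r0)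
  · constructor
    · rw [norm_smul]
      calc _ ≤ B0 * (K0 * Real.exp (t * R⁻¹)) := by
            gcongr
            · exact hb0 x
            · exact (hkn hxk).trans (by gcongr)
        _ ≤ _ := by
          rw [← mul_assoc]; gcongr; linarith
    · by_cases hxb : x ∈ ball y0 r0
      · rw [h.kD_zero L (Or.inr hxb), norm_zero]; positivity
      · have hk2 : ‖kel q L x‖ ≤ K0 * Real.exp (t * (R⁻¹ - r0 ^ 2 / (2 * R ^ 3))) :=
          (hkn hxk).trans (by gcongr; exact g2 hxb)
        have hT : (3 * (t + ‖b‖) / m ^ 2 + |(n:ℝ) - 2| / m) ≤ A * (1 + t + ‖b‖) := by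
          have e : A * (1 + t + ‖b‖) = (3 * (t + ‖b‖) / m ^ 2 + |(n:ℝ) - 2| / m) + (3 / m ^ 2 + |(n:ℝ) - 2| / m * (t + ‖b‖)) := by
            rw [hA]; ring
          rw [e]
          have : 0 ≤ (3 / m ^ 2 + |(n:ℝ) - 2| / m * (t + ‖b‖)) := by positivity
          linarith
        have hpd : ∀ i : Fin n, ‖pd (eb i) (kel q L) x‖ ≤ A * (1 + t + ‖b‖) * ‖kel q L x‖ := fun i => by
          rw [pd_kel L (h.ne hxk), norm_mul]
          gcongr
          exact (kdv_bd hLn hm (h.far hxk) (by simp [eb])).trans hT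
        have hsum : ‖∑ i, pd (eb i) χ x • pd (eb i) (kel q L) x‖ ≤ (∑ i, B1 i) * (A * (1 + t + ‖b‖) * ‖kel q L x‖) := by
          rw [Finset.sum_mul]
          refine norm_sum_le_of_le _ fun i _ => ?_
          rw [norm_smul]
          exact mul_le_mul (hb1 i x) (hpd i) (norm_nonneg _) (hB1 i)
        calc ‖kD q χ L x‖ ≤ 2 * ((∑ i, B1 i) * (A * (1 + t + ‖b‖) * ‖kel q L x‖)) + B2 * ‖kel q L x‖ := by
              refine (norm_add_le _ _).trans ?_
              rw [norm_smul, norm_smul, Real.norm_two]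
              gcongr
              exact hb2 x
          _ = (2 * (∑ i, B1 i) * A * (1 + t + ‖b‖) + B2) * ‖kel q L x‖ := by ring
          _ ≤ ((2 * (∑ i, B1 i) * A + B2) * (1 + t + ‖b‖)) * (K0 * Real.exp (t * (R⁻¹ - r0 ^ 2 / (2 * R ^ 3)))) := by
              gcongr
              have : 0 ≤ B2 * (t + ‖b‖) := by positivity
              linarith
          _ = ((2 * (∑ i, B1 i) * A + B2) * K0) * (1 + t + ‖b‖) * Real.exp (t * (R⁻¹ - r0 ^ 2 / (2 * R ^ 3))) := by ring
          _ ≤ _ := by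
              gcongr
              linarith
  · rw [h.kD_zero L (Or.inl hxk), image_eq_zero_of_notMem_tsupport fun hh => hxk (h.ts hh), zero_smul, norm_zero]
    constructor <;> positivity
end loc
end geom
section uc
open Complex
variable {n : ℕ}
lemma pe {δ : ℝ} (hδ : 0 < δ) : ∃ C : ℝ, 0 ≤ C ∧ ∀ l : ℝ, 0 ≤ l → (1 + l) ^ 2 ≤ C * Real.exp (δ * l) := by
  refine ⟨(1 + 2 / δ) ^ 2, by positivity, fun l hl => ?_⟩
  have h1 : 1 + l ≤ (1 + 2 / δ) * Real.exp (δ / 2 * l) := by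
    have := Real.add_one_le_exp (δ / 2 * l)
    calc 1 + l ≤ (1 + 2 / δ) * (δ / 2 * l + 1) := by
          have e : (1 + 2 / δ) * (δ / 2 * l + 1) = 1 + l + (2 / δ + δ / 2 * l) := by field_simp; ring
          rw [e]; have : 0 ≤ 2 / δ + δ / 2 * l := by positivity
          linarith
      _ ≤ _ := by gcongr
  calc (1 + l) ^ 2 ≤ ((1 + 2 / δ) * Real.exp (δ / 2 * l)) ^ 2 := by gcongr
    _ = _ := by rw [mul_pow, ← Real.exp_nat_mul]; ring_nf
lemma pd_clm {F G : Type*} [NormedAddCommGroup F] [NormedSpace ℝ F] [NormedAddCommGroup G] [NormedSpace ℝ G]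
    (p : F →L[ℝ] G) {g : E n → F} {x : E n} (hg : DifferentiableAt ℝ g x) (v : E n) :
    pd v (fun y => p (g y)) x = p (pd v g x) := by
  unfold pd
  rw [HasFDerivAt.fderiv (f := fun y => p (g y)) (p.hasFDerivAt.comp x hg.hasFDerivAt)]; rfl
lemma Lap_clm {F G : Type*} [NormedAddCommGroup F] [NormedSpace ℝ F] [NormedAddCommGroup G] [NormedSpace ℝ G]
    (p : F →L[ℝ] G) {g : E n → F} (hg : ContDiff ℝ ∞ g) (x : E n) :
    Lap (fun y => p (g y)) x = p (Lap g x) := by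
  unfold Lap
  rw [map_sum]
  refine Finset.sum_congr rfl fun i _ => ?_
  have h1 : pd (eb i) (fun y => p (g y)) = fun y => p (pd (eb i) g y) :=
    funext fun y => pd_clm p (hg.differentiable (by simp) y) _
  rw [h1, pd_clm p ((cd_pd hg _).differentiable (by simp) x)]
lemma test_clm (p : ℂ →L[ℝ] ℝ) {g : E n → ℂ} (hg : ContDiff ℝ ∞ g) {K O : Set (E n)} (hK : IsCompact K)
    (hs : tsupport g ⊆ K) (hKO : K ⊆ O) : IsTest O fun x => p (g x) := by
  have h : tsupport (fun x => p (g x)) ⊆ tsupport g :=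
    closure_mono (Function.support_comp_subset (map_zero p) g)
  exact ⟨p.contDiff.comp hg, hK.of_isClosed_subset (isClosed_tsupport _) (h.trans hs), h.trans (hs.trans hKO)⟩
lemma ZZ_of {f : E n → ℝ} {P : E n → Prop} {y : E n} (hP : ∀ᶠ x in 𝓝 y, P x)
    (h : ∀ᵐ x, P x → f x = 0) : y ∈ ZZ f := by
  obtain ⟨U, hU, hUo, hy⟩ := _root_.eventually_nhds_iff.1 hP
  exact ⟨U, hUo, hy, h.mono fun x hx hxU => hx (hU x hxU)⟩
variable {q y0 : E n} {R r0 : ℝ} {χ : E n → ℝ}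
lemma Loc.cont (h : Loc q y0 R r0 χ) {F : Type*} [NormedAddCommGroup F] [NormedSpace ℝ F] {ψ : E n → F}
    (hψ : ∀ x, x ≠ q → ContinuousAt ψ x) : Continuous fun x => χ x • ψ x := by
  rw [continuous_iff_continuousAt]
  intro x
  by_cases hx : x = q
  · have : x ∉ tsupport χ := fun hh => h.ne (h.ts hh) hx
    refine (continuousAt_const (y := (0:F))).congr ?_
    filter_upwards [notMem_tsupport_iff_eventuallyEq.1 this] with y hy
    simp [hy]
  · exact h.cd.continuous.continuousAt.smul (hψ x hx)
lemma Loc.csm (h : Loc q y0 R r0 χ) {F : Type*} [NormedAddCommGroup F] [NormedSpace ℝ F] (ψ : E n → F) :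
    HasCompactSupport fun x => χ x • ψ x := h.cs.smul_right
lemma Loc.near (h : Loc q y0 R r0 χ) {κ : ℝ} (hκ : 0 < κ) :
    ∀ᶠ x in 𝓝 y0, -κ < ⟪iv q x, R⁻¹ • (y0 - q)⟫ - R⁻¹ ∧ χ x = 1 := by
  have hR := h.Rpos
  have hne : y0 ≠ q := h.ne (by simp [h.r0pos.le])
  have h1 : ContinuousAt (fun x => ⟪iv q x, R⁻¹ • (y0 - q)⟫ - R⁻¹) y0 :=
    ((iv_cont hne).inner continuousAt_const).sub continuousAt_const
  have h2 : ⟪iv q y0, R⁻¹ • (y0 - q)⟫ - R⁻¹ = 0 := by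
    rw [iv, inner_smul_left, inner_smul_right, real_inner_self_eq_norm_sq, h.d]
    simp only [conj_trivial]
    field_simp; ring
  refine (h1.eventually_const_lt (by simp only [h2]; linarith)).and ?_
  filter_upwards [ball_mem_nhds y0 h.r0pos] with x hx using h.one x hx
lemma Loc.e1 (h : Loc q y0 R r0 χ) : ‖R⁻¹ • (y0 - q)‖ = 1 := by
  rw [norm_smul, norm_inv, h.d, Real.norm_of_nonneg h.Rpos.le, inv_mul_cancel₀ h.Rpos.ne']
lemma uc_local (h : Loc q y0 R r0 χ) {V : Set (E n)} (hV : closedBall y0 (2 * r0) ⊆ V)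
    {w : E n → ℝ} (hw : M2 w) (hweak : ∀ φ, IsTest V φ → ∫ x, w x * Lap φ x = 0)
    (hz : ∀ᵐ x, x ∈ ball q R → w x = 0) : y0 ∈ ZZ w := by
  have hR := h.Rpos
  have he := h.e1
  set e1 := R⁻¹ • (y0 - q) with he1
  set K := closedBall y0 (2 * r0) with hKdef
  have hK : IsCompact K := isCompact_closedBall _ _
  obtain ⟨C, hC, -, -, hbd⟩ := h.bd
  set δ := r0 ^ 2 / (2 * R ^ 3) with hδ
  have hδ0 : 0 < δ := by have := h.r0pos; positivity
  let m : E n → ℝ := fun x => χ x • (((‖x - q‖ ^ 2)⁻¹) ^ 2 * k0 q x)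
  have hmc : Continuous m := h.cont fun x hx =>
    ((((cd_nsq q).continuous.continuousAt).inv₀ (nsq_ne hx)).pow 2).mul (k0_cont hx)
  have hm2 : M2 m := m2_cc hmc (h.csm _)
  have hF : Integrable fun x => w x * m x := hw.integrable_mul hm2
  have hWi : Integrable (K.indicator fun x => ‖w x‖) := by
    rw [integrable_indicator_iff hK.measurableSet]
    have : IsFiniteMeasure (volume.restrict K) := ⟨by simpa using hK.measure_lt_top⟩
    exact ((hw.restrict K).integrable one_le_two).norm
  have hwC : MemLp (fun x => (w x : ℂ)) 2 volume := hw.ofReal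
  set W := ∫ x, K.indicator (fun x => ‖w x‖) x
  have hW0 : 0 ≤ W := integral_nonneg fun x => indicator_nonneg (fun _ _ => norm_nonneg _) _
  obtain ⟨C2, hC2, hpe⟩ := pe (δ := δ / 2) (by linarith)
  have main := LL (F := fun x => w x * m x) hF (iv_meas q) (ivi_meas q) (ivi_iv q) he (c := R⁻¹)
    (M := 2 * R⁻¹) (κ := δ / 2) ?_ ?_
  · refine ZZ_of (P := fun x => (-(δ / 2) < ⟪iv q x, e1⟫ - R⁻¹ ∧ χ x = 1) ∧ x ≠ q)
      ((h.near (by linarith)).and (ev_ne (h.ne (by simp [h.r0pos.le])))) ?_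
    filter_upwards [main] with x hx hP
    have h1 := hx hP.1.1
    have h2 : m x ≠ 0 := by
      simp only [m, hP.1.2, one_smul]
      have := k0_pos q x
      have := nsq_ne hP.2
      positivity
    exact (mul_eq_zero.1 h1).resolve_right h2
  · filter_upwards [hz] with x hx hne
    have hxR : R ≤ ‖x - q‖ := by
      by_contra hlt
      refine hne ?_
      rw [hx (by simpa [dist_eq_norm] using hlt), zero_mul]
    obtain ⟨g1, -, g3⟩ := h.geo hxR
    constructor <;> linarith
  · intro ξ hξ
    refine ⟨C * (1 + ‖ξ‖) * W * C2, ‖ξ‖ + 1, fun l hl => ?_⟩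
    have hl0 : 0 ≤ l := by linarith [norm_nonneg ξ]
    set L := cl (l • e1) ξ with hL
    let u : E n → ℂ := fun x => χ x • ((((‖x - q‖ ^ 2 : ℝ) : ℂ)⁻¹) ^ 2 * kel q L x)
    have huc : Continuous u := h.cont fun x hx => by
      refine ContinuousAt.mul (ContinuousAt.pow (ContinuousAt.inv₀ ?_ ?_) 2) (cd_kel L hx).continuousAt
      · exact (continuous_ofReal.comp (cd_nsq q).continuous).continuousAt
      · exact_mod_cast nsq_ne hx
    have hu2 : MemLp u 2 volume := huc.memLp_of_hasCompactSupport (h.csm _)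
    let g : E n → ℂ := fun x => χ x • kel q L x
    have hg : ContDiff ℝ ∞ g := h.cd_g L
    have hts : tsupport g ⊆ K := h.ts_g L
    have hLg2 : MemLp (Lap g) 2 volume := (cd_Lap hg).continuous.memLp_of_hasCompactSupport
      (hK.of_isClosed_subset (isClosed_tsupport _) ((tsupport_Lap g).trans hts))
    set Q := ∑ i, L (eb i) ^ 2 with hQ
    have hLap : ∀ x, Lap g x = Q * u x + kD q χ L x := fun x => by
      rw [h.Lap_g L x]
      congr 2
      simp only [u, real_smul]
      rw [← mul_assoc, inv_pow, div_eq_mul_inv]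
    have hI1 : Integrable fun x => (w x : ℂ) * Lap g x := hwC.integrable_mul hLg2
    have hI2 : Integrable fun x => (w x : ℂ) * u x := hwC.integrable_mul hu2
    have hzero : ∫ x, (w x : ℂ) * Lap g x = 0 := by
      have key : ∀ p : ℂ →L[ℝ] ℝ, p (∫ x, (w x : ℂ) * Lap g x) = 0 := fun p => by
        rw [← p.integral_comp_comm hI1, ← hweak _ (test_clm p hg hK hts hV)]
        congr 1; ext x
        rw [Lap_clm p hg, ← real_smul, map_smul, smul_eq_mul]
      exact Complex.ext (key reCLM) (key imCLM)
    have hsp : Q * ∫ x, (w x : ℂ) * u x = - ∫ x, (w x : ℂ) * kD q χ L x := by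
      rw [eq_neg_iff_add_eq_zero, ← hzero, ← integral_const_mul, ← integral_add]
      · congr 1; ext x; rw [hLap]; ring
      · exact hI2.const_mul Q
      · refine (hI1.sub (hI2.const_mul Q)).congr (.of_forall fun x => ?_)
        simp only [Pi.sub_apply, hLap]; ring
    have hQ1 : 1 ≤ ‖Q‖ := by
      rw [hQ, hL, cl_sq, inner_smul_left, real_inner_comm, hξ, norm_smul, he]
      simp only [mul_zero, ofReal_zero, add_zero, mul_one]
      rw [norm_real, Real.norm_of_nonneg hl0, Real.norm_eq_abs]
      refine le_trans ?_ (le_abs_self _)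
      nlinarith [norm_nonneg ξ]
    have hest : ‖∫ x, (w x : ℂ) * kD q χ L x‖ ≤ (C * (1 + l + ‖ξ‖) * Real.exp (l * (R⁻¹ - δ))) * W := by
      rw [← integral_const_mul]
      refine norm_integral_le_of_norm_le (hWi.const_mul _) ?_
      filter_upwards [hz] with x hx
      by_cases hxK : x ∈ K
      · rw [indicator_of_mem hxK, norm_mul, norm_real, mul_comm]
        by_cases hxR : R ≤ ‖x - q‖
        · exact mul_le_mul_of_nonneg_right (hbd l ξ x hl0 hxR).2 (norm_nonneg _)
        · rw [hx (by simpa [dist_eq_norm] using hxR)]; simp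
      · rw [h.kD_zero L (Or.inl hxK), indicator_of_notMem hxK]; simp
    have hu : ∫ x, ((w x * m x : ℝ) : ℂ) * cexp ((l * (⟪iv q x, e1⟫ - R⁻¹) : ℝ) + (⟪iv q x, ξ⟫ : ℝ) * I) =
        ((Real.exp (-(l * R⁻¹)) : ℝ) : ℂ) * ∫ x, (w x : ℂ) * u x := by
      rw [← integral_const_mul]
      congr 1; ext x
      simp only [u, m, kel_eq, hL, cl_apply, real_smul, smul_eq_mul, inner_smul_right]
      push_cast
      rw [show (l:ℂ) * ((⟪iv q x, e1⟫:ℝ) - (R:ℂ)⁻¹) + (⟪iv q x, ξ⟫:ℝ) * I =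
        -((l:ℂ) * (R:ℂ)⁻¹) + ((l:ℂ) * (⟪iv q x, e1⟫:ℝ) + I * (⟪iv q x, ξ⟫:ℝ)) by ring, Complex.exp_add]
      ring
    rw [hu, norm_mul, norm_real, Real.norm_of_nonneg (Real.exp_pos _).le]
    have h5 : ‖∫ x, (w x : ℂ) * u x‖ ≤ (C * (1 + l + ‖ξ‖) * Real.exp (l * (R⁻¹ - δ))) * W := by
      refine le_trans ?_ hest
      rw [← norm_neg (∫ x, (w x : ℂ) * kD q χ L x), ← hsp, norm_mul]
      exact le_mul_of_one_le_left (norm_nonneg _) hQ1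
    have h6 : (1 + l + ‖ξ‖) ≤ (1 + ‖ξ‖) * (C2 * Real.exp (δ / 2 * l)) := by
      refine le_trans ?_ (mul_le_mul_of_nonneg_left (hpe l hl0) (by positivity))
      nlinarith [norm_nonneg ξ, mul_nonneg hl0 (norm_nonneg ξ), mul_nonneg hl0 (mul_nonneg hl0 (norm_nonneg ξ))]
    calc _ ≤ Real.exp (-(l * R⁻¹)) * ((C * ((1 + ‖ξ‖) * (C2 * Real.exp (δ / 2 * l))) * Real.exp (l * (R⁻¹ - δ))) * W) := by
          refine mul_le_mul_of_nonneg_left (h5.trans ?_) (Real.exp_pos _).le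
          gcongr
      _ = C * (1 + ‖ξ‖) * W * C2 * (Real.exp (-(l * R⁻¹)) * Real.exp (δ / 2 * l) * Real.exp (l * (R⁻¹ - δ))) := by ring
      _ = _ := by
          rw [← Real.exp_add, ← Real.exp_add]
          congr 2; ring
lemma uc {V B : Set (E n)} (hV : IsOpen V) (hVc : IsPreconnected V) (hB : IsOpen B) (hBn : (B ∩ V).Nonempty)
    {w : E n → ℝ} (hw : M2 w) (hweak : ∀ φ, IsTest V φ → ∫ x, w x * Lap φ x = 0)
    (hz : ∀ᵐ x, x ∈ B → w x = 0) : ∀ᵐ x, x ∈ V → w x = 0 := by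
  by_cases hsub : V ⊆ ZZ w ∩ V
  · exact ae_ZZ fun x hx => (hsub hx).1
  exfalso
  obtain ⟨q, y0, R, hR, hball, hd, hy, hyn⟩ := touching hV hVc ((ZZ_open w).inter hV)
    (hBn.mono fun x hx => ⟨⟨B, hB, hx.1, hz⟩, hx.2⟩) inter_subset_right hsub
  obtain ⟨ε, hε, hεV⟩ := Metric.isOpen_iff.1 hV y0 hy
  obtain ⟨χ, hχ⟩ := Loc.exists (q := q) (y0 := y0) (R := R) (r0 := min (ε / 4) (R / 4)) (by positivity)
    (by linarith [min_le_right (ε / 4) (R / 4)]) hd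
  refine hyn ⟨uc_local hχ (V := V) ?_ hw hweak (ae_ZZ (hball.trans inter_subset_left)), hy⟩
  refine (Metric.closedBall_subset_ball ?_).trans hεV
  linarith [min_le_left (ε / 4) (R / 4)]
end uc
section orth
open Complex
variable {n : ℕ} {f : E n → ℝ} {Mf : ℝ}
lemma fm2 (hfm : AEStronglyMeasurable f volume) (hfb : ∀ x, ‖f x‖ ≤ Mf) {g : E n → ℝ} (hg : M2 g) :
    M2 fun x => f x * g x :=
  (hg.const_mul Mf).mono (hfm.mul hg.1) (.of_forall fun x => by
    rw [norm_mul, norm_mul]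
    gcongr
    exact (hfb x).trans (le_abs_self _))
def mf (hfm : AEStronglyMeasurable f volume) (hfb : ∀ x, ‖f x‖ ≤ Mf) : L2 n →L[ℝ] L2 n :=
  LinearMap.mkContinuous
    { toFun := fun g => l2 fun x => f x * g x
      map_add' := fun g h => by
        rw [← l2_add (fm2 hfm hfb (Lp.memLp g)) (fm2 hfm hfb (Lp.memLp h))]
        refine l2_congr ((fm2 hfm hfb (Lp.memLp g)).add (fm2 hfm hfb (Lp.memLp h))) ?_
        filter_upwards [Lp.coeFn_add g h] with x hx
        show f x * (g + h : L2 n) x = _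
        rw [hx]; simp only [Pi.add_apply, mul_add]
      map_smul' := fun c g => by
        rw [RingHom.id_apply, ← l2_smul c (fm2 hfm hfb (Lp.memLp g))]
        refine l2_congr ((fm2 hfm hfb (Lp.memLp g)).const_smul c) ?_
        filter_upwards [Lp.coeFn_smul c g] with x hx
        show f x * (c • g : L2 n) x = _
        rw [hx]; simp only [Pi.smul_apply, smul_eq_mul]; ring }
    Mf fun g => by
      refine Lp.norm_le_mul_norm_of_ae_le_mul ?_
      filter_upwards [l2_coe (fm2 hfm hfb (Lp.memLp g))] with x hx
      simp only [LinearMap.coe_mk, AddHom.coe_mk]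
      rw [hx, norm_mul]
      gcongr
      exact hfb x
lemma mf_l2 (hfm : AEStronglyMeasurable f volume) (hfb : ∀ x, ‖f x‖ ≤ Mf) {g : E n → ℝ} (hg : M2 g) :
    mf hfm hfb (l2 g) = l2 fun x => f x * g x := by
  refine l2_congr (fm2 hfm hfb hg) ?_
  filter_upwards [l2_coe hg] with x hx
  rw [hx]
lemma mf_inner (hfm : AEStronglyMeasurable f volume) (hfb : ∀ x, ‖f x‖ ≤ Mf) (g h : L2 n) :
    ⟪mf hfm hfb g, h⟫ = ∫ x, f x * (g x * h x) := by
  rw [← l2_self h, show mf hfm hfb g = l2 fun x => f x * g x from rfl,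
    inner_l2' (fm2 hfm hfb (Lp.memLp g)) (Lp.memLp h), l2_self]
  simp_rw [mul_assoc]
lemma mf_symm (hfm : AEStronglyMeasurable f volume) (hfb : ∀ x, ‖f x‖ ≤ Mf) (g h : L2 n) :
    ⟪mf hfm hfb g, h⟫ = ⟪g, mf hfm hfb h⟫ := by
  rw [mf_inner, real_inner_comm, mf_inner]
  simp_rw [mul_comm (g _)]
lemma mf_norm (hfm : AEStronglyMeasurable f volume) (hfb : ∀ x, ‖f x‖ ≤ Mf) (g : L2 n) :
    ‖mf hfm hfb g‖ ≤ Mf * ‖g‖ := by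
  have h0 : 0 ≤ Mf := (norm_nonneg _).trans (hfb 0)
  exact ContinuousLinearMap.le_of_opNorm_le _ (LinearMap.mkContinuous_norm_le _ h0 _) g
lemma l2_bd {K : Set (E n)} (hK : MeasurableSet K) (hK' : volume K ≠ ⊤) {g : E n → ℝ} {c : ℝ} (hg : M2 g)
    (h : ∀ᵐ x, ‖g x‖ ≤ c * ‖K.indicator (fun _ => (1:ℝ)) x‖) :
    ‖l2 g‖ ≤ c * ‖l2 (K.indicator fun _ => (1:ℝ))‖ := by
  refine Lp.norm_le_mul_norm_of_ae_le_mul ?_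
  filter_upwards [h, l2_coe hg, l2_coe (memLp_indicator_const 2 hK (1:ℝ) (Or.inr hK'))] with x h1 h2 h3
  rw [h2, h3]; exact h1
variable {O V : Set (E n)}
lemma orth_est (hn : 0 < n) (hO : Bornology.IsBounded O) (hfm : AEStronglyMeasurable f volume) (hfb : ∀ x, ‖f x‖ ≤ Mf)
    (hV : MeasurableSet V)
    (horth : ∀ h k : L2 n, (∀ᵐ x, x ∉ V → h x = 0) → (∀ᵐ x, x ∉ V → k x = 0) →
      ⟪mf hfm hfb (GG O h), GG O k⟫ = 0) {φ ψ : E n → ℝ} (hφ : IsTest O φ) (hψ : IsTest O ψ)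
    {N1 N2 P1 P2 : ℝ} (hN1 : ‖l2 fun x => f x * φ x‖ ≤ N1) (hN2 : ‖l2 fun x => f x * ψ x‖ ≤ N2)
    (hP1 : ‖l2 (Vᶜ.indicator (-Lap φ))‖ ≤ P1) (hP2 : ‖l2 (Vᶜ.indicator (-Lap ψ))‖ ≤ P2) :
    |∫ x, f x * (φ x * ψ x)| ≤ ‖GG O‖ * (N1 * P2 + P1 * N2) + Mf * ‖GG O‖ ^ 2 * P1 * P2 := by
  have h0 : 0 ≤ Mf := (norm_nonneg _).trans (hfb 0)
  have dec : ∀ {φ : E n → ℝ}, IsTest O φ → ∃ h : L2 n, (∀ᵐ x, x ∉ V → h x = 0) ∧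
      GG O h = l2 φ - GG O (l2 (Vᶜ.indicator (-Lap φ))) := fun {φ} hφ => by
    have m0 : M2 (-Lap φ) := hφ.Lap.m2.neg
    have m1 : M2 (V.indicator (-Lap φ)) := m0.indicator hV
    have m2 : M2 (Vᶜ.indicator (-Lap φ)) := m0.indicator hV.compl
    refine ⟨l2 (V.indicator (-Lap φ)), ?_, ?_⟩
    · filter_upwards [l2_coe m1] with x hx hxV
      rw [hx, indicator_of_notMem hxV]
    · rw [← GG_neg_Lap hn hO hφ, ← map_sub, ← l2_sub m0 m2]
      congr 2
      rw [eq_sub_iff_add_eq]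
      exact indicator_self_add_compl V _
  obtain ⟨h, hh, hh'⟩ := dec hφ
  obtain ⟨k, hk, hk'⟩ := dec hψ
  have key := horth h k hh hk
  rw [hh', hk'] at key
  set d1 := GG O (l2 (Vᶜ.indicator (-Lap φ)))
  set d2 := GG O (l2 (Vᶜ.indicator (-Lap ψ)))
  have hd1 : ‖d1‖ ≤ ‖GG O‖ * P1 := ((GG O).le_opNorm _).trans (by gcongr)
  have hd2 : ‖d2‖ ≤ ‖GG O‖ * P2 := ((GG O).le_opNorm _).trans (by gcongr)
  have hP10 := (norm_nonneg _).trans hP1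
  have hP20 := (norm_nonneg _).trans hP2
  have hN10 := (norm_nonneg _).trans hN1
  have e : ∫ x, f x * (φ x * ψ x) = ⟪mf hfm hfb (l2 φ), l2 ψ⟫ := by
    rw [mf_inner]
    refine integral_congr_ae ?_
    filter_upwards [l2_coe hφ.m2, l2_coe hψ.m2] with x h1 h2
    rw [h1, h2]
  rw [map_sub, inner_sub_left, inner_sub_right, inner_sub_right, mf_symm hfm hfb d1 (l2 ψ)] at key
  have e2 : ⟪mf hfm hfb (l2 φ), l2 ψ⟫ = ⟪mf hfm hfb (l2 φ), d2⟫ + ⟪d1, mf hfm hfb (l2 ψ)⟫ - ⟪mf hfm hfb d1, d2⟫ := by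
    linarith
  rw [e, e2, mf_l2 hfm hfb hφ.m2, mf_l2 hfm hfb hψ.m2]
  have t1 : |⟪l2 fun x => f x * φ x, d2⟫| ≤ N1 * (‖GG O‖ * P2) :=
    (abs_real_inner_le_norm _ _).trans (by gcongr)
  have t2 : |⟪d1, l2 fun x => f x * ψ x⟫| ≤ (‖GG O‖ * P1) * N2 :=
    (abs_real_inner_le_norm _ _).trans (by gcongr)
  have t3 : |⟪mf hfm hfb d1, d2⟫| ≤ (Mf * (‖GG O‖ * P1)) * (‖GG O‖ * P2) :=
    (abs_real_inner_le_norm _ _).trans (by gcongr; exact (mf_norm hfm hfb d1).trans (by gcongr))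
  refine (abs_sub _ _).trans ((add_le_add ((abs_add_le _ _).trans (add_le_add t1 t2)) t3).trans (le_of_eq ?_))
  ring
lemma exists_orth (hn : 2 ≤ n) {e1 : E n} (he : ‖e1‖ = 1) {ξ : E n} (hξ : ⟪ξ, e1⟫ = 0) :
    ∃ e2 : E n, ‖e2‖ = 1 ∧ ⟪e1, e2⟫ = 0 ∧ ‖ξ‖ • e2 = ξ := by
  by_cases h0 : ξ = 0
  · have : 1 < Module.finrank ℝ (E n) := by simp [E]; omega
    obtain ⟨v, hv⟩ : ∃ v : E n, v ∉ Submodule.span ℝ {e1} := by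
      by_contra! hc
      have h1 := finrank_span_singleton (K := ℝ) (v := e1) (by rintro rfl; simp at he)
      rw [(Submodule.eq_top_iff'.2 hc : Submodule.span ℝ {e1} = ⊤), finrank_top] at h1
      omega
    have hv0 : v - ⟪e1, v⟫ • e1 ≠ 0 := fun h => hv (by
      rw [sub_eq_zero.1 h]; exact Submodule.smul_mem _ _ (Submodule.mem_span_singleton_self _))
    refine ⟨‖v - ⟪e1, v⟫ • e1‖⁻¹ • (v - ⟪e1, v⟫ • e1), norm_smul_inv_norm (𝕜 := ℝ) hv0, ?_, by simp [h0]⟩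
    rw [inner_smul_right, inner_sub_right, inner_smul_right, real_inner_self_eq_norm_sq, he]; simp
  · refine ⟨‖ξ‖⁻¹ • ξ, norm_smul_inv_norm (𝕜 := ℝ) h0, ?_, smul_inv_smul₀ (norm_ne_zero_iff.2 h0) _⟩
    rw [inner_smul_right, real_inner_comm, hξ, mul_zero]
lemma est_real {s l δ G Mf C v C2 R : ℝ} (hs0 : 0 ≤ s) (hl0 : 0 ≤ l) (hδ0 : 0 ≤ δ) (hG0 : 0 ≤ G) (h0 : 0 ≤ Mf)
    (hC : 0 ≤ C) (hv0 : 0 ≤ v) (hpe : (1 + l) ^ 2 ≤ C2 * Real.exp (δ / 4 * l)) :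
    G * (Mf * C * v * Real.exp ((l + s) / 2 * R⁻¹) * (C * ((1 + s) * (1 + l)) * v * Real.exp ((l - s) / 2 * (R⁻¹ - δ))) +
      C * ((1 + s) * (1 + l)) * v * Real.exp ((l + s) / 2 * (R⁻¹ - δ)) * (Mf * C * v * Real.exp ((l - s) / 2 * R⁻¹))) +
      Mf * G ^ 2 * (C * ((1 + s) * (1 + l)) * v * Real.exp ((l + s) / 2 * (R⁻¹ - δ))) * (C * ((1 + s) * (1 + l)) * v * Real.exp ((l - s) / 2 * (R⁻¹ - δ)))
    ≤ (2 * G * Mf * C ^ 2 * v ^ 2 + Mf * G ^ 2 * C ^ 2 * v ^ 2) * (1 + s) ^ 2 * C2 * Real.exp (δ * s / 2) * (Real.exp (l * R⁻¹) * Real.exp (-(δ / 4) * l)) := by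
  set t1 := (l + s) / 2 with ht1
  set t2 := (l - s) / 2 with ht2
  set A := (2 * G * Mf * C ^ 2 * v ^ 2 + Mf * G ^ 2 * C ^ 2 * v ^ 2) with hA
  have hA0 : 0 ≤ A := by positivity
  set T := (1 + s) * (1 + l) with hT
  have hT1 : 1 ≤ T := by rw [hT]; nlinarith [mul_nonneg hs0 hl0]
  have hTT : T ≤ T ^ 2 := by nlinarith
  set X := Real.exp (l * R⁻¹) * Real.exp (-(δ * t2)) with hX
  have hX0 : 0 ≤ X := by positivity
  have x1 : Real.exp (t1 * R⁻¹) * Real.exp (t2 * (R⁻¹ - δ)) = X := by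
    rw [hX, ← Real.exp_add, ← Real.exp_add]; congr 1; rw [ht1, ht2]; ring
  have x2 : Real.exp (t1 * (R⁻¹ - δ)) * Real.exp (t2 * R⁻¹) ≤ X := by
    rw [hX, ← Real.exp_add, ← Real.exp_add, Real.exp_le_exp, ht1, ht2]
    linarith [mul_nonneg hδ0 hs0]
  have x3 : Real.exp (t1 * (R⁻¹ - δ)) * Real.exp (t2 * (R⁻¹ - δ)) ≤ X := by
    rw [hX, ← Real.exp_add, ← Real.exp_add, Real.exp_le_exp, ht1, ht2]
    linarith [mul_nonneg hδ0 hs0, mul_nonneg hδ0 hl0]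
  have y1 : G * (Mf * C * v * Real.exp (t1 * R⁻¹) * (C * T * v * Real.exp (t2 * (R⁻¹ - δ))) +
      C * T * v * Real.exp (t1 * (R⁻¹ - δ)) * (Mf * C * v * Real.exp (t2 * R⁻¹))) +
      Mf * G ^ 2 * (C * T * v * Real.exp (t1 * (R⁻¹ - δ))) * (C * T * v * Real.exp (t2 * (R⁻¹ - δ)))
      = (G * Mf * C ^ 2 * v ^ 2) * T * (Real.exp (t1 * R⁻¹) * Real.exp (t2 * (R⁻¹ - δ))) +
      (G * Mf * C ^ 2 * v ^ 2) * T * (Real.exp (t1 * (R⁻¹ - δ)) * Real.exp (t2 * R⁻¹)) +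
      (Mf * G ^ 2 * C ^ 2 * v ^ 2) * T ^ 2 * (Real.exp (t1 * (R⁻¹ - δ)) * Real.exp (t2 * (R⁻¹ - δ))) := by ring
  rw [y1, x1]
  calc _ ≤ (G * Mf * C ^ 2 * v ^ 2) * T ^ 2 * X + (G * Mf * C ^ 2 * v ^ 2) * T ^ 2 * X +
        (Mf * G ^ 2 * C ^ 2 * v ^ 2) * T ^ 2 * X := by gcongr
    _ = A * (1 + s) ^ 2 * (1 + l) ^ 2 * X := by rw [hA, hT]; ring
    _ ≤ A * (1 + s) ^ 2 * (C2 * Real.exp (δ / 4 * l)) * X := by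
        gcongr
    _ = A * (1 + s) ^ 2 * C2 * (Real.exp (δ / 4 * l) * Real.exp (-(δ * t2))) * Real.exp (l * R⁻¹) := by rw [hX]; ring
    _ = A * (1 + s) ^ 2 * C2 * (Real.exp (δ * s / 2) * Real.exp (-(δ / 4) * l)) * Real.exp (l * R⁻¹) := by
        congr 2; rw [← Real.exp_add, ← Real.exp_add]; congr 1; rw [ht2]; ring
    _ = _ := by ring
variable {q y0 : E n} {R r0 : ℝ} {χ : E n → ℝ}
set_option maxHeartbeats 1000000 in
lemma orth_local (hn : 2 ≤ n) (h : Loc q y0 R r0 χ) (hO : Bornology.IsBounded O) (hfm : AEStronglyMeasurable f volume)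
    (hfb : ∀ x, ‖f x‖ ≤ Mf) (hV : MeasurableSet V)
    (horth : ∀ h k : L2 n, (∀ᵐ x, x ∉ V → h x = 0) → (∀ᵐ x, x ∉ V → k x = 0) →
      ⟪mf hfm hfb (GG O h), GG O k⟫ = 0) (hKO : closedBall y0 (2 * r0) ⊆ O)
    (hVb : ball q R ⊆ V) (hz : ∀ᵐ x, x ∈ ball q R → f x = 0) : y0 ∈ ZZ f := by
  have hR := h.Rpos
  have he := h.e1
  have h0 : 0 ≤ Mf := (norm_nonneg _).trans (hfb 0)
  set e1 := R⁻¹ • (y0 - q) with he1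
  set K := closedBall y0 (2 * r0) with hKdef
  have hK : IsCompact K := isCompact_closedBall _ _
  obtain ⟨C, hC, -, -, hbd⟩ := h.bd
  set δ := r0 ^ 2 / (2 * R ^ 3) with hδ
  have hδ0 : 0 < δ := by have := h.r0pos; positivity
  let m : E n → ℝ := fun x => χ x • (χ x * k0 q x ^ 2)
  have hmc : Continuous m := h.cont fun x hx => h.cd.continuous.continuousAt.mul ((k0_cont hx).pow 2)
  have hF : Integrable fun x => f x * m x :=
    (hmc.integrable_of_hasCompactSupport (h.csm _)).bdd_mul hfm (.of_forall hfb)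
  set v := ‖l2 (K.indicator fun _ : E n => (1:ℝ))‖ with hv
  have hv0 : 0 ≤ v := norm_nonneg _
  obtain ⟨C2, hC2, hpe⟩ := pe (δ := δ / 4) (by linarith)
  have main := LL (F := fun x => f x * m x) hF (iv_meas q) (ivi_meas q) (ivi_iv q) he (c := R⁻¹)
    (M := 2 * R⁻¹) (κ := δ / 4) ?_ ?_
  · refine ZZ_of (P := fun x => (-(δ / 4) < ⟪iv q x, e1⟫ - R⁻¹ ∧ χ x = 1)) (h.near (by linarith)) ?_
    filter_upwards [main] with x hx hP
    have h1 := hx hP.1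
    have h2 : m x ≠ 0 := by
      simp only [m, hP.2, one_smul, one_mul]
      have := k0_pos q x
      positivity
    exact (mul_eq_zero.1 h1).resolve_right h2
  · filter_upwards [hz] with x hx hne
    have hxR : R ≤ ‖x - q‖ := by
      by_contra hlt
      refine hne ?_
      rw [hx (by simpa [dist_eq_norm] using hlt), zero_mul]
    obtain ⟨g1, -, g3⟩ := h.geo hxR
    constructor <;> linarith
  · intro ξ hξ
    obtain ⟨e2, he2, he12, hse2⟩ := exists_orth hn he hξ
    set s := ‖ξ‖ with hs
    have hs0 : 0 ≤ s := norm_nonneg _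
    set G := ‖GG O‖ with hG
    have hG0 : 0 ≤ G := norm_nonneg _
    set A := (2 * G * Mf * C ^ 2 * v ^ 2 + Mf * G ^ 2 * C ^ 2 * v ^ 2) with hA
    have hA0 : 0 ≤ A := by positivity
    refine ⟨4 * (A * (1 + s) ^ 2 * C2 * Real.exp (δ * s / 2)), s, fun l hl => ?_⟩
    have hl0 : 0 ≤ l := hs0.trans hl
    have one : ∀ (t : ℝ) (b : E n), 0 ≤ t → t ≤ (l + s) / 2 → ‖b‖ = t → ⟪e1, b⟫ = 0 → ∀ p : ℂ →L[ℝ] ℝ, (∀ z, ‖p z‖ ≤ ‖z‖) →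
        IsTest O (fun x => p (χ x • kel q (cl (t • e1) b) x)) ∧
        ‖l2 fun x => f x * p (χ x • kel q (cl (t • e1) b) x)‖ ≤ Mf * C * v * Real.exp (t * R⁻¹) ∧
        ‖l2 (Vᶜ.indicator (-Lap fun x => p (χ x • kel q (cl (t • e1) b) x)))‖ ≤
          C * ((1 + s) * (1 + l)) * v * Real.exp (t * (R⁻¹ - δ)) := by
      intro t b ht htl hb heb p hp
      set L := cl (t • e1) b with hL
      have hg := h.cd_g L
      have hT : IsTest O (fun x => p (χ x • kel q L x)) := test_clm p hg hK (h.ts_g L) hKO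
      have hQ : ∑ i, L (eb i) ^ 2 = 0 := by
        rw [hL, cl_sq, inner_smul_left, heb, norm_smul, he, hb, Real.norm_of_nonneg ht]; simp
      have hLap : ∀ x, Lap (fun x => p (χ x • kel q L x)) x = p (kD q χ L x) := fun x => by
        rw [Lap_clm p hg, h.Lap_g, hQ, zero_mul, zero_add]
      refine ⟨hT, ?_, ?_⟩
      · refine (l2_bd (c := Mf * C * Real.exp (t * R⁻¹)) hK.measurableSet hK.measure_lt_top.ne (fm2 hfm hfb hT.m2) ?_).trans (le_of_eq (by ring))
        filter_upwards [hz] with x hx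
        by_cases hxK : x ∈ K
        · rw [indicator_of_mem hxK, norm_one, mul_one, norm_mul]
          by_cases hxR : R ≤ ‖x - q‖
          · rw [mul_assoc]
            exact mul_le_mul (hfb x) ((hp _).trans (hbd t b x ht hxR).1) (norm_nonneg _) h0
          · rw [hx (by simpa [dist_eq_norm] using hxR), norm_zero, zero_mul]; positivity
        · rw [image_eq_zero_of_notMem_tsupport fun hh => hxK (h.ts hh), zero_smul, map_zero]; simp [hxK]
      · refine (l2_bd (c := C * ((1 + s) * (1 + l)) * Real.exp (t * (R⁻¹ - δ))) hK.measurableSet hK.measure_lt_top.ne (hT.Lap.m2.neg.indicator hV.compl) ?_).trans (le_of_eq (by ring))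
        refine .of_forall fun x => ?_
        by_cases hxV : x ∈ V
        · rw [indicator_of_notMem (by simpa using hxV), norm_zero]; positivity
        rw [indicator_of_mem (mem_compl hxV), Pi.neg_apply, norm_neg, hLap]
        by_cases hxK : x ∈ K
        · rw [indicator_of_mem hxK, norm_one, mul_one]
          have hxR : R ≤ ‖x - q‖ := by
            by_contra hlt
            exact hxV (hVb (by simpa [dist_eq_norm] using hlt))
          refine (hp _).trans ((hbd t b x ht hxR).2.trans ?_)
          gcongr
          rw [hb]; nlinarith
        · rw [h.kD_zero L (Or.inl hxK), map_zero]; simp [hxK]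
    set t1 := (l + s) / 2 with ht1
    set t2 := (l - s) / 2 with ht2
    have ht10 : 0 ≤ t1 := by positivity
    have ht20 : 0 ≤ t2 := by rw [ht2]; linarith
    have ht12 : t2 ≤ t1 := by rw [ht1, ht2]; linarith
    set L1 := cl (t1 • e1) (t1 • e2) with hL1
    set L2' := cl (t2 • e1) (-(t2 • e2)) with hL2
    have o1 := one t1 (t1 • e2) ht10 le_rfl (by rw [norm_smul, he2, mul_one, Real.norm_of_nonneg ht10]) (by rw [inner_smul_right, he12, mul_zero])
    have o2 := one t2 (-(t2 • e2)) ht20 ht12 (by rw [norm_neg, norm_smul, he2, mul_one, Real.norm_of_nonneg ht20]) (by rw [inner_neg_right, inner_smul_right, he12, mul_zero, neg_zero])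
    set g1 : E n → ℂ := fun x => χ x • kel q L1 x with hg1
    set g2 : E n → ℂ := fun x => χ x • kel q L2' x with hg2
    have est : ∀ p p' : ℂ →L[ℝ] ℝ, (∀ z, ‖p z‖ ≤ ‖z‖) → (∀ z, ‖p' z‖ ≤ ‖z‖) →
        |∫ x, f x * (p (g1 x) * p' (g2 x))| ≤ A * (1 + s) ^ 2 * C2 * Real.exp (δ * s / 2) * (Real.exp (l * R⁻¹) * Real.exp (-(δ / 4) * l)) := by
      intro p p' hp hp'
      obtain ⟨a1, a2, a3⟩ := o1 p hp
      obtain ⟨b1, b2, b3⟩ := o2 p' hp'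
      refine (orth_est (by omega) hO hfm hfb hV horth a1 b1 a2 b2 a3 b3).trans ?_
      exact est_real hs0 hl0 hδ0.le hG0 h0 hC hv0 (hpe l hl0)
    have hi : ∀ p p' : ℂ →L[ℝ] ℝ, Integrable fun x => f x * (p (g1 x) * p' (g2 x)) := fun p p' => by
      refine Integrable.bdd_mul ?_ hfm (.of_forall hfb)
      exact (m2_cc ((test_clm p (h.cd_g L1) hK (h.ts_g L1) hKO).cd.continuous) (test_clm p (h.cd_g L1) hK (h.ts_g L1) hKO).cs).integrable_mul
        (m2_cc ((test_clm p' (h.cd_g L2') hK (h.ts_g L2') hKO).cd.continuous) (test_clm p' (h.cd_g L2') hK (h.ts_g L2') hKO).cs)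
    have hu : ∫ x, ((f x * m x : ℝ) : ℂ) * cexp ((l * (⟪iv q x, e1⟫ - R⁻¹) : ℝ) + (⟪iv q x, ξ⟫ : ℝ) * I) =
        ((Real.exp (-(l * R⁻¹)) : ℝ) : ℂ) * ∫ x, (f x : ℂ) * (g1 x * g2 x) := by
      rw [← integral_const_mul]
      congr 1; ext x
      simp only [g1, g2, m, kel_eq, hL1, hL2, cl_apply, real_smul, smul_eq_mul, inner_smul_right, inner_neg_right, ← hse2]
      have hts : (l:ℂ) = t1 + t2 ∧ (s:ℂ) = t1 - t2 := by
        rw [ht1, ht2]; push_cast; constructor <;> ring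
      push_cast
      rw [show (l:ℂ) * ((⟪iv q x, e1⟫:ℝ) - (R:ℂ)⁻¹) + (s:ℂ) * (⟪iv q x, e2⟫:ℝ) * I =
        -((l:ℂ) * (R:ℂ)⁻¹) + (((t1:ℂ) * (⟪iv q x, e1⟫:ℝ) + I * (t1 * (⟪iv q x, e2⟫:ℝ))) + ((t2:ℂ) * (⟪iv q x, e1⟫:ℝ) + I * -(t2 * (⟪iv q x, e2⟫:ℝ)))) by
          rw [hts.1, hts.2]; ring, Complex.exp_add, Complex.exp_add]
      ring
    set B := A * (1 + s) ^ 2 * C2 * Real.exp (δ * s / 2) * (Real.exp (l * R⁻¹) * Real.exp (-(δ / 4) * l)) with hB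
    have hre : ∀ z : ℂ, ‖reCLM z‖ ≤ ‖z‖ := fun z => abs_re_le_norm z
    have him : ∀ z : ℂ, ‖imCLM z‖ ≤ ‖z‖ := fun z => abs_im_le_norm z
    have hsum : ∫ x, (f x : ℂ) * (g1 x * g2 x) =
        (((∫ x, f x * (reCLM (g1 x) * reCLM (g2 x))) - ∫ x, f x * (imCLM (g1 x) * imCLM (g2 x)) : ℝ) : ℂ) +
        (((∫ x, f x * (reCLM (g1 x) * imCLM (g2 x))) + ∫ x, f x * (imCLM (g1 x) * reCLM (g2 x)) : ℝ) : ℂ) * I := by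
      rw [← integral_sub (hi _ _) (hi _ _), ← integral_add (hi _ _) (hi _ _), ← integral_complex_ofReal, ← integral_complex_ofReal,
        ← integral_mul_const, ← integral_add]
      · congr 1; ext x
        simp only [reCLM_apply, imCLM_apply]
        apply Complex.ext <;> simp <;> ring
      · exact ((hi _ _).sub (hi _ _)).ofReal
      · exact ((hi _ _).add (hi _ _)).ofReal.mul_const I
    have hn4 : ‖∫ x, (f x : ℂ) * (g1 x * g2 x)‖ ≤ 4 * B := by
      rw [hsum]
      refine (norm_add_le _ _).trans ?_
      rw [norm_mul, norm_I, mul_one, norm_real, norm_real, Real.norm_eq_abs, Real.norm_eq_abs]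
      have q1 := (abs_sub _ _).trans (add_le_add (est reCLM reCLM hre hre) (est imCLM imCLM him him))
      have q2 := (abs_add_le _ _).trans (add_le_add (est reCLM imCLM hre him) (est imCLM reCLM him hre))
      linarith
    rw [hu, norm_mul, norm_real, Real.norm_of_nonneg (Real.exp_pos _).le]
    calc _ ≤ Real.exp (-(l * R⁻¹)) * (4 * B) := by gcongr
      _ = 4 * (A * (1 + s) ^ 2 * C2 * Real.exp (δ * s / 2)) * (Real.exp (-(l * R⁻¹)) * Real.exp (l * R⁻¹)) * Real.exp (-(δ / 4) * l) := by rw [hB]; ring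
      _ = _ := by rw [← Real.exp_add, neg_add_cancel, Real.exp_zero, mul_one]
lemma orth_ext (hn : 0 < n) (hO : Bornology.IsBounded O) (hfm : AEStronglyMeasurable f volume)
    (hfb : ∀ x, ‖f x‖ ≤ Mf) (hV : IsOpen V) (hVc : IsPreconnected V) (hVO : V ⊆ O) {b : Set (E n)} (hb : IsOpen b)
    (hbn : b.Nonempty) (hbV : b ⊆ V) (hz : ∀ᵐ x, x ∈ V → f x = 0) (k : L2 n)
    (H : ∀ φ, IsTest b φ → ⟪mf hfm hfb (GG O k), GG O (l2 φ)⟫ = 0) (h : L2 n) (hh : ∀ᵐ x, x ∉ V → h x = 0) :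
    ⟪mf hfm hfb (GG O k), GG O h⟫ = 0 := by
  set w := GG O (mf hfm hfb (GG O k)) with hw
  have key : ∀ᵐ x, x ∈ V → w x = 0 := by
    refine uc hV hVc hb (by rwa [inter_eq_left.2 hbV]) (Lp.memLp w) (fun φ hφ => ?_) ?_
    · rw [hw, GG_weak hn hO _ (hφ.mono hVO), neg_eq_zero]
      refine integral_eq_zero_of_ae ?_
      filter_upwards [hz, l2_coe (fm2 hfm hfb (Lp.memLp (GG O k)))] with x h1 h2
      by_cases hx : x ∈ V
      · change mf hfm hfb (GG O k) x = _ at h2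
        rw [h2, h1 hx]; simp
      · rw [image_eq_zero_of_notMem_tsupport fun hh => hx (hφ.ts hh)]; simp
    · have hli : LocallyIntegrableOn (fun x => w x) b volume :=
        ((Lp.memLp w).locallyIntegrable (by norm_num)).locallyIntegrableOn b
      refine hb.ae_eq_zero_of_integral_contDiff_smul_eq_zero hli fun g hg hgc hgs => ?_
      have hT : IsTest b g := ⟨hg, hgc, hgs⟩
      rw [← H g hT, ← GG_symm hn hO, ← hw, inner_Lp_l2 _ hT.m2]
      simp only [smul_eq_mul, mul_comm]
  rw [← GG_symm hn hO, ← hw, inner_Lp]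
  refine integral_eq_zero_of_ae ?_
  filter_upwards [key, hh] with x h1 h2
  by_cases hx : x ∈ V
  · simp [h1 hx]
  · simp [h2 hx]
lemma orth_global (hn : 2 ≤ n) (hO : Bornology.IsBounded O) (hfm : AEStronglyMeasurable f volume)
    (hfb : ∀ x, ‖f x‖ ≤ Mf) {C b : Set (E n)} (hC : IsOpen C) (hCc : IsPreconnected C) (hCO : C ⊆ O) (hb : IsOpen b)
    (hbc : IsPreconnected b) {b0 : E n} (hb0 : b0 ∈ b) (hbC : b ⊆ C) (hz : ∀ᵐ x, x ∈ b → f x = 0)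
    (H : ∀ φ ψ, IsTest b φ → IsTest b ψ → ∫ x, f x * (GG O (l2 φ) x * GG O (l2 ψ) x) = 0) :
    ∀ᵐ x, x ∈ C → f x = 0 := by
  have hn0 : 0 < n := by omega
  have hbZ : b ⊆ ZZ f := fun x hx => ⟨b, hb, hx, hz⟩
  have hbCZ : b ⊆ C ∩ ZZ f := subset_inter hbC hbZ
  have hCZ : IsOpen (C ∩ ZZ f) := hC.inter (ZZ_open f)
  set V := connectedComponentIn (C ∩ ZZ f) b0 with hVdef
  have hVo : IsOpen V := hCZ.connectedComponentIn
  have hVc : IsPreconnected V := isPreconnected_connectedComponentIn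
  have hVs : V ⊆ C ∩ ZZ f := connectedComponentIn_subset _ _
  have hbV : b ⊆ V := hbc.subset_connectedComponentIn hb0 hbCZ
  have hVC : V ⊆ C := fun x hx => (hVs hx).1
  have hVz : ∀ᵐ x, x ∈ V → f x = 0 := ae_ZZ fun x hx => (hVs hx).2
  have s1 : ∀ φ, IsTest b φ → ∀ h : L2 n, (∀ᵐ x, x ∉ V → h x = 0) → ⟪mf hfm hfb (GG O (l2 φ)), GG O h⟫ = 0 :=
    fun φ hφ => orth_ext hn0 hO hfm hfb hVo hVc (hVC.trans hCO) hb ⟨b0, hb0⟩ hbV hVz _ fun ψ hψ => by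
      rw [mf_inner]; exact H φ ψ hφ hψ
  have s2 : ∀ h k : L2 n, (∀ᵐ x, x ∉ V → h x = 0) → (∀ᵐ x, x ∉ V → k x = 0) →
      ⟪mf hfm hfb (GG O h), GG O k⟫ = 0 := fun h k hh hk =>
    orth_ext hn0 hO hfm hfb hVo hVc (hVC.trans hCO) hb ⟨b0, hb0⟩ hbV hVz _ (fun ψ hψ => by
      rw [mf_symm, real_inner_comm]; exact s1 ψ hψ h hh) k hk
  by_cases hsub : C ⊆ V
  · filter_upwards [hVz] with x hx hxC using hx (hsub hxC)
  exfalso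
  obtain ⟨q, y0, R, hR, hball, hd, hy, hyn⟩ := touching hC hCc hVo ⟨b0, hbV hb0⟩ hVC hsub
  obtain ⟨ε, hε, hεC⟩ := Metric.isOpen_iff.1 hC y0 hy
  have hr0 : 0 < min (ε / 4) (R / 4) := by positivity
  obtain ⟨χ, hχ⟩ := Loc.exists hr0 (by linarith [min_le_right (ε / 4) (R / 4)]) hd
  have hyZ : y0 ∈ ZZ f := orth_local hn hχ hO hfm hfb hVo.measurableSet s2
    (fun x hx => hCO (hεC (by
      rw [mem_closedBall] at hx
      rw [mem_ball]; linarith [min_le_left (ε / 4) (R / 4)]))) hball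
    (by filter_upwards [hVz] with x hx hxb using hx (hball hxb))
  obtain ⟨r, hr, hrs⟩ := Metric.isOpen_iff.1 hCZ y0 ⟨hy, hyZ⟩
  have hcl : y0 ∈ closure V := closure_mono hball (by
    rw [closure_ball q hR.ne', mem_closedBall, dist_eq_norm, hd])
  obtain ⟨z, hz1, hz2⟩ := mem_closure_iff.1 hcl (ball y0 r) isOpen_ball (mem_ball_self hr)
  have hu : IsPreconnected (V ∪ ball y0 r) :=
    hVc.union z hz2 hz1 (convex_ball y0 r).isPreconnected
  exact hyn (hu.subset_connectedComponentIn (Or.inl (hbV hb0)) (union_subset hVs hrs) (Or.inr (mem_ball_self hr)))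
end orth
section weyl
variable {n : ℕ}
def bt : ContDiffBump (1/2 : ℝ) := ⟨1/8, 1/4, by norm_num, by norm_num⟩
lemma bt_zero {r : ℝ} (h : r ≤ 1/4 ∨ 3/4 ≤ r) : bt r = 0 := by
  refine bt.zero_of_le_dist ?_
  change (1/4 : ℝ) ≤ _
  rw [Real.dist_eq]
  rcases h with h | h
  · rw [abs_of_nonpos (by linarith)]; linarith
  · rw [abs_of_nonneg (by linarith)]; linarith
def bI (a r : ℝ) : ℝ := ∫ s in (0:ℝ)..r, 4⁻¹ * (s ^ (a - 1) * bt s)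
lemma bI_cont (a : ℝ) : ContDiff ℝ ∞ (fun s : ℝ => 4⁻¹ * (s ^ (a - 1) * bt s)) := by
  rw [contDiff_iff_contDiffAt]
  intro s
  by_cases hs : s < 1/4
  · refine (contDiffAt_const (c := (0:ℝ))).congr_of_eventuallyEq ?_
    filter_upwards [Iio_mem_nhds hs] with r hr
    rw [bt_zero (Or.inl (le_of_lt hr))]; simp
  · exact contDiffAt_const.mul ((Real.contDiffAt_rpow_const_of_ne (by linarith)).mul bt.contDiff.contDiffAt)
lemma bI_deriv (a r : ℝ) : HasDerivAt (bI a) (4⁻¹ * (r ^ (a - 1) * bt r)) r :=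
  intervalIntegral.integral_hasDerivAt_right ((bI_cont a).continuous.intervalIntegrable _ _)
    ((bI_cont a).continuous.stronglyMeasurableAtFilter _ _) (bI_cont a).continuous.continuousAt
lemma cd_of_deriv {f g : ℝ → ℝ} (h : ∀ r, HasDerivAt f (g r) r) (hg : ContDiff ℝ ∞ g) : ContDiff ℝ ∞ f := by
  rw [contDiff_infty_iff_deriv]
  exact ⟨fun r => (h r).differentiableAt, by rwa [show deriv f = g from funext fun r => (h r).deriv]⟩
lemma bI_low {a r : ℝ} (h : r ≤ 1/4) : bI a r = 0 := by
  refine intervalIntegral.integral_zero_ae (.of_forall fun s hs => ?_)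
  rw [bt_zero (Or.inl ?_)]; · simp
  rw [mem_uIoc] at hs
  rcases hs with hs | hs <;> linarith [hs.2]
lemma bI_high {a r : ℝ} (h : 1 ≤ r) : bI a r = bI a 1 := by
  rw [← sub_eq_zero, bI, bI, intervalIntegral.integral_interval_sub_left ((bI_cont a).continuous.intervalIntegrable _ _)
    ((bI_cont a).continuous.intervalIntegrable _ _)]
  refine intervalIntegral.integral_zero_ae (.of_forall fun s hs => ?_)
  rw [bt_zero (Or.inr ?_)]; · simp
  rw [uIoc_of_le h] at hs
  linarith [hs.1]
def kk (a s t r : ℝ) : ℝ := r ^ (-a) * (bI a (r / s) - bI a (r / t))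
def pp (a s t r : ℝ) : ℝ := ∫ x in (max s t)..r, kk a s t x
variable {a s t : ℝ}
lemma kk_low (hs : 0 < s) (ht : 0 < t) {r : ℝ} (hr : r ≤ min s t / 4) : kk a s t r = 0 := by
  have h1 : r / s ≤ 1/4 := by rw [div_le_iff₀ hs]; linarith [min_le_left s t]
  have h2 : r / t ≤ 1/4 := by rw [div_le_iff₀ ht]; linarith [min_le_right s t]
  rw [kk, bI_low h1, bI_low h2]; simp
lemma kk_high (hs : 0 < s) (ht : 0 < t) {r : ℝ} (hr : max s t ≤ r) : kk a s t r = 0 := by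
  have h1 : 1 ≤ r / s := by rw [le_div_iff₀ hs]; linarith [le_max_left s t]
  have h2 : 1 ≤ r / t := by rw [le_div_iff₀ ht]; linarith [le_max_right s t]
  rw [kk, bI_high h1, bI_high h2]; simp
lemma cd_kk (hs : 0 < s) (ht : 0 < t) : ContDiff ℝ ∞ (kk a s t) := by
  rw [contDiff_iff_contDiffAt]
  intro r
  by_cases hr : r < min s t / 4
  · refine (contDiffAt_const (c := (0:ℝ))).congr_of_eventuallyEq ?_
    filter_upwards [Iio_mem_nhds hr] with r hr using kk_low hs ht (le_of_lt hr)
  · have hb : ContDiff ℝ ∞ (bI a) := cd_of_deriv (bI_deriv a) (bI_cont a)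
    have : 0 < min s t := lt_min hs ht
    exact (Real.contDiffAt_rpow_const_of_ne (by linarith)).mul
      (((hb.comp (contDiff_id.div_const s)).sub (hb.comp (contDiff_id.div_const t))).contDiffAt)
lemma pp_deriv (hs : 0 < s) (ht : 0 < t) (r : ℝ) : HasDerivAt (pp a s t) (kk a s t r) r :=
  intervalIntegral.integral_hasDerivAt_right ((cd_kk hs ht).continuous.intervalIntegrable _ _)
    ((cd_kk hs ht).continuous.stronglyMeasurableAtFilter _ _) (cd_kk hs ht).continuous.continuousAt
lemma pp_high (hs : 0 < s) (ht : 0 < t) {r : ℝ} (hr : max s t ≤ r) : pp a s t r = 0 := by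
  refine intervalIntegral.integral_zero_ae (.of_forall fun x hx => ?_)
  rw [uIoc_of_le hr] at hx
  exact kk_high hs ht hx.1.le
lemma kk_eq (hs : 0 < s) (ht : 0 < t) {r : ℝ} (hr : 0 ≤ r) :
    4 * r * deriv (kk a s t) r + 4 * a * kk a s t r = s ^ (-a) * bt (r / s) - t ^ (-a) * bt (r / t) := by
  rcases hr.eq_or_lt with rfl | hr
  · rw [kk_low hs ht (by positivity)]
    simp [bt_zero (r := 0) (Or.inl (by norm_num))]
  have hd : ∀ s, HasDerivAt (fun r => bI a (r / s)) (4⁻¹ * ((r / s) ^ (a - 1) * bt (r / s)) * (1 / s)) r := fun s =>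
    HasDerivAt.comp (h₂ := bI a) (h := fun r => r / s) r (bI_deriv a (r / s)) ((hasDerivAt_id' r).div_const s)
  have hk := (Real.hasDerivAt_rpow_const (p := -a) (Or.inl hr.ne')).mul ((hd s).sub (hd t))
  rw [HasDerivAt.deriv (f := kk a s t) hk]
  have e : ∀ s, 0 < s → r ^ (-a) * r * (r / s) ^ (a - 1) * (1 / s) = s ^ (-a) := fun s hs => by
    rw [Real.div_rpow hr.le hs.le, Real.rpow_sub_one hr.ne', Real.rpow_sub_one hs.ne', Real.rpow_neg hr.le, Real.rpow_neg hs.le]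
    have := (Real.rpow_pos_of_pos hr a).ne'
    have := (Real.rpow_pos_of_pos hs a).ne'
    field_simp
  have e3 : r * r ^ (-a - 1) = r ^ (-a) := by rw [Real.rpow_sub_one hr.ne']; field_simp
  simp only [Pi.sub_apply]
  rw [← e s hs, ← e t ht, kk]
  linear_combination (-4 * a * (bI a (r / s) - bI a (r / t))) * e3
def psi (a s t : ℝ) (q y : E n) : ℝ := pp a s t (‖y - q‖ ^ 2)
def et (a s : ℝ) (y : E n) : ℝ := s ^ (-a) * bt (‖y‖ ^ 2 / s)
lemma cd_psi (hs : 0 < s) (ht : 0 < t) (q : E n) : ContDiff ℝ ∞ (psi a s t q) :=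
  (cd_of_deriv (pp_deriv hs ht) (cd_kk hs ht)).comp (cd_nsq q)
lemma nsq_deriv (q y : E n) : HasFDerivAt (fun y => ‖y - q‖ ^ 2) (2 • innerSL ℝ (y - q)) y := by
  have := ((hasFDerivAt_id (𝕜 := ℝ) y).sub_const q).norm_sq
  simpa using this
lemma Lap_psi (hs : 0 < s) (ht : 0 < t) (q y : E n) :
    Lap (psi (n / 2) s t q) y = et (n / 2) s (y - q) - et (n / 2) t (y - q) := by
  set k := kk ((n:ℝ) / 2) s t with hk
  have h1 : ∀ v, pd v (psi (n / 2) s t q) = fun y => k (‖y - q‖ ^ 2) * (2 * ⟪y - q, v⟫) := fun v => by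
    ext y
    rw [pd, HasFDerivAt.fderiv (f := psi ((n:ℝ) / 2) s t q) ((pp_deriv hs ht (‖y - q‖ ^ 2)).comp_hasFDerivAt y (nsq_deriv q y))]
    simp only [smul_apply, innerSL_apply_apply, smul_eq_mul, nsmul_eq_mul, Nat.cast_ofNat, hk]
  have hkd : ∀ r, HasDerivAt k (deriv k r) r := fun r =>
    ((cd_kk hs ht).differentiable (by simp) r).hasDerivAt
  have h2 : ∀ v, pd v (fun y => k (‖y - q‖ ^ 2) * (2 * ⟪y - q, v⟫)) y =
      4 * deriv k (‖y - q‖ ^ 2) * ⟪y - q, v⟫ ^ 2 + 2 * k (‖y - q‖ ^ 2) * ‖v‖ ^ 2 := fun v => by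
    have ha := (hkd (‖y - q‖ ^ 2)).comp_hasFDerivAt y (nsq_deriv q y)
    have hb : HasFDerivAt (fun y : E n => 2 * ⟪y - q, v⟫) ((2:ℝ) • innerSL ℝ v) y := by
      have : (fun y : E n => 2 * ⟪y - q, v⟫) = fun y => ((2:ℝ) • innerSL ℝ v) y - 2 * ⟪q, v⟫ := by
        ext y; simp [inner_sub_left, real_inner_comm]; ring
      rw [this]
      exact ((2:ℝ) • innerSL ℝ v).hasFDerivAt.sub_const _
    rw [pd, HasFDerivAt.fderiv (f := fun y => k (‖y - q‖ ^ 2) * (2 * ⟪y - q, v⟫)) (ha.mul hb)]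
    simp only [smul_apply, add_apply, innerSL_apply_apply, smul_eq_mul, nsmul_eq_mul, Nat.cast_ofNat, real_inner_self_eq_norm_sq, Function.comp]
    ring
  unfold Lap
  simp_rw [h1, h2]
  rw [Finset.sum_add_distrib, ← Finset.mul_sum, et, et, ← kk_eq hs ht (by positivity), ← hk]
  have h3 : ∑ i, ⟪y - q, eb i⟫ ^ 2 = ‖y - q‖ ^ 2 := by
    rw [← real_inner_self_eq_norm_sq, inner_eq_sum]
    exact Finset.sum_congr rfl fun i _ => by ring
  rw [h3]
  simp [eb]; ring
lemma psi_test (hs : 0 < s) (ht : 0 < t) {q : E n} {O : Set (E n)} {ε : ℝ} (hε : 0 < ε) (hs' : s ≤ ε ^ 2) (ht' : t ≤ ε ^ 2)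
    (hO : closedBall q ε ⊆ O) : IsTest O (psi a s t q) := by
  have hsub : tsupport (psi a s t q) ⊆ closedBall q ε := by
    refine closure_minimal (fun y hy => ?_) isClosed_closedBall
    by_contra hc
    refine hy (pp_high hs ht ((max_le hs' ht').trans ?_))
    rw [mem_closedBall, dist_eq_norm, not_le] at hc
    gcongr
  exact ⟨cd_psi hs ht q, (isCompact_closedBall q ε).of_isClosed_subset (isClosed_tsupport _) hsub, hsub.trans hO⟩
lemma cd_et (hs : 0 < s) : ContDiff ℝ ∞ (et a s : E n → ℝ) := by
  have : ContDiff ℝ ∞ (fun y : E n => ‖y‖ ^ 2) := contDiff_id.norm_sq ℝ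
  exact contDiff_const.mul (bt.contDiff.comp (this.div_const s))
lemma et_zero (hs : 0 < s) {y : E n} (h : Real.sqrt s ≤ ‖y‖) : et a s y = 0 := by
  rw [et, bt_zero (Or.inr ?_), mul_zero]
  rw [le_div_iff₀ hs]
  have := Real.sqrt_nonneg s
  nlinarith [Real.sq_sqrt hs.le]
lemma et_cs (hs : 0 < s) : HasCompactSupport (et a s : E n → ℝ) :=
  HasCompactSupport.intro (isCompact_closedBall 0 (Real.sqrt s)) fun y hy => et_zero hs (by
    simp at hy; exact hy.le)
def mass (n : ℕ) : ℝ := ∫ y : E n, bt (‖y‖ ^ 2)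
lemma mass_pos (hn : 0 < n) : 0 < mass n := by
  have hc : Continuous fun y : E n => bt (‖y‖ ^ 2) := bt.continuous.comp (by fun_prop)
  have h1 : (fun y : E n => bt (‖y‖ ^ 2)) = et 0 1 := by ext; simp [et]
  refine hc.integral_pos_of_hasCompactSupport_nonneg_nonzero (x := Real.sqrt (1/2) • eb ⟨0, hn⟩) ?_ (fun _ => bt.nonneg) ?_
  · rw [h1]; exact et_cs one_pos
  · have : ‖Real.sqrt (1/2) • (eb ⟨0, hn⟩ : E n)‖ ^ 2 = 1/2 := by
      rw [norm_smul, mul_pow, Real.norm_eq_abs, sq_abs, Real.sq_sqrt (by norm_num)]; simp [eb]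
    rw [this, bt.one_of_mem_closedBall (Metric.mem_closedBall_self (by change (0:ℝ) ≤ 1/8; norm_num))]
    simp
lemma sqrt_pow_n (hs : 0 < s) : Real.sqrt s ^ n = s ^ ((n:ℝ) / 2) := by
  rw [Real.sqrt_eq_rpow, ← Real.rpow_natCast, ← Real.rpow_mul hs.le]; congr 1; ring
lemma et_mass (hs : 0 < s) : ∫ y : E n, et (n / 2) s y = mass n := by
  have h0 := Real.sqrt_pos.2 hs
  have h1 : ∀ y : E n, et (n / 2) s y = s ^ (-((n:ℝ) / 2)) * bt (‖(Real.sqrt s)⁻¹ • y‖ ^ 2) := fun y => by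
    rw [et, norm_smul, mul_pow, Real.norm_eq_abs, sq_abs, inv_pow, Real.sq_sqrt hs.le]; congr 2; ring
  simp_rw [h1]
  rw [integral_const_mul, Measure.integral_comp_inv_smul volume (fun y : E n => bt (‖y‖ ^ 2)) (Real.sqrt s)]
  simp only [finrank_euclideanSpace, Fintype.card_fin]
  rw [abs_of_pos (by positivity), sqrt_pow_n hs, smul_eq_mul, ← mul_assoc, ← Real.rpow_add hs]
  simp [mass]
def mol (w : E n → ℝ) (s : ℝ) (x : E n) : ℝ := (mass n)⁻¹ * ∫ y, w y * et (n / 2) s (x - y)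
lemma et_even (y : E n) : et a s (-y) = et a s y := by simp [et]
lemma et_bd (hs : 0 < s) (y : E n) : |et (n / 2) s y| ≤ (volume.real (ball (0 : E n) 1)) /
      volume.real (ball (0 : E n) (Real.sqrt s)) := by
  have h0 := Real.sqrt_pos.2 hs
  have hb : 0 < volume.real (ball (0 : E n) 1) :=
    ENNReal.toReal_pos (Metric.measure_ball_pos _ _ one_pos).ne' measure_ball_lt_top.ne
  rw [measureReal_def, measureReal_def, Measure.addHaar_ball_of_pos volume (0 : E n) h0, ENNReal.toReal_mul,
    ENNReal.toReal_ofReal (by positivity), finrank_euclideanSpace, Fintype.card_fin, sqrt_pow_n hs]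
  rw [measureReal_def] at hb
  rw [et, abs_mul, abs_of_nonneg (bt.nonneg), abs_of_pos (Real.rpow_pos_of_pos hs _), Real.rpow_neg hs.le,
    div_mul_cancel_right₀ hb.ne']
  exact mul_le_of_le_one_right (by positivity) bt.le_one
lemma cd_mol (hs : 0 < s) {w : E n → ℝ} (hw : Integrable w) : ContDiff ℝ ∞ (mol w s) := by
  have := HasCompactSupport.contDiff_convolution_right (L := ContinuousLinearMap.mul ℝ ℝ) (μ := volume) (et_cs (a := n / 2) hs)
    hw.locallyIntegrable (cd_et (n := n) hs)
  exact contDiff_const.mul this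
variable {O : Set (E n)} {w : E n → ℝ}
lemma mol_indep (hw : Integrable w) (hweak : ∀ φ, IsTest O φ → ∫ x, w x * Lap φ x = 0) {x : E n} {ε : ℝ} (hε : 0 < ε)
    (hO : closedBall x ε ⊆ O) (hs : 0 < s) (ht : 0 < t) (hs' : s ≤ ε ^ 2) (ht' : t ≤ ε ^ 2) :
    mol w s x = mol w t x := by
  have h := hweak _ (psi_test (a := n / 2) hs ht hε hs' ht' hO)
  simp_rw [Lap_psi hs ht, mul_sub] at h
  have hi : ∀ s, 0 < s → Integrable fun y => w y * et (n / 2) s (y - x) := fun s hs =>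
    hw.mul_bdd (show Continuous fun y : E n => et ((n:ℝ) / 2) s (y - x) from (cd_et hs).continuous.comp (by fun_prop)).aestronglyMeasurable
      (.of_forall fun y => et_bd hs _)
  rw [integral_sub (hi s hs) (hi t ht), sub_eq_zero] at h
  have e : ∀ (s : ℝ) (y : E n), et (n / 2) s (x - y) = et (n / 2) s (y - x) := fun s y => by rw [← et_even, neg_sub]
  simp only [mol, e, h]
lemma mol_ae (hn : 0 < n) (hw : Integrable w) : ∀ᵐ x, Tendsto (fun s => mol w s x) (𝓝[>] 0) (𝓝 (w x)) := by
  filter_upwards [IsUnifLocDoublingMeasure.ae_tendsto_average_norm_sub volume hw.locallyIntegrable 1] with x hx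
  have hsq : Tendsto Real.sqrt (𝓝[>] 0) (𝓝[>] 0) := by
    refine tendsto_nhdsWithin_iff.2 ⟨?_, ?_⟩
    · have := (Real.continuous_sqrt.tendsto 0).mono_left (nhdsWithin_le_nhds (s := Ioi (0:ℝ)))
      simpa using this
    · filter_upwards [self_mem_nhdsWithin] with s hs using Real.sqrt_pos.2 hs
  have h1 := hx (fun _ => x) Real.sqrt hsq (.of_forall fun s => by simp [Real.sqrt_nonneg])
  have h2 := tendsto_integral_smul_of_tendsto_average_norm_sub
    (g := fun s y => (mass n)⁻¹ * et (n / 2) s (x - y))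
    ((mass n)⁻¹ * (volume.real (closedBall (0 : E n) 1))) h1 (.of_forall fun s => hw.integrableOn) ?_ ?_ ?_
  · refine h2.congr fun s => ?_
    rw [mol, ← integral_const_mul]
    congr 1; ext y; simp only [smul_eq_mul]; ring
  · refine tendsto_const_nhds.congr' ?_
    filter_upwards [self_mem_nhdsWithin] with s hs
    rw [integral_const_mul, integral_sub_left_eq_self (fun y => et (n / 2) s y), et_mass hs, inv_mul_cancel₀ (mass_pos hn).ne']
  · filter_upwards [self_mem_nhdsWithin] with s hs y hy
    by_contra hc
    refine hy ?_
    simp only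
    rw [et_zero hs, mul_zero]
    rw [mem_closedBall, dist_comm, dist_eq_norm, not_le] at hc
    exact hc.le
  · filter_upwards [self_mem_nhdsWithin] with s hs y
    rw [abs_mul, abs_of_pos (inv_pos.2 (mass_pos hn)), mul_div_assoc]
    refine mul_le_mul_of_nonneg_left ?_ (inv_pos.2 (mass_pos hn)).le
    have h5 := et_bd hs (x - y)
    have : Nonempty (Fin n) := ⟨⟨0, hn⟩⟩
    have : Nontrivial (E n) := inferInstance
    rw [measureReal_def, measureReal_def, Measure.addHaar_closedBall_eq_addHaar_ball, Measure.addHaar_closedBall_eq_addHaar_ball,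
      Measure.addHaar_ball_center volume x]
    exact h5
lemma weyl (hn : 0 < n) (hO : IsOpen O) (hw : Integrable w) (hweak : ∀ φ, IsTest O φ → ∫ x, w x * Lap φ x = 0) :
    ∃ u : E n → ℝ, ContDiffOn ℝ ∞ u O ∧ (∀ᵐ x, x ∈ O → w x = u x) ∧ ∀ x ∈ O, Lap u x = 0 := by
  have hex : ∀ x : E n, ∃ ε : ℝ, 0 < ε ∧ (x ∈ O → closedBall x ε ⊆ O) := fun x => by
    by_cases hx : x ∈ O
    · obtain ⟨ε, hε, h⟩ := nhds_basis_closedBall.mem_iff.1 (hO.mem_nhds hx)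
      exact ⟨ε, hε, fun _ => h⟩
    · exact ⟨1, one_pos, fun h => absurd h hx⟩
  choose e he heO using hex
  set u : E n → ℝ := fun x => mol w (e x ^ 2) x with hu
  have hloc : ∀ x ∈ O, ∀ᶠ y in 𝓝 x, u y = mol w ((e x / 2) ^ 2) y := fun x hx => by
    filter_upwards [ball_mem_nhds x (half_pos (he x)), hO.mem_nhds hx] with y hy hyO
    have hsub : closedBall y (e x / 2) ⊆ O := fun z hz => heO x hx (by
      rw [mem_closedBall] at hz ⊢
      rw [mem_ball] at hy
      linarith [dist_triangle z y x])
    have a1 := he x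
    have a2 := he y
    have m0 : 0 < min (e y) (e x / 2) := lt_min a2 (half_pos a1)
    rw [hu]
    simp only
    rw [mol_indep hw hweak (he y) (heO y hyO) (s := e y ^ 2) (t := min (e y) (e x / 2) ^ 2) (by positivity) (by positivity) le_rfl
      (by gcongr; exact min_le_left _ _),
      mol_indep hw hweak (half_pos a1) hsub (s := min (e y) (e x / 2) ^ 2) (t := (e x / 2) ^ 2) (by positivity) (by positivity)
      (by gcongr; exact min_le_right _ _) le_rfl]
  have hcd : ContDiffOn ℝ ∞ u O := fun x hx =>
    ((cd_mol (by have := he x; positivity) hw).contDiffAt.congr_of_eventuallyEq (hloc x hx)).contDiffWithinAt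
  have hae : ∀ᵐ x, x ∈ O → w x = u x := by
    filter_upwards [mol_ae hn hw] with x hx hxO
    have a1 := he x
    refine tendsto_nhds_unique hx (tendsto_const_nhds.congr' ?_)
    filter_upwards [self_mem_nhdsWithin, mem_nhdsWithin_of_mem_nhds (Iio_mem_nhds (show 0 < e x ^ 2 by positivity))] with s hs hs'
    exact mol_indep hw hweak a1 (heO x hxO) (by positivity) hs le_rfl (le_of_lt hs')
  refine ⟨u, hcd, hae, fun x hx => ?_⟩
  have a1 := he x
  set U := mol w ((e x / 2) ^ 2) with hU
  have hUc : ContDiff ℝ ∞ U := cd_mol (by positivity) hw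
  obtain ⟨B, hB, hBo, hxB⟩ := _root_.eventually_nhds_iff.1 ((hloc x hx).and (hO.eventually_mem hx))
  rw [Lap_congr (hloc x hx)]
  have h0 : ∀ᵐ y, y ∈ B → Lap U y = 0 := by
    refine hBo.ae_eq_zero_of_integral_contDiff_smul_eq_zero ((cd_Lap hUc).continuous.locallyIntegrable.locallyIntegrableOn B) fun g hg hgc hgs => ?_
    have hT : IsTest O g := ⟨hg, hgc, hgs.trans fun y hy => (hB y hy).2⟩
    have g1 := green hg hgc hUc
    have g2 : ∫ y, ⟪∇ g y, ∇ U y⟫ = - ∫ y, g y * Lap U y := by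
      have h1 : ∀ x, ⟪∇ g x, ∇ U x⟫ = ∑ i, pd (eb i) g x * pd (eb i) U x := by
        intro x; rw [inner_eq_sum]; simp only [inner_grad]
      simp_rw [h1, Lap, Finset.mul_sum]
      rw [integral_finsetSum, integral_finsetSum, ← Finset.sum_neg_distrib]
      · refine Finset.sum_congr rfl fun i _ => ?_
        rw [ibp hg hgc (cd_pd hUc _), neg_neg]
      · exact fun i _ => (hg.continuous.mul (cd_pd (cd_pd hUc _) _).continuous).integrable_of_hasCompactSupport hgc.mul_right
      · exact fun i _ => ((cd_pd hg _).continuous.mul (cd_pd hUc _).continuous).integrable_of_hasCompactSupport (hcs_pd hgc _).mul_right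
    simp only [smul_eq_mul]
    rw [← neg_inj, ← g2, g1, neg_inj, ← hweak g hT]
    refine integral_congr_ae ?_
    filter_upwards [hae] with y hy
    by_cases hyB : y ∈ B
    · rw [hy (hB y hyB).2, (hB y hyB).1, mul_comm]
    · rw [Lap_eq_zero_of_notMem fun h => hyB (hgs h)]; simp
  have := Measure.eqOn_open_of_ae_eq (μ := volume) (f := Lap U) (g := fun _ => 0) ((ae_restrict_iff' hBo.measurableSet).2 h0) hBo
    (cd_Lap hUc).continuous.continuousOn continuousOn_const
  exact this hxB
end weyl
section mop
variable {n : ℕ}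
scoped instance : NormedAddCommGroup (E n →L[ℝ] E n) := ContinuousLinearMap.toNormedAddCommGroup
scoped instance : NormedSpace ℝ (E n →L[ℝ] E n) := ContinuousLinearMap.toNormedSpace
scoped instance : NormedAddCommGroup (E n →L[ℝ] (E n →L[ℝ] E n)) := ContinuousLinearMap.toNormedAddCommGroup
scoped instance : NormedSpace ℝ (E n →L[ℝ] (E n →L[ℝ] E n)) := ContinuousLinearMap.toNormedSpace
scoped instance : ContinuousSub (E n →L[ℝ] (E n →L[ℝ] E n)) := IsTopologicalAddGroup.to_continuousSub
def CC (B : E n → (E n →L[ℝ] E n)) : Prop := Continuous B ∧ HasCompactSupport B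
lemma CC.bd {B : E n → (E n →L[ℝ] E n)} (h : CC B) : ∃ C, 0 ≤ C ∧ ∀ x, ‖B x‖ ≤ C := by
  obtain ⟨C, hC⟩ := h.1.norm.bddAbove_range_of_hasCompactSupport h.2.norm
  have := fun x => hC (mem_range_self x)
  exact ⟨C, (norm_nonneg _).trans (this 0), this⟩
lemma CC.m2 {B : E n → (E n →L[ℝ] E n)} (h : CC B) {v : E n → E n} (hv : M2 v) : M2 fun x => B x (v x) := by
  obtain ⟨C, hC0, hC⟩ := h.bd
  refine MemLp.of_le_mul (c := C) hv ?_ (.of_forall fun x => ((B x).le_opNorm _).trans (by gcongr; exact hC x))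
  exact (ContinuousLinearMap.id ℝ (E n →L[ℝ] E n)).aestronglyMeasurable_comp₂ h.1.aestronglyMeasurable hv.1
open Classical in
def mo (B : E n → (E n →L[ℝ] E n)) : L2E n →L[ℝ] L2E n :=
  if h : CC B then
    LinearMap.mkContinuousOfExistsBound
      { toFun := fun v => l2 fun x => B x (v x)
        map_add' := fun v w => by
          rw [← l2_add (h.m2 (Lp.memLp v)) (h.m2 (Lp.memLp w))]
          refine l2_congr ((h.m2 (Lp.memLp v)).add (h.m2 (Lp.memLp w))) ?_
          filter_upwards [Lp.coeFn_add v w] with x hx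
          rw [hx, Pi.add_apply, map_add]; rfl
        map_smul' := fun c v => by
          rw [RingHom.id_apply, ← l2_smul c (h.m2 (Lp.memLp v))]
          refine l2_congr ((h.m2 (Lp.memLp v)).const_smul c) ?_
          filter_upwards [Lp.coeFn_smul c v] with x hx
          simp [hx] }
      (by
        obtain ⟨C, hC0, hC⟩ := h.bd
        refine ⟨C, fun v => Lp.norm_le_mul_norm_of_ae_le_mul ?_⟩
        filter_upwards [l2_coe (h.m2 (Lp.memLp v))] with x hx
        change ‖l2 (fun x => B x (v x)) x‖ ≤ _
        rw [hx]
        exact ((B x).le_opNorm _).trans (by gcongr; exact hC x))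
  else 0
variable {B B' : E n → (E n →L[ℝ] E n)}
lemma mo_apply (h : CC B) (v : L2E n) : mo B v = l2 fun x => B x (v x) := by
  rw [mo, dif_pos h]; rfl
lemma mo_l2 (h : CC B) {v : E n → E n} (hv : M2 v) : mo B (l2 v) = l2 fun x => B x (v x) := by
  rw [mo_apply h]
  refine l2_congr (h.m2 hv) ?_
  filter_upwards [l2_coe hv] with x hx
  rw [hx]
lemma mo_norm (h : CC B) {C : ℝ} (hC0 : 0 ≤ C) (hC : ∀ x, ‖B x‖ ≤ C) : ‖mo B‖ ≤ C := by
  refine ContinuousLinearMap.opNorm_le_bound _ hC0 fun v => Lp.norm_le_mul_norm_of_ae_le_mul ?_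
  rw [mo_apply h]
  filter_upwards [l2_coe (h.m2 (Lp.memLp v))] with x hx
  rw [hx]
  exact ((B x).le_opNorm _).trans (by gcongr; exact hC x)
lemma mo_add (h : CC B) (h' : CC B') : mo (B + B') = mo B + mo B' := by
  ext1 v
  rw [add_apply, mo_apply h, mo_apply h', mo_apply ⟨h.1.add h'.1, h.2.add h'.2⟩,
    ← l2_add (h.m2 (Lp.memLp v)) (h'.m2 (Lp.memLp v))]
  rfl
lemma CC.smul (h : CC B) (c : ℝ) : CC (c • B) := ⟨h.1.const_smul c, h.2.smul_left (f := fun _ => c)⟩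
lemma mo_smul (h : CC B) (c : ℝ) : mo (c • B) = c • mo B := by
  ext1 v
  rw [smul_apply, mo_apply h, mo_apply (h.smul c), ← l2_smul c (h.m2 (Lp.memLp v))]
  rfl
lemma CC.sub (h : CC B) (h' : CC B') : CC (B - B') := ⟨h.1.sub h'.1, h.2.sub h'.2⟩
lemma mo_sub (h : CC B) (h' : CC B') : mo (B - B') = mo B - mo B' := by
  rw [sub_eq_add_neg, ← neg_one_smul ℝ B', mo_add h (h'.smul _), mo_smul h', neg_one_smul, sub_eq_add_neg]
structure SD (V K : Set (E n)) (a : E n × E n → (E n →L[ℝ] E n)) : Prop where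
  cd : ∀ t ∈ V, ∀ x, ContDiffAt ℝ ∞ a (t, x)
  z : ∀ t ∈ V, ∀ x, x ∉ K → a (t, x) = 0
variable {V K : Set (E n)} {a : E n × E n → (E n →L[ℝ] E n)}
lemma SD.cc (h : SD V K a) (hK : IsCompact K) {t : E n} (ht : t ∈ V) : CC fun x => a (t, x) :=
  ⟨continuous_iff_continuousAt.2 fun x => (h.cd t ht x).continuousAt.comp (f := fun x => (t, x)) (by fun_prop),
    HasCompactSupport.intro hK fun x hx => h.z t ht x hx⟩
lemma SD.hd (h : SD V K a) {t : E n} (ht : t ∈ V) (x : E n) :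
    HasFDerivAt (fun s => a (s, x)) ((fderiv ℝ a (t, x)).comp (ContinuousLinearMap.inl ℝ (E n) (E n))) t :=
  HasFDerivAt.comp (g := a) (f := fun s => (s, x)) t (((h.cd t ht x).differentiableAt (by simp)).hasFDerivAt) (hasFDerivAt_prodMk_left t x)
lemma SD.deriv (hV : IsOpen V) (h : SD V K a) (v : E n) : SD V K fun p => fderiv ℝ a p (v, 0) where
  cd t ht x := ((h.cd t ht x).fderiv_right (m := ∞) le_rfl).clm_apply contDiffAt_const
  z t ht x hx := by
    have h1 := h.hd ht x
    have h2 : (fun s => a (s, x)) =ᶠ[𝓝 t] fun _ => 0 := by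
      filter_upwards [hV.mem_nhds ht] with s hs using h.z s hs x hx
    have h3 := h1.unique ((hasFDerivAt_const (0 : E n →L[ℝ] E n) t).congr_of_eventuallyEq h2)
    simpa using congrArg (fun L => L v) h3
lemma SD.mo_hd (hV : IsOpen V) (hK : IsCompact K) (h : SD V K a) {t : E n} (ht : t ∈ V) :
    ∃ L : E n →L[ℝ] (L2E n →L[ℝ] L2E n), (∀ v, L v = mo fun x => fderiv ℝ a (t, x) (v, 0)) ∧
      HasFDerivAt (fun s => mo fun x => a (s, x)) L t := by
  have hcc := fun v => (h.deriv hV v).cc hK ht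
  let L : E n →ₗ[ℝ] (L2E n →L[ℝ] L2E n) :=
    { toFun := fun v => mo fun x => fderiv ℝ a (t, x) (v, 0)
      map_add' := fun v w => by
        rw [← mo_add (hcc v) (hcc w)]
        congr 1; ext1 x
        rw [Pi.add_apply, ← map_add]; simp
      map_smul' := fun c v => by
        rw [RingHom.id_apply, ← mo_smul (hcc v)]
        congr 1; ext1 x
        rw [Pi.smul_apply, ← map_smul]; simp }
  refine ⟨L.toContinuousLinearMap, fun v => rfl, HasFDerivAt.of_isLittleO (Asymptotics.isLittleO_iff.2 fun c hc => ?_)⟩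
  have hu : ∀ᶠ s in 𝓝 t, ∀ x ∈ K, s ∈ V ∧ ‖(fderiv ℝ a (s, x)).comp (ContinuousLinearMap.inl ℝ (E n) (E n)) -
      (fderiv ℝ a (t, x)).comp (ContinuousLinearMap.inl ℝ (E n) (E n))‖ < c := by
    refine hK.eventually_forall_of_forall_eventually fun x hx => ?_
    have c1 : ContinuousAt (fderiv ℝ a) (t, x) := ((h.cd t ht x).fderiv_right (m := ∞) le_rfl).continuousAt
    have c2 : ContinuousAt (fun p : E n × E n => fderiv ℝ a (t, p.2)) (t, x) :=
      c1.comp (f := fun p : E n × E n => (t, p.2)) (by fun_prop)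
    have c3 : ContinuousAt (fun p : E n × E n => ‖(fderiv ℝ a p).comp (ContinuousLinearMap.inl ℝ (E n) (E n)) -
      (fderiv ℝ a (t, p.2)).comp (ContinuousLinearMap.inl ℝ (E n) (E n))‖) (t, x) :=
      ((c1.clm_comp continuousAt_const).sub (c2.clm_comp continuousAt_const)).norm
    have c4 := c3.eventually_lt (continuousAt_const (y := c)) (by simpa using hc)
    filter_upwards [c4, (continuousAt_fst (p := (t, x))).eventually (hV.eventually_mem ht)] with p h1 h2 using ⟨h2, h1⟩
  obtain ⟨δ, hδ, hb⟩ := eventually_nhds_iff_ball.1 (hu.and (hV.eventually_mem ht))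
  filter_upwards [ball_mem_nhds t hδ] with s hs
  have hsV := (hb s hs).2
  change ‖mo (fun x => a (s, x)) - mo (fun x => a (t, x)) - mo (fun x => fderiv ℝ a (t, x) (s - t, 0))‖ ≤ _
  rw [← mo_sub (h.cc hK hsV) (h.cc hK ht), ← mo_sub ((h.cc hK hsV).sub (h.cc hK ht)) (hcc _)]
  refine mo_norm (((h.cc hK hsV).sub (h.cc hK ht)).sub (hcc _)) (by positivity) fun x => ?_
  by_cases hx : x ∈ K
  · have := (convex_ball t δ).norm_image_sub_le_of_norm_hasFDerivWithin_le' (f := fun s => a (s, x))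
      (fun s hs => (h.hd (hb s hs).2 x).hasFDerivWithinAt) (fun s hs => ((hb s hs).1 x hx).2.le) (mem_ball_self hδ) hs
    simpa using this
  · simp only [Pi.sub_apply, h.z s hsV x hx, h.z t ht x hx, (h.deriv hV (s - t)).z t ht x hx]
    simp; positivity
lemma SD.mo_cd (hV : IsOpen V) (hK : IsCompact K) (h : SD V K a) : ContDiffOn ℝ ∞ (fun s => mo fun x => a (s, x)) V := by
  rw [contDiffOn_infty]
  intro m
  induction m generalizing a with
  | zero =>
    rw [Nat.cast_zero, contDiffOn_zero]
    exact fun t ht => by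
      obtain ⟨L, _, hL⟩ := h.mo_hd hV hK ht
      exact hL.continuousAt.continuousWithinAt
  | succ m ih =>
    rw [Nat.cast_succ, contDiffOn_succ_iff_fderiv_of_isOpen hV]
    refine ⟨fun t ht => ?_, by simp, contDiffOn_clm_apply.2 fun v => (ih (h.deriv hV v)).congr fun t ht => ?_⟩
    · obtain ⟨L, _, hL⟩ := h.mo_hd hV hK ht
      exact hL.differentiableAt.differentiableWithinAt
    · obtain ⟨L, hL', hL⟩ := h.mo_hd hV hK ht
      rw [hL.fderiv, hL']
lemma sol_cd {O : Set (E n)} (hn : 0 < n) (hO : Bornology.IsBounded O) (hV : IsOpen V) (hK : IsCompact K) (h : SD V K a) (h0 : (0 : E n) ∈ V)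
    (ha0 : ∀ x, a (0, x) = 0) (f : L2 n) :
    ∀ᶠ t in 𝓝 (0 : E n), t ∈ V ∧ IsUnit (TT O (ContinuousLinearMap.id ℝ _ + mo fun x => a (t, x))) ∧
      ContDiffAt ℝ ∞ (fun t => sol O (ContinuousLinearMap.id ℝ _ + mo fun x => a (t, x)) f) t := by
  set T : E n → (KK O →L[ℝ] KK O) := fun t => TT O (ContinuousLinearMap.id ℝ _ + mo fun x => a (t, x)) with hT
  have hcd : ContDiffOn ℝ ∞ T V := by
    have := (contDiffOn_const (c := ContinuousLinearMap.id ℝ (L2E n))).add (h.mo_cd hV hK)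
    exact contDiffOn_const.clm_comp (this.clm_comp contDiffOn_const)
  have hT0 : IsUnit (T 0) := by
    have : (fun x => a (0, x)) = (0 : ℝ) • fun x => a (0, x) := by ext1 x; rw [Pi.smul_apply, ha0, smul_zero]
    have h2 := mo_smul (h.cc hK h0) 0
    rw [← this, zero_smul] at h2
    rw [hT]
    simp only
    rw [h2, add_zero]
    exact id_unit hn hO
  have hev : ∀ᶠ t in 𝓝 (0 : E n), IsUnit (T t) :=
    (hcd.continuousOn.continuousAt (hV.mem_nhds h0)).eventually (Units.isOpen.eventually_mem hT0)
  filter_upwards [hev, hV.eventually_mem h0] with t h1 h2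
  refine ⟨h2, h1, ?_⟩
  obtain ⟨u, hu⟩ := h1
  have i1 : ContDiffAt ℝ ∞ (Ring.inverse : (KK O →L[ℝ] KK O) → _) (T t) := by
    rw [← hu]; exact contDiffAt_ringInverse ℝ u
  exact (i1.comp t (hcd.contDiffAt (hV.mem_nhds h2))).clm_apply contDiffAt_const
end mop
section pull
variable {n : ℕ}
structure Dif (O K : Set (E n)) (φ θ : E n → E n) : Prop where
  cd : ContDiff ℝ ∞ φ
  cd' : ContDiff ℝ ∞ θ
  lr : ∀ x, θ (φ x) = x
  rl : ∀ x, φ (θ x) = x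
  off : ∀ x, x ∉ K → φ x = x
  mem : ∀ x, φ x ∈ O ↔ x ∈ O
def AA (Q : E n →L[ℝ] E n) : E n →L[ℝ] E n :=
  |Q.det| • ((Ring.inverse Q) ∘L (Ring.inverse Q)†)
variable {O K : Set (E n)} {φ θ : E n → E n}
lemma Dif.hφ (h : Dif O K φ θ) (x : E n) : HasFDerivAt φ (fderiv ℝ φ x) x :=
  (h.cd.differentiable (by simp) x).hasFDerivAt
lemma Dif.hθ (h : Dif O K φ θ) (x : E n) : HasFDerivAt θ (fderiv ℝ θ x) x :=
  (h.cd'.differentiable (by simp) x).hasFDerivAt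
lemma Dif.PQ (h : Dif O K φ θ) (x : E n) : fderiv ℝ θ (φ x) * fderiv ℝ φ x = 1 := by
  have h1 := (h.hθ (φ x)).comp x (h.hφ x)
  rw [show θ ∘ φ = id from funext h.lr] at h1
  exact h1.unique (hasFDerivAt_id x)
lemma Dif.QP (h : Dif O K φ θ) (x : E n) : fderiv ℝ φ x * fderiv ℝ θ (φ x) = 1 := by
  have h0 := h.hφ (θ (φ x))
  have h1 := h0.comp (φ x) (h.hθ (φ x))
  rw [show φ ∘ θ = id from funext h.rl, h.lr] at h1
  exact h1.unique (hasFDerivAt_id _)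
lemma Dif.inv (h : Dif O K φ θ) (x : E n) : Ring.inverse (fderiv ℝ φ x) = fderiv ℝ θ (φ x) :=
  Ring.inverse_unit (⟨fderiv ℝ φ x, fderiv ℝ θ (φ x), h.QP x, h.PQ x⟩ : (E n →L[ℝ] E n)ˣ)
lemma Dif.test (h : Dif O K φ θ) {η : E n → ℝ} (hη : IsTest O η) : IsTest O (fun y => η (θ y)) := by
  have hc : IsCompact (φ '' tsupport η) := hη.cs.isCompact.image h.cd.continuous
  have hs : tsupport (fun y => η (θ y)) ⊆ φ '' tsupport η :=
    closure_minimal (fun y hy => ⟨θ y, subset_tsupport _ hy, h.rl y⟩) hc.isClosed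
  refine ⟨hη.cd.comp h.cd', hc.of_isClosed_subset (isClosed_tsupport _) hs, hs.trans ?_⟩
  rintro _ ⟨x, hx, rfl⟩
  exact (h.mem x).2 (hη.ts hx)
lemma Dif.symm (h : Dif O K φ θ) : Dif O K θ φ where
  cd := h.cd'
  cd' := h.cd
  lr := h.rl
  rl := h.lr
  off x hx := by
    have := h.lr x
    rwa [h.off x hx] at this
  mem x := by rw [← h.mem (θ x), h.rl]
lemma grad_comp {ψ : E n → ℝ} {φ : E n → E n} {x : E n} (hψ : DifferentiableAt ℝ ψ (φ x)) (hφ : DifferentiableAt ℝ φ x) :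
    ∇ (fun x => ψ (φ x)) x = ((fderiv ℝ φ x)†) (∇ ψ (φ x)) := by
  refine ext_inner_right ℝ fun v => ?_
  rw [inner_grad, ContinuousLinearMap.adjoint_inner_left, inner_grad, pd, pd, fderiv_fun_comp x hψ hφ]
  rfl
lemma Dif.key (h : Dif O K φ θ) {η ψ : E n → ℝ} (hη : IsTest O η) (hψ : IsTest O ψ) :
    ∫ y, ⟪∇ (fun y => η (θ y)) y, ∇ ψ y⟫ = ∫ x, ⟪AA (fderiv ℝ φ x) (∇ η x), ∇ (fun x => ψ (φ x)) x⟫ := by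
  have h1 := integral_image_eq_integral_abs_det_fderiv_smul volume (s := univ) MeasurableSet.univ
    (fun x _ => (h.hφ x).hasFDerivWithinAt) (fun x _ y _ hxy => by rw [← h.lr x, hxy, h.lr])
    (fun y => ⟪∇ (fun y => η (θ y)) y, ∇ ψ y⟫)
  rw [image_univ_of_surjective fun y => ⟨θ y, h.rl y⟩, Measure.restrict_univ] at h1
  rw [h1]
  refine integral_congr_ae (.of_forall fun x => ?_)
  simp only
  rw [grad_comp (hη.diff _) (h.hθ _).differentiableAt, grad_comp (hψ.diff _) (h.hφ _).differentiableAt, h.lr, AA, h.inv,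
    ContinuousLinearMap.adjoint_inner_right, smul_apply, map_smul, real_inner_smul_left, smul_eq_mul,
    ContinuousLinearMap.comp_apply]
  have := congrArg (fun L : E n →L[ℝ] E n => L (((fderiv ℝ θ (φ x))†) (∇ η x))) (h.QP x)
  simp only [mul_apply_eq_comp, one_apply_eq_self] at this
  rw [this]
def BB (φ : E n → E n) (x : E n) : E n →L[ℝ] E n := AA (fderiv ℝ φ x) - 1
lemma Dif.key2 (h : Dif O K φ θ) (hB : CC (BB φ)) {η ψ : E n → ℝ} (hη : IsTest O η) (hψ : IsTest O ψ) :
    ⟪l2 (∇ (fun y => η (θ y))), l2 (∇ ψ)⟫ =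
      ⟪(ContinuousLinearMap.id ℝ (L2E n) + mo (BB φ)) (l2 (∇ η)), l2 (∇ (fun x => ψ (φ x)))⟫ := by
  rw [inner_l2 (h.test hη).gm2 hψ.gm2, h.key hη hψ, add_apply, mo_l2 hB hη.gm2, ContinuousLinearMap.id_apply,
    ← l2_add hη.gm2 (hB.m2 hη.gm2), inner_l2 (hη.gm2.add (hB.m2 hη.gm2)) (h.symm.test hψ).gm2]
  refine integral_congr_ae (.of_forall fun x => ?_)
  simp [BB]
lemma Dif.pull (hn : 0 < n) (hO : Bornology.IsBounded O) (h : Dif O K φ θ) (hB : CC (BB φ))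
    (hu : IsUnit (TT O (ContinuousLinearMap.id ℝ _ + mo (BB φ)))) {f : E n → ℝ} (hf : M2 f) (hfφ : ∀ x, f x ≠ 0 → φ x = x)
    {Ψ Ψ' : E n → ℝ} (hΨ : M2 Ψ) (hΨ' : M2 Ψ') (hh : ∀ η, IsTest O η → ∫ x, η x * Ψ x = ∫ x, η (θ x) * Ψ' x) :
    ⟪fK O (sol O (ContinuousLinearMap.id ℝ _ + mo (BB φ)) (l2 f)), l2 Ψ⟫ = ⟪GG O (l2 f), l2 Ψ'⟫ := by
  set A := ContinuousLinearMap.id ℝ _ + mo (BB φ) with hA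
  set κ := sol O A (l2 f) with hκ
  obtain ⟨η, hη, hl⟩ := K_seq κ
  have hζ := fun k => h.test (hη k)
  have key : ∀ k l, ⟪l2 (∇ (fun y => η k (θ y))), l2 (∇ (fun y => η l (θ y)))⟫ = ⟪A (l2 (∇ (η k))), l2 (∇ (η l))⟫ := fun k l => by
    rw [h.key2 hB (hη k) (hζ l)]
    simp only [h.lr]
    rfl
  obtain ⟨R, hR⟩ := hO.subset_closedBall 0
  have hbd : ∀ k l, ‖jK (hζ k) - jK (hζ l)‖ ^ 2 ≤ (((2 * R) ^ 2 + 1) * ‖A‖) * ‖jK (hη k) - jK (hη l)‖ ^ 2 := fun k l => by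
    have e1 : ‖sK O (jK (hζ k) - jK (hζ l))‖ ^ 2 = ⟪A (sK O (jK (hη k) - jK (hη l))), sK O (jK (hη k) - jK (hη l))⟫ := by
      rw [← real_inner_self_eq_norm_sq]
      simp only [map_sub, sK_jK, inner_sub_left, inner_sub_right, key]
    have e2 := real_inner_le_norm (A (sK O (jK (hη k) - jK (hη l)))) (sK O (jK (hη k) - jK (hη l)))
    have e3 := A.le_opNorm (sK O (jK (hη k) - jK (hη l)))
    have e4 := K_norm (jK (hη k) - jK (hη l))
    have e5 := poincare hn hR (jK (hζ k) - jK (hζ l))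
    have e6 := K_norm (jK (hζ k) - jK (hζ l))
    have e7 : ‖sK O (jK (hζ k) - jK (hζ l))‖ ^ 2 ≤ ‖A‖ * ‖jK (hη k) - jK (hη l)‖ ^ 2 := by
      have : ‖sK O (jK (hη k) - jK (hη l))‖ ^ 2 ≤ ‖jK (hη k) - jK (hη l)‖ ^ 2 := by nlinarith [sq_nonneg ‖fK O (jK (hη k) - jK (hη l))‖]
      calc _ ≤ ‖A‖ * ‖sK O (jK (hη k) - jK (hη l))‖ * ‖sK O (jK (hη k) - jK (hη l))‖ := by
              rw [e1]; exact e2.trans (by gcongr)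
        _ = ‖A‖ * ‖sK O (jK (hη k) - jK (hη l))‖ ^ 2 := by ring
        _ ≤ _ := by gcongr
    calc _ ≤ ((2 * R) ^ 2 + 1) * ‖sK O (jK (hζ k) - jK (hζ l))‖ ^ 2 := by linarith
      _ ≤ ((2 * R) ^ 2 + 1) * (‖A‖ * ‖jK (hη k) - jK (hη l)‖ ^ 2) := by gcongr
      _ = _ := by ring
  have hcau : CauchySeq fun k => jK (hζ k) := by
    rw [Metric.cauchySeq_iff]
    intro ε hε
    set C := ((2 * R) ^ 2 + 1) * ‖A‖ with hC
    have hC0 : 0 ≤ C := by positivity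
    obtain ⟨N, hN⟩ := Metric.cauchySeq_iff.1 hl.cauchySeq (ε / (C + 1)) (by positivity)
    refine ⟨N, fun k hk l hl => ?_⟩
    have h1 := hN k hk l hl
    rw [dist_eq_norm] at h1 ⊢
    have h2 := hbd k l
    refine lt_of_pow_lt_pow_left₀ 2 hε.le (h2.trans_lt ?_)
    calc _ ≤ C * (ε / (C + 1)) ^ 2 := by gcongr
      _ < (C + 1) ^ 2 * (ε / (C + 1)) ^ 2 := by
        have : 0 < (ε / (C + 1)) ^ 2 := by positivity
        gcongr; nlinarith
      _ = ε ^ 2 := by field_simp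
  obtain ⟨κ', hl'⟩ := cauchySeq_tendsto_of_complete hcau
  have hs : sol O (ContinuousLinearMap.id ℝ _) (l2 f) = κ' := by
    refine sol_unique (id_unit hn hO) fun ψ hψ => ?_
    have t1 : Tendsto (fun k => ⟪sK O (jK (hζ k)), l2 (∇ ψ)⟫) atTop (𝓝 ⟪sK O κ', l2 (∇ ψ)⟫) :=
      (((sK O).continuous.tendsto κ').comp hl').inner tendsto_const_nhds
    have t2 : Tendsto (fun k => ⟪A (sK O (jK (hη k))), sK O (jK (h.symm.test hψ))⟫) atTop (𝓝 ⟪A (sK O κ), sK O (jK (h.symm.test hψ))⟫) :=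
      (((A.continuous.comp (sK O).continuous).tendsto κ).comp hl).inner tendsto_const_nhds
    have e : ∀ k, ⟪sK O (jK (hζ k)), l2 (∇ ψ)⟫ = ⟪A (sK O (jK (hη k))), sK O (jK (h.symm.test hψ))⟫ := fun k =>
      h.key2 hB (hη k) hψ
    simp_rw [e] at t1
    rw [ContinuousLinearMap.id_apply, tendsto_nhds_unique t1 t2, hκ, sol_spec hu, fK_jK, inner_l2' hf (h.symm.test hψ).m2, inner_l2' hf hψ.m2]
    refine integral_congr_ae (.of_forall fun x => ?_)
    by_cases hx : f x = 0
    · simp [hx]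
    · simp only [hfφ x hx]
  rw [GG_eq, hs]
  have t1 : Tendsto (fun k => ⟪fK O (jK (hζ k)), l2 Ψ'⟫) atTop (𝓝 ⟪fK O κ', l2 Ψ'⟫) :=
    (((fK O).continuous.tendsto κ').comp hl').inner tendsto_const_nhds
  have t2 : Tendsto (fun k => ⟪fK O (jK (hη k)), l2 Ψ⟫) atTop (𝓝 ⟪fK O κ, l2 Ψ⟫) :=
    (((fK O).continuous.tendsto κ).comp hl).inner tendsto_const_nhds
  have e : ∀ k, ⟪fK O (jK (hζ k)), l2 Ψ'⟫ = ⟪fK O (jK (hη k)), l2 Ψ⟫ := fun k => by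
    rw [fK_jK, fK_jK, inner_l2' (hη k).m2 hΨ, inner_l2' (hζ k).m2 hΨ', hh _ (hη k)]
  simp_rw [e] at t1
  exact tendsto_nhds_unique t2 t1
end pull
section nearid
variable {n : ℕ}
lemma near_id {σ : E n → E n} (hσ : ContDiff ℝ ∞ σ) (hd : ∀ x, ‖fderiv ℝ σ x‖ ≤ 1/2) :
    ∃ θ : E n → E n, ContDiff ℝ ∞ θ ∧ (∀ x, θ (x + σ x) = x) ∧ ∀ y, θ y + σ (θ y) = y := by
  have hdf : Differentiable ℝ σ := hσ.differentiable (by simp)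
  have hap : ApproximatesLinearOn (fun x => x + σ x)
      ((ContinuousLinearEquiv.refl ℝ (E n) : E n ≃L[ℝ] E n) : E n →L[ℝ] E n) univ (1/2) := by
    intro x _ y _
    have := Convex.norm_image_sub_le_of_norm_fderiv_le (𝕜 := ℝ) (f := σ) (C := 1/2)
      (fun x _ => hdf x) (fun x _ => hd x) convex_univ (mem_univ y) (mem_univ x)
    have e : x + σ x - (y + σ y) - ((ContinuousLinearEquiv.refl ℝ (E n) : E n ≃L[ℝ] E n) : E n →L[ℝ] E n) (x - y) = σ x - σ y := by
      simp; abel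
    show ‖x + σ x - (y + σ y) - _‖ ≤ _
    rw [e]; simpa using this
  have hc : Subsingleton (E n) ∨ (1/2 : NNReal) < ‖((ContinuousLinearEquiv.refl ℝ (E n)).symm : E n →L[ℝ] E n)‖₊⁻¹ := by
    rcases subsingleton_or_nontrivial (E n) with h | h
    · exact .inl h
    · right
      have : ‖((ContinuousLinearEquiv.refl ℝ (E n)).symm : E n →L[ℝ] E n)‖₊ = 1 := by
        simp
      rw [this, inv_one]
      exact NNReal.half_lt_self one_ne_zero
  let H := hap.toHomeomorph _ hc
  have hH : ∀ x, H x = x + σ x := fun x => rfl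
  have hu : ∀ x, IsUnit (1 + fderiv ℝ σ x) := by
    intro x
    have : ‖-(fderiv ℝ σ x)‖ < 1 := by rw [norm_neg]; linarith [hd x]
    have h := (Units.oneSub _ this).isUnit
    simpa using h
  choose u hu using hu
  let f' : E n → (E n ≃L[ℝ] E n) := fun x => ContinuousLinearEquiv.unitsEquiv ℝ (E n) (u x)
  have hf' : ∀ x, ((f' x : E n ≃L[ℝ] E n) : E n →L[ℝ] E n) = 1 + fderiv ℝ σ x := by
    intro x; rw [← hu x]; ext v; rfl
  refine ⟨H.symm, H.contDiff_symm (f₀' := f') (fun a => ?_) (contDiff_id.add hσ), fun x => ?_, fun y => ?_⟩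
  · rw [hf' a]
    exact (hasFDerivAt_id a).add (hdf a).hasFDerivAt
  · rw [← hH]; exact H.symm_apply_apply x
  · rw [← hH]; exact H.apply_symm_apply y
end nearid
section shear
variable {n : ℕ}
structure Sh (ν : E n) (g : E n → ℝ) : Prop where
  nu : ‖ν‖ = 1
  cd : ContDiff ℝ ∞ g
  inv : ∀ x (r : ℝ), g (x + r • ν) = g x
def sh (ν : E n) (g : E n → ℝ) (y : E n) : E n := y + g y • ν
def hs (ν : E n) (g : E n → ℝ) (y : E n) : E n := y - g y • ν
variable {ν : E n} {g : E n → ℝ}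
lemma Sh.neg (S : Sh ν g) : Sh ν (fun x => -g x) := ⟨S.nu, S.cd.neg, fun x r => by rw [S.inv]⟩
lemma hs_eq : hs ν g = sh ν (fun x => -g x) := by ext1 y; simp [hs, sh, sub_eq_add_neg]
lemma Sh.hs_sh (S : Sh ν g) (y : E n) : hs ν g (sh ν g y) = y := by
  simp [hs, sh, S.inv]
lemma Sh.sh_hs (S : Sh ν g) (y : E n) : sh ν g (hs ν g y) = y := by
  have := S.inv y (-g y)
  rw [neg_smul, ← sub_eq_add_neg] at this
  simp [hs, sh, this]
lemma Sh.cd_sh (S : Sh ν g) : ContDiff ℝ ∞ (sh ν g) := contDiff_id.add (S.cd.smul contDiff_const)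
lemma Sh.cd_hs (S : Sh ν g) : ContDiff ℝ ∞ (hs ν g) := contDiff_id.sub (S.cd.smul contDiff_const)
lemma Sh.fd (S : Sh ν g) (x : E n) :
    HasFDerivAt (sh ν g) (ContinuousLinearMap.id ℝ (E n) + (fderiv ℝ g x).smulRight ν) x :=
  (hasFDerivAt_id x).add (((S.cd.differentiable (by simp) x).hasFDerivAt).smul_const ν)
lemma Sh.pdnu (S : Sh ν g) (x : E n) : fderiv ℝ g x ν = 0 := by
  have h := (S.cd.differentiable (by simp) x).lineDeriv_eq_fderiv (v := ν)
  rw [← h, lineDeriv]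
  simp [S.inv]
lemma Sh.mp (S : Sh ν g) : MeasurePreserving (hs ν g) volume volume := by
  refine ⟨S.cd_hs.continuous.measurable, Measure.ext fun s hs' => ?_⟩
  rw [Measure.map_apply S.cd_hs.continuous.measurable hs']
  have e : hs ν g ⁻¹' s = sh ν g '' s := by
    ext x; constructor
    · intro h; exact ⟨_, h, S.sh_hs x⟩
    · rintro ⟨y, hy, rfl⟩; rwa [mem_preimage, S.hs_sh]
  rw [e, ← lintegral_abs_det_fderiv_eq_addHaar_image volume hs' (fun x _ => (S.fd x).hasFDerivWithinAt)
    (Function.LeftInverse.injective S.hs_sh).injOn]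
  have hd : ∀ x, (ContinuousLinearMap.id ℝ (E n) + (fderiv ℝ g x).smulRight ν).det = 1 := by
    intro x
    have := LinearMap.transvection.det (fderiv ℝ g x : E n →ₗ[ℝ] ℝ) ν
    rw [show ((fderiv ℝ g x : E n →ₗ[ℝ] ℝ)) ν = 0 from S.pdnu x, add_zero] at this
    rw [← this, ContinuousLinearMap.det]
    congr 1
  simp [hd]
lemma Sh.mp' (S : Sh ν g) : MeasurePreserving (sh ν g) volume volume := by
  have := S.neg.mp
  rwa [hs_eq, show (fun x => - -g x) = g from funext fun x => neg_neg _] at this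
lemma Sh.int (S : Sh ν g) (F : E n → ℝ) : ∫ x, F x = ∫ y, F (sh ν g y) :=
  (S.mp'.integral_comp' (f := (MeasurableEquiv.mk ⟨sh ν g, hs ν g, S.hs_sh, S.sh_hs⟩
    S.cd_sh.continuous.measurable S.cd_hs.continuous.measurable)) F).symm
def tp (ν : E n) : E n →L[ℝ] E n := ContinuousLinearMap.id ℝ _ - (innerSL ℝ ν).smulRight ν
lemma tp_apply (ν t : E n) : tp ν t = t - ⟪ν, t⟫ • ν := by simp [tp]
lemma Sh.tp_nu (S : Sh ν g) (t : E n) : ⟪ν, tp ν t⟫ = 0 := by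
  rw [tp_apply, inner_sub_right, inner_smul_right, real_inner_self_eq_norm_sq, S.nu]; simp
lemma cd_det : ContDiff ℝ ∞ (fun Q : E n →L[ℝ] E n => Q.det) := by
  let b := (EuclideanSpace.basisFun (Fin n) ℝ).toBasis
  have : (fun Q : E n →L[ℝ] E n => Q.det) = fun Q => ∑ s : Equiv.Perm (Fin n), ((Equiv.Perm.sign s : ℤ) : ℝ) * ∏ i, (Q (b i)) (s i) := by
    ext Q
    rw [ContinuousLinearMap.det, ← LinearMap.det_toMatrix b, Matrix.det_apply]
    refine Finset.sum_congr rfl fun s _ => ?_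
    rw [Units.smul_def, zsmul_eq_mul]
    congr 1
    refine Finset.prod_congr rfl fun i _ => ?_
    rw [LinearMap.toMatrix_apply]
    simp [b]
  rw [this]
  refine ContDiff.sum fun s _ => contDiff_const.mul (contDiff_prod fun i _ => ?_)
  exact ((EuclideanSpace.proj (𝕜 := ℝ) (s i)).contDiff).comp ((ContinuousLinearMap.apply ℝ (E n) (b i)).contDiff)
lemma cd_AA {Q : E n →L[ℝ] E n} (hQ : IsUnit Q) : ContDiffAt ℝ ∞ AA Q := by
  obtain ⟨u, rfl⟩ := hQ
  have hd : (u : E n →L[ℝ] E n).det ≠ 0 := by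
    have : (u : E n →L[ℝ] E n).det * ((u⁻¹ : (E n →L[ℝ] E n)ˣ) : E n →L[ℝ] E n).det = 1 := by
      have h := congrArg (fun Q : E n →L[ℝ] E n => LinearMap.det (Q : E n →ₗ[ℝ] E n)) (u.mul_inv)
      have h2 : LinearMap.det ((1 : E n →L[ℝ] E n) : E n →ₗ[ℝ] E n) = 1 := LinearMap.det_id
      rw [ContinuousLinearMap.det, ContinuousLinearMap.det, ← LinearMap.det_comp]
      exact h.trans h2
    exact left_ne_zero_of_mul_eq_one this
  have h1 := contDiffAt_ringInverse ℝ (n := ∞) u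
  have h2 : ContDiffAt ℝ ∞ (fun Q : E n →L[ℝ] E n => (Ring.inverse Q)†) (u : E n →L[ℝ] E n) :=
    ((ContinuousLinearMap.adjoint (𝕜 := ℝ) (E := E n) (F := E n)).toContinuousLinearEquiv.contDiff.contDiffAt).comp _ h1
  exact (((contDiffAt_abs hd).comp _ cd_det.contDiffAt)).smul (h1.clm_comp h2)
lemma AA_one : AA (1 : E n →L[ℝ] E n) = 1 := by
  have h1 : (1 : E n →L[ℝ] E n).det = 1 := LinearMap.det_id
  have h2 : ((1 : E n →L[ℝ] E n)†) = 1 := ContinuousLinearMap.adjoint_id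
  rw [AA, h1, Ring.inverse_one, h2, abs_one, one_smul]; rfl
end shear
section flow
variable {n : ℕ} {ν p : E n} {g : E n → ℝ} {O : Set (E n)} {r : ℝ}
def fl (ν : E n) (g χ : E n → ℝ) (t x : E n) : E n := sh ν g (hs ν g x + χ (hs ν g x) • tp ν t)
lemma flow_dif (S : Sh ν g) (χ : ContDiffBump p) (hin : χ.rIn = r) (hout : χ.rOut = 2 * r)
    (hW : ∀ y ∈ ball p (3 * r), sh ν g y ∈ O ↔ ⟪ν, y - p⟫ < 0) :
    ∃ V : Set (E n), IsOpen V ∧ 0 ∈ V ∧ ∀ t ∈ V, ∃ D : E n → E n, (∀ y, D (y + χ y • tp ν t) = y) ∧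
      Dif O (sh ν g '' closedBall p (2 * r)) (fl ν g χ t) (fun x => sh ν g (D (hs ν g x))) := by
  have hr : 0 < r := hin ▸ χ.rIn_pos
  have hχ : ContDiff ℝ ∞ χ := χ.contDiff
  obtain ⟨M, hM⟩ : ∃ M, ∀ y, ‖fderiv ℝ χ y‖ ≤ M := by
    obtain ⟨C, hC⟩ := (hχ.continuous_fderiv (by simp)).norm.bddAbove_range_of_hasCompactSupport
      (χ.hasCompactSupport.fderiv (𝕜 := ℝ)).norm
    exact ⟨C, fun x => hC (mem_range_self x)⟩
  have h0 : ∀ y, y ∉ closedBall p (2 * r) → χ y = 0 := fun y hy =>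
    image_eq_zero_of_notMem_tsupport (by rwa [χ.tsupport_eq, hout])
  refine ⟨{t | M * ‖tp ν t‖ < 1/2} ∩ {t | ‖tp ν t‖ < r}, (isOpen_lt (by fun_prop) continuous_const).inter
    (isOpen_lt (by fun_prop) continuous_const), ⟨by simp, by simpa using hr⟩, ?_⟩
  rintro t ⟨ht1, ht2⟩
  simp only [mem_ofPred_eq] at ht1 ht2
  obtain ⟨D, hD, hD1, hD2⟩ := near_id (σ := fun y => χ y • tp ν t) (hχ.smul contDiff_const) (fun y => by
    have : HasFDerivAt (fun y => χ y • tp ν t) ((fderiv ℝ χ y).smulRight (tp ν t)) y :=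
      ((hχ.differentiable (by simp) y).hasFDerivAt).smul_const _
    rw [this.fderiv, ContinuousLinearMap.norm_smulRight_apply]
    nlinarith [hM y, norm_nonneg (tp ν t)])
  have hfix : ∀ x, x ∉ sh ν g '' closedBall p (2 * r) → χ (hs ν g x) = 0 := fun x hx =>
    h0 _ fun h => hx ⟨_, h, S.sh_hs x⟩
  refine ⟨D, hD1, ⟨?_, ?_, ?_, ?_, ?_, ?_⟩⟩
  · exact S.cd_sh.comp (S.cd_hs.add ((hχ.comp S.cd_hs).smul contDiff_const))
  · exact S.cd_sh.comp (hD.comp S.cd_hs)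
  · intro x; simp only [fl, S.hs_sh, hD1, S.sh_hs]
  · intro x; simp only [fl, S.hs_sh, hD2, S.sh_hs]
  · intro x hx; simp only [fl, hfix x hx, zero_smul, add_zero, S.sh_hs]
  · intro x
    by_cases hx : hs ν g x ∈ closedBall p (2 * r)
    · have h1 : hs ν g x ∈ ball p (3 * r) := Metric.closedBall_subset_ball (by linarith) hx
      have h2 : hs ν g x + χ (hs ν g x) • tp ν t ∈ ball p (3 * r) := by
        rw [mem_closedBall, dist_eq_norm] at hx
        rw [mem_ball, dist_eq_norm, add_sub_right_comm]
        have h3 := norm_add_le (hs ν g x - p) (χ (hs ν g x) • tp ν t)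
        rw [norm_smul, Real.norm_of_nonneg χ.nonneg] at h3
        nlinarith [χ.le_one (x := hs ν g x), norm_nonneg (tp ν t)]
      have e := hW _ h1
      rw [S.sh_hs] at e
      rw [fl, hW _ h2, e, add_sub_right_comm, inner_add_right, inner_smul_right, S.tp_nu, mul_zero, add_zero]
    · simp only [fl, h0 _ hx, zero_smul, add_zero, S.sh_hs]
lemma flow_sd (S : Sh ν g) (χ : ContDiffBump p) {V K : Set (E n)} (hK : IsClosed K) (θ : E n → E n → E n)
    (h : ∀ t ∈ V, Dif O K (fl ν g χ t) (θ t)) : SD V K (fun q => BB (fl ν g χ q.1) q.2) where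
  cd := by
    intro t ht x
    have hj : ContDiff ℝ ∞ (fun q : (E n × E n) × E n => fl ν g χ q.1.1 q.2) := by
      have hχ : ContDiff ℝ ∞ χ := χ.contDiff
      have h1 : ContDiff ℝ ∞ (fun q : (E n × E n) × E n => hs ν g q.2) := S.cd_hs.comp contDiff_snd
      exact S.cd_sh.comp (h1.add ((hχ.comp h1).smul ((tp ν).contDiff.comp (contDiff_fst.comp contDiff_fst))))
    have hf : ContDiff ℝ ∞ (fun q : E n × E n => fderiv ℝ (fl ν g χ q.1) q.2) :=
      ContDiff.fderiv (f := fun q : E n × E n => fl ν g χ q.1) (g := fun q => q.2) hj contDiff_snd (by simp)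
    have hu : IsUnit (fderiv ℝ (fl ν g χ t) x) :=
      ⟨⟨_, _, (h t ht).QP x, (h t ht).PQ x⟩, rfl⟩
    have := ContDiffAt.comp (g := AA) (f := fun q : E n × E n => fderiv ℝ (fl ν g χ q.1) q.2) (t, x) (cd_AA hu) hf.contDiffAt
    exact this.sub contDiffAt_const
  z := by
    intro t ht x hx
    have : fl ν g χ t =ᶠ[𝓝 x] id := by
      filter_upwards [hK.isOpen_compl.mem_nhds hx] with y hy
      exact (h t ht).off y hy
    show AA _ - 1 = 0
    rw [this.fderiv_eq, fderiv_id]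
    exact sub_eq_zero.2 AA_one
lemma flow (hn : 0 < n) (hO : Bornology.IsBounded O) (S : Sh ν g) (hr : 0 < r)
    (hW : ∀ y ∈ ball p (3 * r), sh ν g y ∈ O ↔ ⟪ν, y - p⟫ < 0) {f : E n → ℝ} (hf : M2 f)
    (hf0 : ∀ y ∈ closedBall p (2 * r), f (sh ν g y) = 0) :
    ∃ U : E n → KK O, (∀ᶠ t in 𝓝 0, ContDiffAt ℝ ∞ U t) ∧ ∀ ψ, IsTest (ball p r) ψ →
      ∀ᶠ t in 𝓝 0, ⟪fK O (U t), l2 (fun x => ψ (hs ν g x))⟫ = ∫ y, (GG O (l2 f)) (sh ν g y) * ψ (y - tp ν t) := by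
  let χ : ContDiffBump p := ⟨r, 2 * r, hr, by linarith⟩
  obtain ⟨V, hV, h0, hD⟩ := flow_dif S χ rfl rfl hW
  choose! D hD1 hD2 using hD
  set K := sh ν g '' closedBall p (2 * r)
  have hK : IsCompact K := (isCompact_closedBall _ _).image S.cd_sh.continuous
  have hsd := flow_sd S χ hK.isClosed (fun t x => sh ν g (D t (hs ν g x))) hD2
  have ha0 : ∀ x, BB (fl ν g χ 0) x = 0 := by
    intro x
    have : fl ν g χ 0 = id := by ext1 y; simp [fl, S.sh_hs]
    rw [BB, this, fderiv_id]
    exact sub_eq_zero.2 AA_one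
  have hs1 := sol_cd hn hO hV hK hsd h0 ha0 (l2 f)
  refine ⟨_, hs1.mono fun t h => h.2.2, fun ψ hψ => hs1.mono fun t h => ?_⟩
  have hΨ' : M2 fun x => ψ (hs ν g x - tp ν t) := by
    have h1 : M2 fun y => ψ (y - tp ν t) := hψ.m2.comp_measurePreserving (measurePreserving_sub_right volume (tp ν t))
    exact h1.comp_measurePreserving S.mp
  have := (hD2 t h.1).pull hn hO (hsd.cc hK h.1) h.2.1 hf (fun x hx => (hD2 t h.1).off x fun hx' => by
      obtain ⟨y, hy, rfl⟩ := hx'; exact hx (hf0 y hy)) (hψ.m2.comp_measurePreserving S.mp) hΨ' (fun η _ => ?_)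
  · refine this.trans ?_
    rw [inner_Lp_l2 _ hΨ', S.int]
    simp only [S.hs_sh]
  · rw [S.int, S.int (fun x => η (sh ν g (D t (hs ν g x))) * _)]
    simp only [S.hs_sh, Function.comp]
    rw [← integral_sub_right_eq_self _ (tp ν t)]
    refine integral_congr_ae (.of_forall fun y => ?_)
    show η (sh ν g (y - tp ν t)) * ψ (y - tp ν t) = η (sh ν g (D t y)) * ψ (y - tp ν t)
    by_cases hy : y - tp ν t ∈ ball p r
    · have h2 := hD1 t h.1 (y - tp ν t)
      rw [χ.one_of_mem_closedBall (ball_subset_closedBall hy), one_smul, sub_add_cancel] at h2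
      rw [h2]
    · rw [image_eq_zero_of_notMem_tsupport (f := ψ) fun h => hy (hψ.ts h)]; simp
end flow
open scoped ContDiff Gradient RealInnerProductSpace InnerProduct Convolution
section tang
variable {n : ℕ} {ν p : E n} {g : E n → ℝ} {O N : Set (E n)} {r : ℝ}
def pdl : List (E n) → (E n → ℝ) → (E n → ℝ)
  | [], f => f
  | v :: l, f => pdl l (pd v f)
lemma pdl_append (l m : List (E n)) (f : E n → ℝ) : pdl (l ++ m) f = pdl m (pdl l f) := by
  induction l generalizing f with
  | nil => rfl
  | cons v l ih => exact ih _
lemma IsTest.pdl {φ : E n → ℝ} (h : IsTest O φ) (l : List (E n)) : IsTest O (LC.pdl l φ) := by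
  induction l generalizing φ with
  | nil => exact h
  | cons v l ih => exact ih (h.pd v)
lemma cdo_pdl {f : E n → ℝ} (hN : IsOpen N) (hf : ContDiffOn ℝ ∞ f N) (l : List (E n)) : ContDiffOn ℝ ∞ (pdl l f) N := by
  induction l generalizing f with
  | nil => exact hf
  | cons v l ih => exact ih (cdo_pd hN hf v)
lemma cdo_dif {f : E n → ℝ} (hN : IsOpen N) (hf : ContDiffOn ℝ ∞ f N) {x : E n} (hx : x ∈ N) : DifferentiableAt ℝ f x :=
  (hf.contDiffAt (hN.mem_nhds hx)).differentiableAt (by simp)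
lemma conv_deriv {w φ : E n → ℝ} (hw : LocallyIntegrable w volume) (hφ : IsTest univ φ) (s : E n) :
    ∃ L : E n →L[ℝ] ℝ, HasFDerivAt (fun s => ∫ y, w y * φ (y - s)) L s ∧ ∀ v, L v = - ∫ y, w y * pd v φ (y - s) := by
  let ψ : E n → ℝ := fun z => φ (-z)
  have hψ : ContDiff ℝ ∞ ψ := hφ.cd.comp contDiff_neg
  have hc : HasCompactSupport ψ := hφ.cs.comp_homeomorph (Homeomorph.neg (E n))
  have h := hc.hasFDerivAt_convolution_right (ContinuousLinearMap.mul ℝ ℝ) hw (hψ.of_le (by simp)) s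
  have e : (fun s => ∫ y, w y * φ (y - s)) = (w ⋆[ContinuousLinearMap.mul ℝ ℝ, volume] ψ) := by
    ext s
    rw [convolution_def]
    simp [ψ]
  rw [← e] at h
  refine ⟨_, h, fun v => ?_⟩
  rw [convolution_precompR_apply _ hw (hc.fderiv ℝ) (hψ.continuous_fderiv (by simp)), convolution_def, ← integral_neg]
  refine integral_congr_ae (.of_forall fun y => ?_)
  have : fderiv ℝ ψ (s - y) v = - pd v φ (y - s) := by
    have h1 : HasFDerivAt ψ _ (s - y) := HasFDerivAt.comp (g := φ) (f := fun z => -z) (s - y)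
      (hφ.cd.differentiable (by simp) _).hasFDerivAt (hasFDerivAt_id (s - y)).neg
    rw [h1.fderiv]; simp [pd]
  simp [this]
lemma tang_pair {H : Type*} [NormedAddCommGroup H] [NormedSpace ℝ H] (P : E n →L[ℝ] E n) {w : E n → ℝ} (hw : LocallyIntegrable w volume)
    (l : List (E n)) (U : E n → H) (hU : ∀ᶠ t in 𝓝 0, ContDiffAt ℝ ∞ U t) (Λ : (E n → ℝ) → (H →L[ℝ] ℝ))
    (D : (E n → ℝ) → (E n → ℝ)) (hD : ∀ ψ, IsTest O ψ → IsTest univ (D ψ))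
    (h : ∀ ψ, IsTest O ψ → ∀ᶠ t in 𝓝 0, Λ ψ (U t) = ∫ y, w y * D ψ (y - P t)) :
    ∃ F : H, ∀ ψ, IsTest O ψ → Λ ψ F = ∫ y, w y * pdl (l.map P) (D ψ) y := by
  induction l generalizing U D with
  | nil => exact ⟨U 0, fun ψ hψ => by simpa [pdl] using (h ψ hψ).self_of_nhds⟩
  | cons v l ih =>
    refine ih (fun t => - fderiv ℝ U t v) ?_ (fun ψ => pd (P v) (D ψ)) (fun ψ hψ => (hD ψ hψ).pd _) fun ψ hψ => ?_
    · filter_upwards [hU] with t ht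
      exact ((ht.fderiv_right (m := ∞) (by simp)).clm_apply contDiffAt_const).neg
    · filter_upwards [hU, (h ψ hψ).eventually_nhds] with t ht ht2
      obtain ⟨L, hL, hL2⟩ := conv_deriv hw (hD ψ hψ) (P t)
      have h1 : HasFDerivAt (fun t => ∫ y, w y * D ψ (y - P t)) (L.comp P) t :=
        HasFDerivAt.comp (g := fun s => ∫ y, w y * D ψ (y - s)) (f := P) t hL P.hasFDerivAt
      have h2 : HasFDerivAt (fun t => Λ ψ (U t)) ((Λ ψ).comp (fderiv ℝ U t)) t :=
        (Λ ψ).hasFDerivAt.comp t (ht.differentiableAt (by simp)).hasFDerivAt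
      have h3 := h2.unique (h1.congr_of_eventuallyEq ht2)
      have h4 := congrArg (fun L => L v) h3
      simp only [ContinuousLinearMap.comp_apply, hL2] at h4
      rw [map_neg, h4, neg_neg]
lemma int_test {h ψ : E n → ℝ} (hN : IsOpen N) (hh : ContinuousOn h N) (hc : Continuous ψ) (hcs : HasCompactSupport ψ) (hs : tsupport ψ ⊆ N) :
    Integrable (fun x => ψ x * h x) volume := by
  refine Continuous.integrable_of_hasCompactSupport ?_ hcs.mul_right
  exact ContinuousOn.continuous_of_tsupport_subset (hc.continuousOn.mul hh) hN ((tsupport_mul_subset_left).trans hs)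
lemma ibp_loc {h ψ : E n → ℝ} (hN : IsOpen N) (hh : ContDiffOn ℝ ∞ h N) (hψ : IsTest N ψ) (v : E n) :
    ∫ x, h x * pd v ψ x = - ∫ x, pd v h x * ψ x := by
  have i1 := int_test hN hh.continuousOn (hψ.pd v).cd.continuous (hψ.pd v).cs (hψ.pd v).ts
  have i2 := int_test hN (cdo_pd hN hh v).continuousOn hψ.cd.continuous hψ.cs hψ.ts
  have i3 := int_test hN hh.continuousOn hψ.cd.continuous hψ.cs hψ.ts
  have := integral_mul_fderiv_eq_neg_fderiv_mul_of_integrable (μ := volume) (f := ψ) (g := h) (v := v) i1 i2 i3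
    (fun x _ => hψ.cd.differentiable (by simp) x) (fun x hx => cdo_dif hN hh (hψ.ts hx))
  have e1 : ∫ x, h x * pd v ψ x = ∫ x, fderiv ℝ ψ x v * h x := by simp only [pd, mul_comm]
  have e2 : ∫ x, pd v h x * ψ x = ∫ x, ψ x * fderiv ℝ h x v := by simp only [pd, mul_comm]
  rw [e1, e2, this, neg_neg]
lemma ibp_list {h ψ : E n → ℝ} (hN : IsOpen N) (hh : ContDiffOn ℝ ∞ h N) (hψ : IsTest N ψ) (l : List (E n)) :
    ∫ x, h x * pdl l ψ x = (-1) ^ l.length * ∫ x, pdl l.reverse h x * ψ x := by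
  induction l generalizing ψ with
  | nil => simp [pdl]
  | cons v l ih =>
    rw [pdl, ih (hψ.pd v), List.reverse_cons, pdl_append, ibp_loc hN (cdo_pdl hN hh _) hψ, List.length_cons, pow_succ]
    simp [pdl]
lemma weak_L2 {h k : E n → ℝ} (hN : IsOpen N) (hb : Bornology.IsBounded N) (hh : ContDiffOn ℝ ∞ h N) (hk : M2 k)
    (he : ∀ ψ, IsTest N ψ → ∫ x, h x * ψ x = ∫ x, k x * ψ x) : IntegrableOn h N volume := by
  have hkl : LocallyIntegrable k volume := hk.locallyIntegrable (by simp)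
  have hz : ∀ᵐ x ∂volume, x ∈ N → h x - k x = 0 := by
    refine hN.ae_eq_zero_of_integral_contDiff_smul_eq_zero
      ((hh.continuousOn.locallyIntegrableOn hN.measurableSet).sub (hkl.locallyIntegrableOn _)) fun ψ h1 h2 h3 => ?_
    have i1 := int_test hN hh.continuousOn h1.continuous h2 h3
    have i2 := hkl.integrable_smul_left_of_hasCompactSupport h1.continuous h2
    have := he ψ ⟨h1, h2, h3⟩
    simp only [smul_eq_mul, mul_sub] at i2 ⊢
    rw [integral_sub i1 i2]
    simp only [mul_comm] at this ⊢
    rw [this, sub_self]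
  have hi : IntegrableOn k N volume := by
    have : IsFiniteMeasure (volume.restrict N) := ⟨by simpa using hb.measure_lt_top⟩
    exact (hk.restrict N).integrable (by simp)
  refine hi.congr ?_
  rw [EventuallyEq, ae_restrict_iff' hN.measurableSet]
  filter_upwards [hz] with x hx hxN
  linarith [hx hxN]
lemma tang_L2 (hn : 0 < n) (hO : Bornology.IsBounded O) (S : Sh ν g) (hr : 0 < r)
    (hW : ∀ y ∈ ball p (3 * r), sh ν g y ∈ O ↔ ⟪ν, y - p⟫ < 0) {f : E n → ℝ} (hf : M2 f)
    (hf0 : ∀ y ∈ closedBall p (2 * r), f (sh ν g y) = 0) (hN : IsOpen N) (hNr : N ⊆ ball p r)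
    {w : E n → ℝ} (hw : ContDiffOn ℝ ∞ w N) (hwe : ∀ᵐ y, y ∈ N → GG O (l2 f) (sh ν g y) = w y) (l : List (E n)) :
    IntegrableOn (pdl (l.map (tp ν)) w) N volume ∧ IntegrableOn (pd ν (pdl (l.map (tp ν)) w)) N volume := by
  obtain ⟨U, hU, hU2⟩ := flow hn hO S hr hW hf hf0
  have hû : LocallyIntegrable (fun y => GG O (l2 f) (sh ν g y)) volume :=
    ((Lp.memLp (GG O (l2 f))).comp_measurePreserving S.mp').locallyIntegrable (by simp)
  obtain ⟨F, hF⟩ := tang_pair (tp ν) hû l.reverse U hU (fun ψ => (innerSL ℝ (l2 fun x => ψ (hs ν g x))).comp (fK O)) id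
    (fun ψ h => (h.mono (subset_univ _) : IsTest univ ψ)) (O := ball p r) (fun ψ hψ => by
      filter_upwards [hU2 ψ hψ] with t ht
      simp only [ContinuousLinearMap.comp_apply, innerSL_apply_apply, id]
      rw [real_inner_comm, ht])
  have hbN : Bornology.IsBounded N := isBounded_ball.subset hNr
  have hm : ∀ {ψ : E n → ℝ}, IsTest N ψ → M2 fun x => ψ (hs ν g x) := fun h => h.m2.comp_measurePreserving S.mp
  have key : ∀ ψ, IsTest N ψ → ⟪fK O F, l2 fun x => ψ (hs ν g x)⟫ =
      (-1) ^ l.length * ∫ x, pdl (l.map (tp ν)) w x * ψ x := by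
    intro ψ hψ
    have h1 := hF ψ (hψ.mono hNr)
    simp only [ContinuousLinearMap.comp_apply, innerSL_apply_apply, id] at h1
    rw [real_inner_comm, h1]
    have h2 := ibp_list hN hw hψ (l.reverse.map (tp ν))
    rw [← List.map_reverse, List.reverse_reverse, List.length_map, List.length_reverse] at h2
    rw [← h2]
    refine integral_congr_ae ?_
    filter_upwards [hwe] with y hy
    by_cases hyN : y ∈ N
    · simp only [hy hyN]
    · have : pdl (List.map (tp ν) l.reverse) ψ y = 0 :=
        image_eq_zero_of_notMem_tsupport fun h => hyN ((hψ.pdl _).ts h)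
      simp only [this, mul_zero]
  have hs2 : ((-1 : ℝ) ^ l.length) * (-1) ^ l.length = 1 := by rw [← mul_pow]; simp
  set c : ℝ := (-1) ^ l.length
  have hwl := cdo_pdl hN hw (l.map (tp ν))
  constructor
  · refine weak_L2 (k := fun y => c * (fK O F) (sh ν g y)) hN hbN hwl
      (((Lp.memLp (fK O F)).comp_measurePreserving S.mp').const_mul c) fun ψ hψ => ?_
    have h1 := key ψ hψ
    rw [inner_Lp_l2 _ (hm hψ), S.int] at h1
    simp only [S.hs_sh] at h1
    simp only [mul_assoc, integral_const_mul]
    rw [h1, ← mul_assoc, hs2, one_mul]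
  · have hk : M2 fun y => ⟪(sK O F) (sh ν g y), ν⟫ := by
      refine (((Lp.memLp (sK O F)).comp_measurePreserving S.mp')).of_le_mul (c := ‖ν‖) ?_ (.of_forall fun y => ?_)
      · exact (((Lp.memLp (sK O F)).comp_measurePreserving S.mp').1).inner aestronglyMeasurable_const
      · simpa [mul_comm] using norm_inner_le_norm (𝕜 := ℝ) ((sK O F) (sh ν g y)) ν
    refine weak_L2 (k := fun y => c * ⟪(sK O F) (sh ν g y), ν⟫) hN hbN (cdo_pd hN hwl ν) (hk.const_mul c) fun ψ hψ => ?_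
    have hb : IsTest univ (fun x => ψ (hs ν g x)) := ⟨hψ.cd.comp S.cd_hs,
      hψ.cs.comp_homeomorph ⟨⟨hs ν g, sh ν g, S.sh_hs, S.hs_sh⟩, S.cd_hs.continuous, S.cd_sh.continuous⟩, subset_univ _⟩
    have h1 := K_weak F hb ν
    have e : pd ν (fun x => ψ (hs ν g x)) = fun x => pd ν ψ (hs ν g x) := by
      ext x
      have h2 := S.neg.fd x
      rw [← hs_eq] at h2
      have h3 := HasFDerivAt.comp (g := ψ) x (hψ.cd.differentiable (by simp) _).hasFDerivAt h2
      have h4 : fderiv ℝ (fun x => ψ (hs ν g x)) x = _ := h3.fderiv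
      have h5 := S.pdnu x
      rw [pd, h4]
      simp [h5, pd]
    rw [e, key _ (hψ.pd ν), ibp_loc hN hwl hψ ν, mul_neg, neg_inj] at h1
    have hm2 : M2 fun x => ψ (hs ν g x) • ν := by
      exact MemLp.smul (r := 2) (p := 2) (q := ⊤) (memLp_top_const ν) (hm hψ)
    have h2 := inner_l2 (Lp.memLp (sK O F)) hm2
    rw [l2_self] at h2
    rw [h2, S.int (fun x => ⟪(sK O F) x, ψ (hs ν g x) • ν⟫)] at h1
    simp only [S.hs_sh, inner_smul_right] at h1
    simp only [mul_assoc, integral_const_mul]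
    have h3 : ∫ y, ⟪(sK O F) (sh ν g y), ν⟫ * ψ y = ∫ y, ψ y * ⟪(sK O F) (sh ν g y), ν⟫ := by simp only [mul_comm]
    rw [h3, ← h1, ← mul_assoc, hs2, one_mul]
end tang
section cls
variable {n : ℕ} {ν : E n} {g : E n → ℝ} {N : Set (E n)} {P : (E n → ℝ) → Prop}
lemma pd_comm {f : E n → ℝ} {x : E n} (hf : ContDiffAt ℝ ∞ f x) (v w : E n) : pd v (pd w f) x = pd w (pd v f) x := by
  have h1 : DifferentiableAt ℝ (fderiv ℝ f) x := (hf.fderiv_right (m := ∞) (by simp)).differentiableAt (by simp)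
  have e : ∀ v w : E n, pd v (pd w f) x = fderiv ℝ (fderiv ℝ f) x v w := by
    intro v w
    have : HasFDerivAt (pd w f) _ x := h1.hasFDerivAt.clm_apply (hasFDerivAt_const w x)
    rw [pd, this.fderiv]; simp
  rw [e, e]
  exact (hf.isSymmSndFDerivAt (by rw [minSmoothness_of_isRCLikeNormedField]; exact WithTop.coe_le_coe.2 le_top)) v w
lemma pd_mulr {f g : E n → ℝ} {x : E n} (hf : DifferentiableAt ℝ f x) (hg : DifferentiableAt ℝ g x)
    (v : E n) : pd v (fun y => f y * g y) x = pd v f x * g x + f x * pd v g x := by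
  unfold pd
  rw [HasFDerivAt.fderiv (f := fun y => f y * g y) (hf.hasFDerivAt.mul hg.hasFDerivAt)]
  simp; ring
lemma pd_on {f h : E n → ℝ} (hN : IsOpen N) (e : EqOn f h N) (v : E n) : EqOn (pd v f) (pd v h) N := fun _ hx =>
  (pd_congr (e.eventuallyEq_of_mem (hN.mem_nhds hx)) v).self_of_nhds
lemma pdl_on {f h : E n → ℝ} (hN : IsOpen N) (e : EqOn f h N) (l : List (E n)) : EqOn (pdl l f) (pdl l h) N := by
  induction l generalizing f h with
  | nil => exact e
  | cons v l ih => exact ih (pd_on hN e v)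
lemma pdl_add {f h : E n → ℝ} (hN : IsOpen N) (hf : ContDiffOn ℝ ∞ f N) (hh : ContDiffOn ℝ ∞ h N) (l : List (E n)) :
    EqOn (pdl l fun y => f y + h y) (fun y => pdl l f y + pdl l h y) N := by
  induction l generalizing f h with
  | nil => exact fun _ _ => rfl
  | cons v l ih =>
    refine EqOn.trans (pdl_on hN (h := fun y => pd v f y + pd v h y) (fun x hx => ?_) l) (ih (cdo_pd hN hf v) (cdo_pd hN hh v))
    exact pd_add (cdo_dif hN hf hx) (cdo_dif hN hh hx) v
structure Cl (N : Set (E n)) (P : (E n → ℝ) → Prop) : Prop where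
  congr : ∀ {f h : E n → ℝ}, EqOn f h N → P h → P f
  add : ∀ {f h : E n → ℝ}, P f → P h → P (fun x => f x + h x)
  mul : ∀ {a f : E n → ℝ}, ContDiff ℝ ∞ a → P f → P (fun x => a x * f x)
def Tn (ν : E n) (N : Set (E n)) (P : (E n → ℝ) → Prop) (w : E n → ℝ) : Prop :=
  ContDiffOn ℝ ∞ w N ∧ ∀ l : List (E n), P (pdl (l.map (tp ν)) w)
lemma Tn.congr (C : Cl N P) (hN : IsOpen N) {f h : E n → ℝ} (e : EqOn f h N) (hh : Tn ν N P h) : Tn ν N P f :=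
  ⟨hh.1.congr e, fun l => C.congr (pdl_on hN e _) (hh.2 l)⟩
lemma Tn.add (C : Cl N P) (hN : IsOpen N) {f h : E n → ℝ} (hf : Tn ν N P f) (hh : Tn ν N P h) : Tn ν N P (fun y => f y + h y) :=
  ⟨hf.1.add hh.1, fun l => C.congr (pdl_add hN hf.1 hh.1 _) (C.add (hf.2 l) (hh.2 l))⟩
lemma Tn.pd (hN : IsOpen N) {f : E n → ℝ} (hf : Tn ν N P f) (v : E n) : Tn ν N P (pd (tp ν v) f) :=
  ⟨cdo_pd hN hf.1 _, fun l => hf.2 (v :: l)⟩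
lemma Tn.mul (C : Cl N P) (hN : IsOpen N) {a f : E n → ℝ} (ha : ContDiff ℝ ∞ a) (hf : Tn ν N P f) : Tn ν N P (fun y => a y * f y) := by
  refine ⟨ha.contDiffOn.mul hf.1, fun l => ?_⟩
  induction l generalizing a f with
  | nil => exact C.mul ha (hf.2 [])
  | cons v l ih =>
    have e : EqOn (LC.pd (tp ν v) fun y => a y * f y) (fun y => LC.pd (tp ν v) a y * f y + a y * LC.pd (tp ν v) f y) N := fun x hx =>
      pd_mulr (ha.differentiable (by simp) x) (cdo_dif hN hf.1 hx) _
    refine C.congr (pdl_on hN e _) (C.congr (pdl_add hN ((cd_pd ha _).contDiffOn.mul hf.1) (ha.contDiffOn.mul (cdo_pd hN hf.1 _)) _) ?_)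
    exact C.add (ih (cd_pd ha _) hf) (ih ha (hf.pd hN v))
lemma Tn.sum (C : Cl N P) (hN : IsOpen N) {ι : Type*} (s : Finset ι) {f : ι → E n → ℝ} {f0 : E n → ℝ} (h0 : Tn ν N P f0)
    (hf : ∀ i, Tn ν N P (f i)) : Tn ν N P (fun y => ∑ i ∈ s, f i y) := by
  classical
  induction s using Finset.induction_on with
  | empty => simpa using Tn.mul C hN (contDiff_const (c := (0 : ℝ))) h0
  | insert i s hi ih => simpa only [Finset.sum_insert hi] using Tn.add C hN (hf i) ih
def qq (ν : E n) (g : E n → ℝ) (e y : E n) : ℝ := ⟪ν, e⟫ - pd e g y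
lemma Sh.cd_qq (S : Sh ν g) (e : E n) : ContDiff ℝ ∞ (qq ν g e) := contDiff_const.sub (cd_pd S.cd e)
lemma Sh.pd_qq (S : Sh ν g) (e x : E n) : pd ν (qq ν g e) x = 0 := by
  have h : HasFDerivAt (qq ν g e) (0 - fderiv ℝ (pd e g) x) x :=
    (hasFDerivAt_const _ x).sub ((cd_pd S.cd e).differentiable (by simp) x).hasFDerivAt
  have h2 : pd ν (pd e g) x = 0 := by
    rw [pd_comm S.cd.contDiffAt]
    have : pd ν g = fun _ => 0 := funext fun x => S.pdnu x
    rw [this, pd]; simp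
  rw [pd, h.fderiv]
  simpa [pd] using h2
lemma Sh.sum_qq (S : Sh ν g) (y : E n) : ∑ i, qq ν g (eb i) y * qq ν g (eb i) y ≠ 0 := by
  intro h
  rw [Finset.sum_eq_zero_iff_of_nonneg fun i _ => mul_self_nonneg _] at h
  have h1 : ∀ i, qq ν g (eb i) y = 0 := fun i => mul_self_eq_zero.1 (h i (Finset.mem_univ i))
  have h2 : ∑ i, ⟪ν, eb i⟫ * qq ν g (eb i) y = 1 := by
    simp only [qq, mul_sub, Finset.sum_sub_distrib]
    rw [← inner_eq_sum, real_inner_self_eq_norm_sq, S.nu]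
    have h3 := inner_eq_sum ν (∇ g y)
    rw [real_inner_comm, inner_grad] at h3
    simp only [inner_grad] at h3
    rw [← h3, pd, S.pdnu]; simp
  simp [h1] at h2
lemma tp_decomp (ν e : E n) (f : E n → ℝ) (x : E n) : pd e f x = pd (tp ν e) f x + ⟪ν, e⟫ * pd ν f x := by
  simp [pd, tp_apply]
lemma Sh.pd_sh (S : Sh ν g) {v : E n → ℝ} {y : E n} (hv : DifferentiableAt ℝ v (sh ν g y)) (e : E n) :
    pd e v (sh ν g y) = pd (tp ν e) (fun y => v (sh ν g y)) y + qq ν g e y * pd ν (fun y => v (sh ν g y)) y := by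
  have h : HasFDerivAt (fun y => v (sh ν g y)) _ y := HasFDerivAt.comp (g := v) y hv.hasFDerivAt (S.fd y)
  have h2 : ∀ e, pd e (fun y => v (sh ν g y)) y = pd e v (sh ν g y) + pd e g y * pd ν v (sh ν g y) := by
    intro e; rw [pd, h.fderiv]; simp [pd]
  have h3 := tp_decomp ν e (fun y => v (sh ν g y)) y
  have h4 : pd ν g y = 0 := S.pdnu y
  have h5 := h2 ν
  rw [h4, zero_mul, add_zero] at h5
  rw [h2 e] at h3
  rw [qq, h5]
  rw [h5] at h3
  linarith
lemma Sh.cd_comp (S : Sh ν g) {v : E n → ℝ} (hv : ContDiffOn ℝ ∞ v (hs ν g ⁻¹' N)) : ContDiffOn ℝ ∞ (fun y => v (sh ν g y)) N :=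
  hv.comp S.cd_sh.contDiffOn fun y hy => by rwa [mem_preimage, S.hs_sh]
lemma Sh.pdnu_sh (S : Sh ν g) (hN : IsOpen N) {v : E n → ℝ} (hv : ContDiffOn ℝ ∞ v (hs ν g ⁻¹' N)) :
    EqOn (pd ν (fun y => v (sh ν g y))) (fun y => pd ν v (sh ν g y)) N := by
  intro y hy
  have hd : DifferentiableAt ℝ v (sh ν g y) := cdo_dif (hN.preimage S.cd_hs.continuous) hv (by rwa [mem_preimage, S.hs_sh])
  have := S.pd_sh hd ν
  have h1 : tp ν ν = 0 := by rw [tp_apply, real_inner_self_eq_norm_sq, S.nu]; simp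
  have h2 : pd ν g y = 0 := S.pdnu y
  have h3 : qq ν g ν y = 1 := by rw [qq, h2, real_inner_self_eq_norm_sq, S.nu]; simp
  rw [h1, h3] at this
  have h4 : pd 0 (fun y => v (sh ν g y)) y = 0 := by simp [pd]
  simp only
  rw [this, h4]; ring
lemma Tn_eq (C : Cl N P) (hN : IsOpen N) (S : Sh ν g) {v : E n → ℝ} (hv : ContDiffOn ℝ ∞ v (hs ν g ⁻¹' N))
    (hL : ∀ x, hs ν g x ∈ N → Lap v x = 0) (h1 : Tn ν N P fun y => v (sh ν g y)) (h2 : Tn ν N P (pd ν fun y => v (sh ν g y))) :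
    Tn ν N P (pd ν (pd ν fun y => v (sh ν g y))) := by
  set w : E n → ℝ := fun y => v (sh ν g y) with hw
  have hN' := hN.preimage S.cd_hs.continuous
  have hwc : ContDiffOn ℝ ∞ w N := h1.1
  let R : Fin n → E n → ℝ := fun i y => (pd (tp ν (eb i)) (pd (tp ν (eb i)) w) y + pd (tp ν (eb i)) (fun y => qq ν g (eb i) y * pd ν w y) y)
    + qq ν g (eb i) y * pd (tp ν (eb i)) (pd ν w) y
  have hR : ∀ i, Tn ν N P (R i) := fun i => Tn.add C hN (Tn.add C hN ((h1.pd hN _).pd hN _) ((h2.mul C hN (S.cd_qq _)).pd hN _))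
    ((h2.pd hN _).mul C hN (S.cd_qq _))
  have hfin := Tn.mul C hN (a := fun y => -(∑ i, qq ν g (eb i) y * qq ν g (eb i) y)⁻¹)
    ((ContDiff.inv (ContDiff.sum fun i _ => (S.cd_qq _).mul (S.cd_qq _)) S.sum_qq).neg) (Tn.sum C hN Finset.univ h1 hR)
  refine Tn.congr C hN (fun y hy => ?_) hfin
  have hm : sh ν g y ∈ hs ν g ⁻¹' N := by rwa [mem_preimage, S.hs_sh]
  have h3 : ∀ i, pd (eb i) (pd (eb i) v) (sh ν g y) = R i y + qq ν g (eb i) y * qq ν g (eb i) y * pd ν (pd ν w) y := by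
    intro i
    rw [S.pd_sh (cdo_dif hN' (cdo_pd hN' hv _) hm)]
    have e : EqOn (fun y => pd (eb i) v (sh ν g y)) (fun y => pd (tp ν (eb i)) w y + qq ν g (eb i) y * pd ν w y) N := fun z hz =>
      S.pd_sh (cdo_dif hN' hv (by rwa [mem_preimage, S.hs_sh])) _
    have d1 := cdo_dif hN (cdo_pd hN hwc (tp ν (eb i))) hy
    have dq := (S.cd_qq (eb i)).differentiable (by simp) y
    have dn := cdo_dif hN (cdo_pd hN hwc ν) hy
    rw [pd_on hN e _ hy, pd_on hN e _ hy, pd_add (g := fun y => qq ν g (eb i) y * pd ν w y) d1 (dq.mul dn), pd_add (g := fun y => qq ν g (eb i) y * pd ν w y) d1 (dq.mul dn), pd_mulr dq dn ν, S.pd_qq,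
      pd_comm (hwc.contDiffAt (hN.mem_nhds hy)) ν]
    simp only [R]
    ring
  have h4 := hL (sh ν g y) hm
  rw [Lap, Finset.sum_congr rfl fun i _ => h3 i, Finset.sum_add_distrib, ← Finset.sum_mul] at h4
  have h5 := S.sum_qq y
  show pd ν (pd ν w) y = -(∑ i, qq ν g (eb i) y * qq ν g (eb i) y)⁻¹ * ∑ i, R i y
  generalize ∑ i, qq ν g (eb i) y * qq ν g (eb i) y = q at h4 h5 ⊢
  rw [eq_neg_of_add_eq_zero_left h4]
  field_simp
lemma Lap_pd {v : E n → ℝ} {M : Set (E n)} (hM : IsOpen M) (hv : ContDiffOn ℝ ∞ v M) (hL : ∀ x ∈ M, Lap v x = 0) (e : E n) :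
    ∀ x ∈ M, Lap (pd e v) x = 0 := by
  intro x hx
  have h0 : pd e (Lap v) x = 0 := by
    rw [pd_on hM (h := fun _ => 0) hL e hx]; simp [pd]
  have h1 : pd e (Lap v) x = ∑ i, pd e (pd (eb i) (pd (eb i) v)) x := by
    have : HasFDerivAt (fun y => ∑ i, pd (eb i) (pd (eb i) v) y) _ x := HasFDerivAt.fun_sum fun i _ =>
      (cdo_dif hM (cdo_pd hM (cdo_pd hM hv (eb i)) (eb i)) hx).hasFDerivAt
    show fderiv ℝ (fun y => ∑ i, pd (eb i) (pd (eb i) v) y) x e = _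
    rw [this.fderiv]; simp [pd]
  rw [← h0, h1, Lap]
  refine Finset.sum_congr rfl fun i _ => ?_
  rw [pd_comm ((cdo_pd hM hv _).contDiffAt (hM.mem_nhds hx)) e]
  exact (pd_on hM (fun z hz => pd_comm (hv.contDiffAt (hM.mem_nhds hz)) e (eb i)) _ hx).symm
def Tw (ν : E n) (N : Set (E n)) (P : (E n → ℝ) → Prop) (w : E n → ℝ) : Prop := ∀ k : ℕ, Tn ν N P ((pd ν)^[k] w)
lemma Tw_of (C : Cl N P) (hN : IsOpen N) (S : Sh ν g) {v : E n → ℝ} (hv : ContDiffOn ℝ ∞ v (hs ν g ⁻¹' N))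
    (hL : ∀ x, hs ν g x ∈ N → Lap v x = 0) (h1 : Tn ν N P fun y => v (sh ν g y)) (h2 : Tn ν N P (pd ν fun y => v (sh ν g y))) :
    Tw ν N P fun y => v (sh ν g y) := by
  have hN' := hN.preimage S.cd_hs.continuous
  have key : ∀ (k : ℕ) (v : E n → ℝ), ContDiffOn ℝ ∞ v (hs ν g ⁻¹' N) → (∀ x, hs ν g x ∈ N → Lap v x = 0) →
      (Tn ν N P fun y => v (sh ν g y)) → (Tn ν N P (pd ν fun y => v (sh ν g y))) → Tn ν N P ((pd ν)^[k] fun y => v (sh ν g y)) := by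
    intro k
    induction k with
    | zero => exact fun v _ _ h _ => h
    | succ k ih =>
      intro v hv hL h1 h2
      have e := S.pdnu_sh hN hv
      have h3 := Tn_eq C hN S hv hL h1 h2
      have h4 := ih (pd ν v) (cdo_pd hN' hv ν) (Lap_pd hN' hv hL ν) (Tn.congr C hN e.symm h2)
        (Tn.congr C hN (pd_on hN e.symm ν) h3)
      rw [Function.iterate_succ_apply]
      have it : ∀ (k : ℕ) (a b : E n → ℝ), EqOn a b N → EqOn ((pd ν)^[k] a) ((pd ν)^[k] b) N := by
        intro k
        induction k with
        | zero => exact fun a b h => h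
        | succ k ih => exact fun a b h => ih _ _ (pd_on hN h ν)
      exact Tn.congr C hN (it k _ _ e) h4
  exact fun k => key k v hv hL h1 h2
lemma Tw.pd (C : Cl N P) (hN : IsOpen N) {w : E n → ℝ} (h : Tw ν N P w) (e : E n) : Tw ν N P (pd e w) := by
  intro k
  have : EqOn ((LC.pd ν)^[k] (LC.pd e w)) (fun y => LC.pd (tp ν e) ((LC.pd ν)^[k] w) y + ⟪ν, e⟫ * (LC.pd ν)^[k+1] w y) N := by
    induction k with
    | zero => exact fun y _ => tp_decomp ν e w y
    | succ k ih =>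
      rw [Function.iterate_succ_apply']
      refine (pd_on hN ih ν).trans fun y hy => ?_
      have c1 := (h k).1
      have c2 := (h (k+1)).1
      rw [pd_add (cdo_dif hN (cdo_pd hN c1 _) hy) ((cdo_dif hN c2 hy).const_mul _), pd_comm (c1.contDiffAt (hN.mem_nhds hy)),
        pd_mulr (differentiableAt_const _) (cdo_dif hN c2 hy)]
      rw [Function.iterate_succ_apply' _ (k+1), Function.iterate_succ_apply' _ k]
      simp [LC.pd]
  exact Tn.congr C hN this (Tn.add C hN ((h k).pd hN e) ((h (k+1)).mul C hN contDiff_const))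
lemma Tw.all (C : Cl N P) (hN : IsOpen N) {w : E n → ℝ} (h : Tw ν N P w) (l : List (E n)) : P (pdl l w) := by
  induction l generalizing w with
  | nil => exact (h 0).2 []
  | cons v l ih => exact ih (h.pd C hN v)
end cls
section sob
variable {n : ℕ} {ν p : E n} {r : ℝ} {N : Set (E n)} {P : (E n → ℝ) → Prop}
lemma tsupport_pdl (l : List (E n)) (f : E n → ℝ) : tsupport (pdl l f) ⊆ tsupport f := by
  induction l generalizing f with
  | nil => exact subset_rfl
  | cons v l ih => exact (ih _).trans (tsupport_pd f v)
lemma cd_of_ts {f : E n → ℝ} (h : ∀ x ∈ tsupport f, ContDiffAt ℝ ∞ f x) : ContDiff ℝ ∞ f := by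
  refine contDiff_iff_contDiffAt.2 fun x => ?_
  by_cases hx : x ∈ tsupport f
  · exact h x hx
  · exact contDiffAt_const.congr_of_eventuallyEq (notMem_tsupport_iff_eventuallyEq.1 hx)
lemma line_bd {G : E n → ℝ} (hG : IsTest univ G) {v : E n} (hv : ‖v‖ = 1) (y : E n) :
    ‖G y‖ₑ ≤ ∫⁻ s in Iic (0:ℝ), ‖pd v G (y + s • v)‖ₑ := by
  have hi : Isometry fun s : ℝ => y + s • v := by
    refine Isometry.of_dist_eq fun s t => ?_
    rw [dist_add_left, dist_eq_norm, ← sub_smul, norm_smul, hv, mul_one, Real.dist_eq, Real.norm_eq_abs]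
  have hc : HasCompactSupport fun s : ℝ => G (y + s • v) := hG.cs.comp_isClosedEmbedding hi.isClosedEmbedding
  have hd : ContDiff ℝ 1 fun s : ℝ => G (y + s • v) := (hG.cd.of_le (by simp)).comp (by fun_prop)
  have := hc.enorm_le_lintegral_Ici_deriv hd 0
  rw [zero_smul, add_zero] at this
  refine this.trans_eq (lintegral_congr fun s => ?_)
  congr 1
  have h1 : HasDerivAt (fun s : ℝ => y + s • v) v s := by
    simpa using ((hasDerivAt_id s).smul_const v).const_add y
  exact ((hG.cd.differentiable (by simp) (y + s • v)).hasFDerivAt.comp_hasDerivAt s h1).deriv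
lemma orthant {j : ℕ} {G : E n → ℝ} (hG : IsTest univ G) {vs : Fin j → E n} (hv : ∀ i, ‖vs i‖ = 1) (y : E n) :
    ‖G y‖ₑ ≤ ∫⁻ z, ‖pdl (List.ofFn vs) G (y + ∑ i, z i • vs i)‖ₑ ∂(Measure.pi fun _ : Fin j => (volume.restrict (Iic (0:ℝ)))) := by
  induction j generalizing G y with
  | zero => simp [pdl]
  | succ j ih =>
    refine (line_bd hG (hv 0) y).trans ?_
    refine (lintegral_mono fun s => ih (hG.pd (vs 0)) (fun i => hv i.succ) (y + s • vs 0)).trans_eq ?_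
    have hm := measurePreserving_piFinSuccAbove (fun _ : Fin (j+1) => (volume.restrict (Iic (0:ℝ)))) 0
    have hT : Measurable fun z : Fin (j+1) → ℝ => ‖pdl (List.ofFn vs) G (y + ∑ i, z i • vs i)‖ₑ :=
      ((hG.pdl _).cd.continuous.comp (by fun_prop)).measurable.enorm
    rw [← hm.symm.lintegral_comp hT, lintegral_prod]
    swap
    · exact (hT.comp hm.symm.measurable).aemeasurable
    refine lintegral_congr fun s => lintegral_congr fun z => ?_
    rw [List.ofFn_succ, Fin.sum_univ_succ]
    simp [MeasurableEquiv.piFinSuccAbove, pdl, Fin.insertNthEquiv, add_assoc]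
lemma sob (b : OrthonormalBasis (Fin n) ℝ (E n)) (i : Fin n) {G : E n → ℝ} (hG : IsTest univ G) (y : E n) :
    ‖G y‖ₑ ≤ ∫⁻ x in {x | ⟪b i, x - y⟫ ≤ 0}, ‖pdl (List.ofFn b) G x‖ₑ := by
  refine (orthant hG (fun i => b.orthonormal.1 i) y).trans ?_
  have hT : Continuous (pdl (List.ofFn b) G) := (hG.pdl _).cd.continuous
  have hA : IsClosed {x | ⟪b i, x - y⟫ ≤ 0} := isClosed_le (by fun_prop) continuous_const
  have e : ∀ z : Fin n → ℝ, b.repr.symm (WithLp.toLp 2 z) = ∑ i, z i • b i := fun z => by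
    rw [← b.sum_repr_symm]
  have hm : MeasurePreserving (fun z : Fin n → ℝ => y + b.repr.symm (WithLp.toLp 2 z)) volume volume :=
    (measurePreserving_add_left volume y).comp (b.measurePreserving_repr_symm.comp (PiLp.volume_preserving_toLp (Fin n)))
  rw [← Measure.restrict_pi_pi, ← lintegral_indicator hA.measurableSet, ← hm.lintegral_comp (by
    exact hT.measurable.enorm.indicator hA.measurableSet), ← lintegral_indicator (MeasurableSet.univ_pi fun _ => measurableSet_Iic)]
  refine lintegral_mono fun z => ?_
  by_cases hz : z ∈ Set.pi univ fun _ : Fin n => Iic (0:ℝ)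
  · rw [indicator_of_mem hz, indicator_of_mem, e]
    have := hz i (mem_univ _)
    simp only [mem_ofPred_eq, add_sub_cancel_left]
    rw [← b.repr_apply_apply]
    simpa using this
  · rw [indicator_of_notMem hz]; exact zero_le
lemma all_mul (C : Cl N P) (hN : IsOpen N) {a f : E n → ℝ} (ha : ContDiff ℝ ∞ a) (hf : ContDiffOn ℝ ∞ f N)
    (h : ∀ l, P (pdl l f)) (l : List (E n)) : P (pdl l fun y => a y * f y) := by
  induction l generalizing a f with
  | nil => exact C.mul ha (h [])
  | cons v l ih =>
    have e : EqOn (pd v fun y => a y * f y) (fun y => pd v a y * f y + a y * pd v f y) N := fun x hx =>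
      pd_mulr (ha.differentiable (by simp) x) (cdo_dif hN hf hx) v
    refine C.congr (pdl_on hN e l) (C.congr (pdl_add hN ((cd_pd ha v).contDiffOn.mul hf) (ha.contDiffOn.mul (cdo_pd hN hf v)) l) (C.add ?_ ?_))
    · exact ih (cd_pd ha v) hf h
    · exact ih ha (cdo_pd hN hf v) fun l => h (v :: l)
def hb (ν p : E n) (r : ℝ) : Set (E n) := ball p r ∩ {y | ⟪ν, y - p⟫ < 0}
lemma hb_open (ν p : E n) (r : ℝ) : IsOpen (hb ν p r) := isOpen_ball.inter (isOpen_lt (by fun_prop) continuous_const)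
lemma Cl_int (hN : Bornology.IsBounded N) (hNm : MeasurableSet N) : Cl N (fun f => IntegrableOn f N volume) where
  congr e h := h.congr_fun e.symm hNm
  add h h' := h.add h'
  mul {a f} ha h := by
    obtain ⟨C, hC⟩ := hN.isCompact_closure.exists_bound_of_continuousOn ha.continuous.continuousOn
    exact Integrable.bdd_mul (c := C) h ha.continuous.aestronglyMeasurable
      ((ae_restrict_iff' hNm).2 (ae_of_all _ fun x hx => hC x (subset_closure hx)))
lemma sob_bd (hν : ‖ν‖ = 1) (hr : 0 < r) {w : E n → ℝ} (hw : ContDiffOn ℝ ∞ w (hb ν p r))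
    (h : ∀ l, IntegrableOn (pdl l w) (hb ν p r) volume) : ∃ C : ℝ, ∀ y ∈ hb ν p (r/2), |w y| ≤ C := by
  have hne : ν ≠ 0 := by rintro rfl; simp at hν
  obtain ⟨i⟩ : Nonempty (Fin n) := by
    by_contra hh
    rw [not_nonempty_iff] at hh
    exact hne (Subsingleton.elim _ _)
  obtain ⟨b, hbi⟩ := Orthonormal.exists_orthonormalBasis_extension_of_card_eq (𝕜 := ℝ) (E := E n) (ι := Fin n) (by simp)
    (v := fun _ => ν) (s := {i}) ⟨fun j => by simpa using hν, fun j k hjk => (hjk (Subsingleton.elim _ _)).elim⟩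
  replace hbi := hbi i rfl
  let χ : ContDiffBump p := ⟨r/2, 3*r/4, by linarith, by linarith⟩
  have hχs : tsupport χ ⊆ ball p r := by
    rw [χ.tsupport_eq]; exact Metric.closedBall_subset_ball (by change 3*r/4 < r; linarith)
  set F : E n → ℝ := fun x => χ x * w x with hF
  have hFs : tsupport F ⊆ tsupport χ := tsupport_mul_subset_left
  have hbm : Bornology.IsBounded (hb ν p r) := isBounded_ball.subset inter_subset_left
  have hI : IntegrableOn (pdl (List.ofFn b) F) (hb ν p r) volume :=
    all_mul (Cl_int hbm (hb_open ν p r).measurableSet) (hb_open ν p r) χ.contDiff hw h _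
  refine ⟨(∫⁻ x in hb ν p r, ‖pdl (List.ofFn b) F x‖ₑ).toReal, fun y hy => ?_⟩
  have hly : ⟪ν, y - p⟫ < 0 := hy.2
  set t := ⟪ν, y - p⟫ with ht
  set G : E n → ℝ := fun x => Real.smoothTransition ((⟪ν, x - p⟫ - t/4) / (t/4)) * F x with hG
  have hM : IsOpen {x | ⟪ν, x - p⟫ < 2/3*t} := isOpen_lt (by fun_prop) continuous_const
  have hGF : EqOn G F {x | ⟪ν, x - p⟫ < 2/3*t} := by
    intro x hx
    have hx' : ⟪ν, x - p⟫ < 2/3*t := hx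
    rw [hG]
    simp only
    rw [Real.smoothTransition.one_of_one_le, one_mul]
    rw [le_div_iff_of_neg (by linarith)]; linarith
  have hGs : tsupport G ⊆ hb ν p r := by
    intro x hx
    refine ⟨hχs (hFs (tsupport_mul_subset_right hx)), ?_⟩
    have h1 : tsupport G ⊆ {x | ⟪ν, x - p⟫ ≤ t/4} := by
      refine closure_minimal (fun x hx => ?_) (isClosed_le (by fun_prop) continuous_const)
      by_contra hxx
      have hxx : ¬ ⟪ν, x - p⟫ ≤ t/4 := hxx
      refine hx ?_
      rw [hG]
      simp only
      rw [Real.smoothTransition.zero_of_nonpos, zero_mul]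
      exact div_nonpos_of_nonneg_of_nonpos (by linarith) (by linarith)
    have : ⟪ν, x - p⟫ ≤ t/4 := h1 hx
    change ⟪ν, x - p⟫ < 0
    linarith
  have hGt : IsTest univ G := by
    refine ⟨cd_of_ts fun x hx => ?_, ?_, subset_univ _⟩
    · refine ContDiffAt.mul ?_ (χ.contDiff.contDiffAt.mul (hw.contDiffAt ((hb_open ν p r).mem_nhds (hGs hx))))
      exact Real.smoothTransition.contDiffAt.comp x (((contDiffAt_const.inner ℝ (contDiffAt_id.sub contDiffAt_const)).sub contDiffAt_const).div_const _)
    · exact χ.hasCompactSupport.mono' ((subset_tsupport _).trans ((tsupport_mul_subset_right).trans hFs))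
  have hyG : G y = w y := by
    rw [hGF (by change t < 2/3*t; linarith), hF]
    simp only
    rw [χ.one_of_mem_closedBall (ball_subset_closedBall hy.1), one_mul]
  have hs := sob b i hGt y
  rw [hyG, hbi] at hs
  have h2 : ∫⁻ x in {x | ⟪ν, x - y⟫ ≤ 0}, ‖pdl (List.ofFn b) G x‖ₑ ≤ ∫⁻ x in hb ν p r, ‖pdl (List.ofFn b) F x‖ₑ := by
    rw [← lintegral_indicator (isClosed_le (by fun_prop) continuous_const).measurableSet, ← lintegral_indicator (hb_open ν p r).measurableSet]
    refine lintegral_mono fun x => ?_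
    by_cases hx : x ∈ {x | ⟪ν, x - y⟫ ≤ 0}
    · have hx1 : ⟪ν, x - p⟫ ≤ t := by
        have : ⟪ν, x - y⟫ ≤ 0 := hx
        have e : x - p = (x - y) + (y - p) := by abel
        rw [e, inner_add_right]; linarith
      rw [indicator_of_mem hx, pdl_on hM hGF _ (by change ⟪ν, x - p⟫ < 2/3*t; linarith)]
      by_cases hx2 : x ∈ hb ν p r
      · rw [indicator_of_mem hx2]
      · rw [image_eq_zero_of_notMem_tsupport (f := pdl (List.ofFn b) F)]
        · simp
        · intro h3
          exact hx2 ⟨hχs (hFs (tsupport_pdl _ _ h3)), by change ⟪ν, x - p⟫ < 0; linarith⟩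
    · rw [indicator_of_notMem hx]; exact zero_le
  have h3 := ENNReal.toReal_mono hI.2.ne (hs.trans h2)
  simpa using h3
lemma pdl_pd {w : E n → ℝ} (hN : IsOpen N) (hw : ContDiffOn ℝ ∞ w N) (v : E n) (l : List (E n)) :
    EqOn (pdl l (pd v w)) (pd v (pdl l w)) N := by
  induction l generalizing w with
  | nil => exact fun _ _ => rfl
  | cons u l ih =>
    exact (pdl_on hN (fun x hx => pd_comm (hw.contDiffAt (hN.mem_nhds hx)) u v) l).trans (ih (cdo_pd hN hw u))
lemma reg {O : Set (E n)} {g f u : E n → ℝ} (hn : 0 < n) (hO : Bornology.IsBounded O) (S : Sh ν g) (hr : 0 < r)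
    (hW : ∀ y ∈ ball p (3*r), sh ν g y ∈ O ↔ ⟪ν, y - p⟫ < 0) (hf : M2 f)
    (hf0 : ∀ y ∈ closedBall p (2*r), f (sh ν g y) = 0)
    (hu : ContDiffOn ℝ ∞ u (hs ν g ⁻¹' hb ν p r)) (hL : ∀ x, hs ν g x ∈ hb ν p r → Lap u x = 0)
    (hue : ∀ᵐ y, y ∈ hb ν p r → GG O (l2 f) (sh ν g y) = u (sh ν g y)) (l : List (E n)) :
    ∃ C : ℝ, ∀ y ∈ hb ν p (r/2), |pdl l (fun y => u (sh ν g y)) y| ≤ C := by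
  have hN := hb_open ν p r
  have hbm : Bornology.IsBounded (hb ν p r) := isBounded_ball.subset inter_subset_left
  have C := Cl_int hbm hN.measurableSet
  have hw := S.cd_comp hu
  have T := tang_L2 hn hO S hr hW hf hf0 hN inter_subset_left hw hue
  have h2 : Tn ν (hb ν p r) (fun f => IntegrableOn f (hb ν p r) volume) (pd ν fun y => u (sh ν g y)) :=
    ⟨cdo_pd hN hw ν, fun l => C.congr (pdl_pd hN hw ν _) (T l).2⟩
  have A := Tw.all C hN (Tw_of C hN S hu hL ⟨hw, fun l => (T l).1⟩ h2)
  refine sob_bd S.nu hr (cdo_pdl hN hw l) fun m => ?_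
  rw [← pdl_append]
  exact A _
end sob
section straight
variable {n : ℕ} {p : E n} {U O : Set (E n)} {ρ : E n → ℝ}
lemma cut_small {h : E n → ℝ} (hU : IsOpen U) (hp : p ∈ U) (hh : ContDiffOn ℝ ∞ h U) (h0 : h p = 0) (hd : fderiv ℝ h p = 0) :
    ∃ (σ : E n → ℝ) (δ : ℝ), 0 < δ ∧ ball p δ ⊆ U ∧ ContDiff ℝ ∞ σ ∧ (∀ x, ‖fderiv ℝ σ x‖ ≤ 1/2) ∧ ∀ x ∈ ball p δ, σ x = h x := by
  let B : ContDiffBump (0 : E n) := ⟨1, 2, by norm_num, by norm_num⟩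
  have hBc : ContDiff ℝ ∞ B := B.contDiff
  obtain ⟨K, hK⟩ := (hBc.continuous_fderiv (by simp)).bounded_above_of_compact_support (B.hasCompactSupport.fderiv (𝕜 := ℝ))
  have hK0 : 0 ≤ K := (norm_nonneg _).trans (hK 0)
  set ε : ℝ := 1 / (2 * (2*K+1)) with hε
  have hε0 : 0 < ε := by positivity
  have hcf : ContinuousAt (fderiv ℝ h) p := (hh.contDiffAt (hU.mem_nhds hp)).continuousAt_fderiv (by simp)
  have h1 : ∀ᶠ x in 𝓝 p, x ∈ U ∧ ‖fderiv ℝ h x‖ < ε := by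
    refine (hU.eventually_mem hp).and ?_
    have := hcf.norm
    rw [ContinuousAt, hd, norm_zero] at this
    exact this.eventually_lt_const hε0
  obtain ⟨δ', hδ', hb⟩ := eventually_nhds_iff_ball.1 h1
  set δ := δ'/3 with hδ
  have hδ0 : 0 < δ := by positivity
  have hb2 : ∀ x ∈ closedBall p (2*δ), x ∈ ball p δ' := fun x hx =>
    Metric.closedBall_subset_ball (by rw [hδ]; linarith) hx
  have hhd : ∀ x ∈ closedBall p (2*δ), |h x| ≤ ε * (2*δ) := by
    intro x hx
    have := (convex_ball p δ').norm_image_sub_le_of_norm_fderiv_le (𝕜 := ℝ) (f := h) (C := ε)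
      (fun y hy => cdo_dif hU hh (hb y hy).1) (fun y hy => (hb y hy).2.le) (mem_ball_self hδ') (hb2 x hx)
    rw [h0, sub_zero, Real.norm_eq_abs] at this
    refine this.trans (mul_le_mul_of_nonneg_left ?_ hε0.le)
    rw [← dist_eq_norm]; exact hx
  set η : E n → ℝ := fun x => B (δ⁻¹ • (x - p)) with hη
  have hηc : ContDiff ℝ ∞ η := hBc.comp (by fun_prop)
  have hηs : tsupport η ⊆ closedBall p (2*δ) := by
    refine closure_minimal (fun x hx => ?_) isClosed_closedBall
    have h2 : δ⁻¹ • (x - p) ∈ ball (0 : E n) 2 := by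
      have := B.support_eq ▸ (show δ⁻¹ • (x - p) ∈ Function.support B from hx)
      exact this
    rw [mem_ball_zero_iff, norm_smul, Real.norm_of_nonneg (by positivity), inv_mul_lt_iff₀ hδ0] at h2
    rw [mem_closedBall_iff_norm]; linarith
  have hηd : ∀ x, ‖fderiv ℝ η x‖ ≤ K * δ⁻¹ := by
    intro x
    have e : HasFDerivAt η ((fderiv ℝ B (δ⁻¹ • (x - p))).comp (δ⁻¹ • ContinuousLinearMap.id ℝ (E n))) x :=
      HasFDerivAt.comp (g := B) (f := fun x => δ⁻¹ • (x - p)) x (hBc.differentiable (by simp) _).hasFDerivAt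
        (((hasFDerivAt_id x).sub_const p).const_smul δ⁻¹)
    rw [e.fderiv]
    refine (ContinuousLinearMap.opNorm_comp_le _ _).trans (mul_le_mul (hK _) ?_ (norm_nonneg _) hK0)
    rw [norm_smul, Real.norm_of_nonneg (by positivity)]
    exact mul_le_of_le_one_right (by positivity) ContinuousLinearMap.norm_id_le
  have hss : tsupport (fun x => η x * h x) ⊆ tsupport η := tsupport_mul_subset_left
  refine ⟨fun x => η x * h x, δ, hδ0, fun x hx => ?_, ?_, fun x => ?_, fun x hx => ?_⟩
  · exact (hb x (ball_subset_ball (by rw [hδ]; linarith) hx)).1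
  · refine cd_of_ts fun x hx => ?_
    exact hηc.contDiffAt.mul (hh.contDiffAt (hU.mem_nhds (hb x (hb2 x (hηs (hss hx)))).1))
  · by_cases hx : x ∈ tsupport η
    · have hx1 := hηs hx
      have hx2 := hb x (hb2 x hx1)
      rw [HasFDerivAt.fderiv (f := fun x => η x * h x) ((hηc.differentiable (by simp) x).hasFDerivAt.mul (cdo_dif hU hh hx2.1).hasFDerivAt)]
      refine (norm_add_le _ _).trans ?_
      rw [norm_smul, norm_smul]
      have a1 : ‖η x‖ ≤ 1 := by rw [Real.norm_of_nonneg B.nonneg]; exact B.le_one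
      have a2 : ‖η x‖ * ‖fderiv ℝ h x‖ ≤ 1 * ε := mul_le_mul a1 hx2.2.le (norm_nonneg _) zero_le_one
      have a3 : ‖h x‖ * ‖fderiv ℝ η x‖ ≤ (ε * (2*δ)) * (K * δ⁻¹) := mul_le_mul (hhd x hx1) (hηd x) (norm_nonneg _) (by positivity)
      have a4 : (ε * (2*δ)) * (K * δ⁻¹) = ε * (2*K) := by field_simp
      have a5 : ε * (2*K+1) = 1/2 := by rw [hε]; field_simp
      linarith
    · rw [image_eq_zero_of_notMem_tsupport (f := fderiv ℝ fun x => η x * h x) (fun hh => hx (hss (tsupport_fderiv_subset ℝ hh)))]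
      simp
  · have : η x = 1 := by
      refine B.one_of_mem_closedBall ?_
      rw [mem_closedBall_zero_iff, norm_smul, Real.norm_of_nonneg (by positivity), inv_mul_le_iff₀ hδ0]
      rw [mem_ball_iff_norm] at hx
      change _ ≤ δ * 1; linarith
    change η x * h x = h x
    rw [this, one_mul]
lemma straighten (hU : IsOpen U) (hp : p ∈ U) (hρ : ContDiffOn ℝ ∞ ρ U) (h0 : ρ p = 0) (hd : fderiv ℝ ρ p ≠ 0)
    (hO : ∀ x ∈ U, x ∈ O ↔ ρ x < 0) : ∃ (ν : E n) (g : E n → ℝ) (R : ℝ), 0 < R ∧ Sh ν g ∧ g p = 0 ∧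
    ∀ y ∈ ball p R, sh ν g y ∈ O ↔ ⟪ν, y - p⟫ < 0 := by
  set G := ∇ ρ p with hG
  have hGd : ∀ v, fderiv ℝ ρ p v = ⟪G, v⟫ := fun v => (inner_grad ρ p v).symm
  have hG0 : 0 < ‖G‖ := by
    rw [norm_pos_iff]; intro h; apply hd; ext v; rw [hGd, h]; simp
  set c := ‖G‖⁻¹ with hc
  have hc0 : 0 < c := by positivity
  set ν := c • G with hν
  have hν1 : ‖ν‖ = 1 := by rw [hν, norm_smul, hc, norm_inv, norm_norm, inv_mul_cancel₀ hG0.ne']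
  have hli : ∀ x : E n, HasFDerivAt (fun x => ⟪ν, x - p⟫) (innerSL ℝ ν) x := fun x =>
    HasFDerivAt.comp (g := innerSL ℝ ν) (f := fun x => x - p) x (innerSL ℝ ν).hasFDerivAt ((hasFDerivAt_id x).sub_const p)
  have hlc : ContDiff ℝ ∞ fun x : E n => ⟪ν, x - p⟫ := contDiff_const.inner ℝ (contDiff_id.sub contDiff_const)
  have hhd : fderiv ℝ (fun x => c * ρ x - ⟪ν, x - p⟫) p = 0 := by
    rw [HasFDerivAt.fderiv (f := fun x => c * ρ x - ⟪ν, x - p⟫) (((cdo_dif hU hρ hp).hasFDerivAt.const_mul c).sub (hli p))]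
    ext v
    simp [hGd, hν, inner_smul_left]
  obtain ⟨σ, δ, hδ, hδU, hσ, hσd, hσe⟩ := cut_small hU hp ((contDiffOn_const.mul hρ).sub hlc.contDiffOn) (by simp [h0]) hhd
  have hσp : σ p = 0 := by rw [hσe p (mem_ball_self hδ)]; simp [h0]
  have hσL : ∀ x y, |σ x - σ y| ≤ 1/2 * ‖x - y‖ := fun x y =>
    convex_univ.norm_image_sub_le_of_norm_fderiv_le (𝕜 := ℝ) (fun z _ => hσ.differentiable (by simp) z) (fun z _ => hσd z) (mem_univ _) (mem_univ _)
  obtain ⟨θ, hθ, hθ1, hθ2⟩ := near_id (σ := fun x => σ x • ν) (hσ.smul contDiff_const) (fun x => by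
    rw [HasFDerivAt.fderiv (f := fun x => σ x • ν) ((hσ.differentiable (by simp) x).hasFDerivAt.smul_const ν), ContinuousLinearMap.norm_smulRight_apply, hν1, mul_one]
    exact hσd x)
  have hinn : ⟪ν, ν⟫ = 1 := by rw [real_inner_self_eq_norm_sq, hν1]; norm_num
  let π : E n → E n := fun y => y - ⟪ν, y - p⟫ • ν
  have hπ : ContDiff ℝ ∞ π := contDiff_id.sub (hlc.smul contDiff_const)
  let g : E n → ℝ := fun y => - σ (θ (π y))
  have hπp : π p = p := by simp [π]
  have hθp : θ p = p := by have := hθ1 p; rwa [hσp, zero_smul, add_zero] at this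
  have hgp : g p = 0 := by simp only [g, hπp, hθp, hσp, neg_zero]
  have hg : ContDiff ℝ ∞ g := (hσ.comp (hθ.comp hπ)).neg
  have S : Sh ν g := ⟨hν1, hg, fun x t => by
    have : π (x + t • ν) = π x := by
      have e : x + t • ν - p = (x - p) + t • ν := by abel
      simp only [π]
      rw [e, inner_add_right, inner_smul_right, hinn, mul_one, add_smul]; abel
    simp only [g, this]⟩
  have hcs : ContinuousAt (sh ν g) p := S.cd_sh.continuous.continuousAt
  have hsp : sh ν g p = p := by simp [sh, hgp]
  obtain ⟨R, hR, hRb⟩ := eventually_nhds_iff_ball.1 (hcs.eventually (ball_mem_nhds (sh ν g p) hδ))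
  refine ⟨ν, g, R, hR, S, hgp, fun y hy => ?_⟩
  have hb := hRb y hy
  rw [hsp] at hb
  rw [hO _ (hδU hb)]
  set t := ⟪ν, y - p⟫ with ht
  set q := θ (π y) with hq
  have e1 : sh ν g y = q + t • ν := by
    have := hθ2 (π y)
    rw [← hq] at this
    have h2 : q = π y - σ q • ν := by rw [← this]; abel
    change y + (- σ q) • ν = q + t • ν
    nth_rw 2 [h2]
    simp only [π]; rw [neg_smul, ← ht]; abel
  have e2 : ⟪ν, q - p⟫ + σ q = 0 := by
    have h2 : q + σ q • ν = π y := hθ2 (π y)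
    have h3 : ⟪ν, q + σ q • ν - p⟫ = ⟪ν, π y - p⟫ := by rw [h2]
    have h4 : ⟪ν, π y - p⟫ = 0 := by
      have e : π y - p = (y - p) - t • ν := by simp only [π]; rw [← ht]; abel
      rw [e, inner_sub_right, inner_smul_right, hinn, ← ht]; ring
    have e : q + σ q • ν - p = (q - p) + σ q • ν := by abel
    rw [h4, e, inner_add_right, inner_smul_right, hinn] at h3
    linarith
  have e3 : c * ρ (sh ν g y) = t + (σ (q + t • ν) - σ q) := by
    have h2 := hσe _ hb
    rw [e1] at h2 ⊢
    have e : q + t • ν - p = (q - p) + t • ν := by abel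
    simp only [e, inner_add_right, inner_smul_right, hinn] at h2
    linarith
  have e4 : |σ (q + t • ν) - σ q| ≤ 1/2 * |t| := by
    have := hσL (q + t • ν) q
    rwa [add_sub_cancel_left, norm_smul, hν1, mul_one] at this
  rw [abs_le] at e4
  constructor
  · intro h
    have h5 : c * ρ (sh ν g y) < 0 := mul_neg_of_pos_of_neg hc0 h
    by_contra h6
    rw [abs_of_nonneg (not_lt.1 h6)] at e4
    linarith
  · intro h
    rw [abs_of_neg h] at e4
    have h5 : c * ρ (sh ν g y) < 0 := by linarith
    exact (pos_iff_neg_of_mul_neg h5).1 hc0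
end straight
section vanish
variable {n : ℕ} {ν p q : E n} {g : E n → ℝ} {O : Set (E n)}
lemma M2.trans {ψ : E n → ℝ} (hψ : M2 ψ) (v : E n) : M2 fun y => ψ (y - v) :=
  hψ.comp_measurePreserving (measurePreserving_sub_right volume v)
lemma trans_bd (κ : KK O) {ψ : E n → ℝ} (hψ : M2 ψ) (hν : ‖ν‖ = 1) {δ : ℝ} (hδ : 0 ≤ δ) :
    |⟪fK O κ, l2 (fun y => ψ (y - δ • ν)) - l2 ψ⟫| ≤ δ * (‖sK O κ‖ * ‖l2 ψ‖) := by
  refine K_ind (P := fun κ => |⟪fK O κ, l2 (fun y => ψ (y - δ • ν)) - l2 ψ⟫| ≤ δ * (‖sK O κ‖ * ‖l2 ψ‖))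
    (isClosed_le ((fK O).continuous.inner continuous_const).abs (continuous_const.mul ((sK O).continuous.norm.mul continuous_const))) (fun φ h => ?_) κ
  rw [fK_jK, sK_jK, inner_sub_right, inner_l2 h.m2 (hψ.trans _), inner_l2 h.m2 hψ]
  have hφ : IsTest univ φ := h.mono (subset_univ _)
  have hloc : LocallyIntegrable ψ volume := hψ.locallyIntegrable (by norm_num)
  let F : ℝ → ℝ := fun s => ∫ y, ψ y * φ (y - (-(s • ν)))
  have hF : ∀ s, ∃ D, HasDerivAt F D s ∧ ‖D‖ ≤ ‖l2 (∇ φ)‖ * ‖l2 ψ‖ := by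
    intro s
    obtain ⟨L, hL, hL2⟩ := conv_deriv hloc hφ (-(s • ν))
    have h1 : HasDerivAt (fun s : ℝ => -(s • ν)) (-ν) s := by
      have := HasDerivAt.fun_neg ((hasDerivAt_id' s).smul_const ν)
      rwa [one_smul] at this
    refine ⟨_, HasFDerivAt.comp_hasDerivAt (l := fun s => ∫ y, ψ y * φ (y - s)) (f := fun s : ℝ => -(s • ν)) s hL h1, ?_⟩
    rw [hL2, norm_neg]
    have hm : M2 fun y => ψ (y - s • ν) := hψ.trans _
    rw [← integral_add_right_eq_self _ (-(s • ν))]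
    simp only [← sub_eq_add_neg, sub_neg_eq_add, sub_add_cancel]
    have e : ∫ y, ψ (y - s • ν) * pd (-ν) φ y = ⟪l2 (fun y => ψ (y - s • ν)), l2 (pd (-ν) φ)⟫ := by
      rw [inner_l2 hm (h.pd _).m2]
      exact integral_congr_ae (.of_forall fun y => by simp [mul_comm])
    rw [e, Real.norm_eq_abs]
    refine (abs_real_inner_le_norm _ _).trans ?_
    have e1 : ‖l2 (fun y => ψ (y - s • ν))‖ = ‖l2 ψ‖ := by
      rw [← sq_eq_sq₀ (norm_nonneg _) (norm_nonneg _), norm_l2_sq hm, norm_l2_sq hψ]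
      exact integral_sub_right_eq_self (fun y => ‖ψ y‖ ^ 2) (s • ν)
    have e2 : ‖l2 (pd (-ν) φ)‖ ≤ ‖l2 (∇ φ)‖ := by
      refine Lp.norm_le_norm_of_ae_le ?_
      filter_upwards [l2_coe (h.pd (-ν)).m2, l2_coe h.gm2] with x h1 h2
      rw [h1, h2, ← inner_grad]
      refine (norm_inner_le_norm _ _).trans_eq ?_
      rw [norm_neg, hν, mul_one]
    rw [e1, mul_comm]
    exact mul_le_mul_of_nonneg_right e2 (norm_nonneg _)
  choose D hD hDb using hF
  have := convex_univ.norm_image_sub_le_of_norm_hasDerivWithin_le (fun s _ => (hD s).hasDerivWithinAt) (fun s _ => hDb s) (mem_univ 0) (mem_univ δ)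
  simp only [F, Real.norm_eq_abs, zero_smul, neg_zero, sub_zero, abs_of_nonneg hδ] at this
  rw [mul_comm] at this
  refine le_trans (le_of_eq ?_) this
  congr 2
  · rw [← integral_add_right_eq_self _ (δ • ν)]
    exact integral_congr_ae (.of_forall fun y => by simp)
lemma co1 (ν q : E n) : Continuous fun y => ‖tp ν (y - q)‖ := by fun_prop
lemma co2 (ν q : E n) : Continuous fun y => ⟪ν, y - q⟫ := by fun_prop
def cyl (ν q : E n) (ε δ : ℝ) : Set (E n) := {y | ‖tp ν (y - q)‖ < ε ∧ -δ ≤ ⟪ν, y - q⟫ ∧ ⟪ν, y - q⟫ < 0}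
lemma cyl_meas (ν q : E n) (ε δ : ℝ) : MeasurableSet (cyl ν q ε δ) := by
  refine MeasurableSet.inter ?_ (MeasurableSet.inter ?_ ?_)
  · exact (isOpen_lt (co1 ν q) continuous_const).measurableSet
  · exact (isClosed_le continuous_const (co2 ν q)).measurableSet
  · exact (isOpen_lt (co2 ν q) continuous_const).measurableSet
lemma tp_self (hν : ‖ν‖ = 1) : tp ν ν = 0 := by
  rw [tp_apply, real_inner_self_eq_norm_sq, hν]; simp
lemma cyl_cover (hν : ‖ν‖ = 1) {ε δ : ℝ} (N : ℕ) :
    volume (cyl ν q ε (N * δ)) ≤ N * volume (cyl ν q ε δ) := by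
  have hinn : ⟪ν, ν⟫ = 1 := by rw [real_inner_self_eq_norm_sq, hν]; norm_num
  induction N with
  | zero =>
    have : cyl ν q ε (((0:ℕ):ℝ) * δ) = ∅ := by
      ext y; simp only [cyl, mem_ofPred_eq, mem_empty_iff_false, iff_false]
      rintro ⟨_, h1, h2⟩; simp at h1; linarith
    rw [this]; simp
  | succ N ih =>
    have : cyl ν q ε (((N+1:ℕ):ℝ) * δ) ⊆ cyl ν q ε (N * δ) ∪ (fun y => y + ((N:ℝ) * δ) • ν) ⁻¹' cyl ν q ε δ := by
      rintro y ⟨h0, h1, h2⟩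
      push_cast at h1
      by_cases h3 : -(N * δ) ≤ ⟪ν, y - q⟫
      · exact Or.inl ⟨h0, h3, h2⟩
      · right
        have e : y + ((N:ℝ) * δ) • ν - q = (y - q) + ((N:ℝ) * δ) • ν := by abel
        change ‖tp ν (_ - q)‖ < ε ∧ -δ ≤ ⟪ν, _ - q⟫ ∧ ⟪ν, _ - q⟫ < 0
        rw [e, map_add, map_smul, tp_self hν, smul_zero, add_zero, inner_add_right, inner_smul_right, hinn]
        exact ⟨h0, by linarith, by linarith⟩
    refine (measure_mono this).trans ((measure_union_le _ _).trans ?_)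
    rw [measure_preimage_add_right]
    push_cast
    rw [add_mul, one_mul]
    gcongr
lemma vanish (hO : IsOpen O) (κ : KK O) (S : Sh ν g) {R : ℝ}
    (hW : ∀ y ∈ ball p R, sh ν g y ∈ O ↔ ⟪ν, y - p⟫ < 0) (hq : q ∈ ball p R) (hq0 : ⟪ν, q - p⟫ = 0)
    {c ε : ℝ} (hc : 0 < c) (hε : 0 < ε) (h : ∀ᵐ y, y ∈ ball q ε → ⟪ν, y - p⟫ < 0 → c ≤ |fK O κ (sh ν g y)|) : False := by
  have hν := S.nu
  have hinn : ⟪ν, ν⟫ = 1 := by rw [real_inner_self_eq_norm_sq, hν]; norm_num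
  have hl : ∀ y, ⟪ν, y - p⟫ = ⟪ν, y - q⟫ := fun y => by
    have : y - p = (y - q) + (q - p) := by abel
    rw [this, inner_add_right, hq0, add_zero]
  obtain ⟨ε₁, hε₁, hb⟩ := Metric.isOpen_iff.1 isOpen_ball q hq
  set η := min ε ε₁ / 2 with hη
  have hη0 : 0 < η := by positivity
  have hη1 : 2 * η ≤ ε := by rw [hη]; linarith [min_le_left ε ε₁]
  have hη2 : 2 * η ≤ ε₁ := by rw [hη]; linarith [min_le_right ε ε₁]
  have hnb : ∀ y, ‖tp ν (y - q)‖ < η → |⟪ν, y - q⟫| ≤ η → y ∈ ball q (2*η) := by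
    intro y h1 h2
    rw [mem_ball_iff_norm]
    have e : y - q = tp ν (y - q) + ⟪ν, y - q⟫ • ν := by rw [tp_apply]; abel
    rw [e]
    refine (norm_add_le _ _).trans_lt ?_
    rw [norm_smul, hν, mul_one, Real.norm_eq_abs]
    linarith
  have hne : volume (cyl ν q η η) ≠ 0 := by
    refine (pos_iff_ne_zero.1 (lt_of_lt_of_le ?_ (measure_mono (show
      {y | ‖tp ν (y - q)‖ < η ∧ -η < ⟪ν, y - q⟫ ∧ ⟪ν, y - q⟫ < 0} ⊆ cyl ν q η η from fun y hy => ⟨hy.1, hy.2.1.le, hy.2.2⟩))))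
    refine IsOpen.measure_pos _ ?_ ⟨q - (η/2) • ν, ?_⟩
    · exact (isOpen_lt (co1 ν q) continuous_const).inter ((isOpen_lt continuous_const (co2 ν q)).inter (isOpen_lt (co2 ν q) continuous_const))
    · have e : q - (η/2) • ν - q = -((η/2) • ν) := by abel
      change ‖tp ν (_ - q)‖ < η ∧ -η < ⟪ν, _ - q⟫ ∧ ⟪ν, _ - q⟫ < 0
      rw [e, map_neg, map_smul, tp_self hν, inner_neg_right, inner_smul_right, hinn]
      simp only [smul_zero, neg_zero, norm_zero]
      exact ⟨hη0, by linarith, by linarith⟩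
  have hfin : ∀ δ ≤ η, volume (cyl ν q η δ) ≠ ⊤ := fun δ hδ =>
    ((measure_mono (fun y hy => hnb y hy.1 (abs_le.2 ⟨by linarith [hy.2.1], by linarith [hy.2.2]⟩))).trans_lt
      (measure_ball_lt_top (μ := volume) (x := q) (r := 2*η))).ne
  set M := ‖sK O κ‖ with hM
  have key : ∀ δ, 0 < δ → δ ≤ η → c^2 * volume.real (cyl ν q η δ) ≤ (δ * M)^2 := by
    intro δ hδ hδη
    set A := hs ν g ⁻¹' cyl ν q η δ with hA
    have hAm : MeasurableSet A := S.mp.measurable (cyl_meas ν q η δ)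
    have hAv : volume A = volume (cyl ν q η δ) := S.mp.measure_preimage (cyl_meas ν q η δ).nullMeasurableSet
    set ψ : E n → ℝ := A.indicator (fK O κ) with hψd
    have hψ : M2 ψ := (Lp.memLp (fK O κ)).indicator hAm
    have T := trans_bd κ hψ hν hδ.le
    rw [inner_sub_right] at T
    have e1 : ⟪fK O κ, l2 (fun y => ψ (y - δ • ν))⟫ = 0 := by
      rw [inner_Lp_l2 _ (hψ.trans _)]
      refine integral_eq_zero_of_ae ?_
      filter_upwards [K_zero_off hO κ] with x hx
      by_cases hxA : x - δ • ν ∈ A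
      · have h1 : hs ν g (x - δ • ν) = hs ν g x - δ • ν := by
          have := S.inv x (-δ)
          rw [neg_smul, ← sub_eq_add_neg] at this
          simp only [hs, this]; abel
        have h2 : hs ν g x - δ • ν ∈ cyl ν q η δ := h1 ▸ hxA
        have e : hs ν g x - δ • ν - q = (hs ν g x - q) - δ • ν := by abel
        obtain ⟨a1, a2, a3⟩ := h2
        rw [e, map_sub, map_smul, tp_self hν, smul_zero, sub_zero] at a1
        rw [e, inner_sub_right, inner_smul_right, hinn] at a2 a3
        have h3 := hW (hs ν g x) (hb (ball_subset_ball hη2 (hnb _ a1 (abs_le.2 ⟨by linarith, by linarith⟩))))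
        rw [S.sh_hs, hl] at h3
        rw [hx (fun h4 => by have := h3.1 h4; linarith)]; simp
      · rw [hψd, indicator_of_notMem hxA]; simp
    have e2 : ⟪fK O κ, l2 ψ⟫ = ‖l2 ψ‖ ^ 2 := by
      rw [inner_Lp_l2 _ hψ, norm_l2_sq hψ]
      refine integral_congr_ae (.of_forall fun x => ?_)
      by_cases hxA : x ∈ A
      · simp [hψd, indicator_of_mem hxA, pow_two]
      · simp [hψd, indicator_of_notMem hxA]
    rw [e1, e2, zero_sub, abs_neg, abs_of_nonneg (sq_nonneg _), ← mul_assoc] at T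
    have T2 : ‖l2 ψ‖ ≤ δ * M := by
      by_contra h5
      push Not at h5
      have h6 : 0 < ‖l2 ψ‖ := lt_of_le_of_lt (by positivity) h5
      nlinarith
    refine le_trans ?_ (pow_le_pow_left₀ (norm_nonneg _) T2 2)
    rw [norm_l2_sq hψ]
    have e3 : c^2 * volume.real (cyl ν q η δ) = ∫ x, A.indicator (fun _ => c^2) x := by
      rw [integral_indicator hAm, setIntegral_const, smul_eq_mul, mul_comm, Measure.real, Measure.real, hAv]
    rw [e3]
    refine integral_mono_ae ?_ hψ.norm.integrable_sq ?_
    · rw [integrable_indicator_iff hAm]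
      exact integrableOn_const (by rw [hAv]; exact hfin δ hδη)
    · filter_upwards [S.mp.quasiMeasurePreserving.ae h] with x hx
      by_cases hxA : x ∈ A
      · have h1 : hs ν g x ∈ cyl ν q η δ := hxA
        have h2 := hx (ball_subset_ball hη1 (hnb _ h1.1 (abs_le.2 ⟨by linarith [h1.2.1], by linarith [h1.2.2]⟩))) (by rw [hl]; exact h1.2.2)
        rw [S.sh_hs] at h2
        simp only [hψd, indicator_of_mem hxA, Real.norm_eq_abs]
        exact pow_le_pow_left₀ hc.le h2 2
      · simp [hψd, indicator_of_notMem hxA]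
  have hv0 : 0 < volume.real (cyl ν q η η) := ENNReal.toReal_pos hne (hfin η le_rfl)
  obtain ⟨N, hN⟩ := exists_nat_gt ((η * M)^2 / (c^2 * volume.real (cyl ν q η η)))
  rw [div_lt_iff₀ (by positivity)] at hN
  have hN0 : 0 < (N:ℝ) := by
    by_contra h5
    have : (N:ℝ) = 0 := le_antisymm (not_lt.1 h5) (Nat.cast_nonneg N)
    rw [this, zero_mul] at hN
    nlinarith [sq_nonneg (η * M)]
  have hN1 : (1:ℝ) ≤ N := by exact_mod_cast Nat.cast_pos.1 hN0
  have k1 := key (η / N) (by positivity) (div_le_self hη0.le hN1)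
  have k2 := cyl_cover (q := q) (ε := η) hν (δ := η / N) N
  rw [mul_div_cancel₀ _ hN0.ne'] at k2
  have k3 := ENNReal.toReal_mono (ENNReal.mul_ne_top (ENNReal.natCast_ne_top N) (hfin _ (div_le_self hη0.le hN1))) k2
  rw [ENNReal.toReal_mul, ENNReal.toReal_natCast] at k3
  change volume.real _ ≤ N * volume.real _ at k3
  have k4 : (η / N * M)^2 = (η * M)^2 / N^2 := by ring
  rw [k4, le_div_iff₀ (by positivity)] at k1
  have k5 : c^2 * volume.real (cyl ν q η η) * N ≤ c^2 * volume.real (cyl ν q η (η/N)) * N^2 := by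
    have : c^2 * volume.real (cyl ν q η η) * N ≤ c^2 * (N * volume.real (cyl ν q η (η/N))) * N := by gcongr
    refine this.trans_eq (by ring)
  nlinarith
end vanish
section ext
variable {n : ℕ} {ν p q : E n} {g : E n → ℝ} {O H : Set (E n)}
lemma fderiv_sum (w : E n → ℝ) (x : E n) : fderiv ℝ w x = ∑ i, pd (eb i) w x • innerSL ℝ (eb i) := by
  ext v
  have : v = ∑ i, v i • (eb i : E n) := by
    have := (EuclideanSpace.basisFun (Fin n) ℝ).sum_repr v
    simpa [eb] using this.symm
  conv_lhs => rw [this, map_sum]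
  rw [sum_apply]
  refine Finset.sum_congr rfl fun i _ => ?_
  have h : ⟪(eb i : E n), v⟫ = v i := by rw [eb, EuclideanSpace.inner_single_left]; simp
  rw [map_smul, smul_apply, innerSL_apply_apply, h, smul_eq_mul, smul_eq_mul, mul_comm]
  rfl
structure Bd (H : Set (E n)) (w : E n → ℝ) : Prop where
  cd : ContDiffOn ℝ ∞ w H
  bd : ∀ l, ∃ C : ℝ, ∀ y ∈ H, |pdl l w y| ≤ C
lemma Bd.pd {w : E n → ℝ} (hH : IsOpen H) (h : Bd H w) (v : E n) : Bd H (pd v w) := ⟨cdo_pd hH h.cd v, fun l => h.bd (v :: l)⟩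
lemma Bd.lim {w : E n → ℝ} (hH : IsOpen H) (hc : Convex ℝ H) (h : Bd H w) (x : E n) : ∃ y, Tendsto w (𝓝[H] x) (𝓝 y) := by
  choose C hC using fun i : Fin n => h.bd [eb i]
  have hL : LipschitzOnWith (∑ i, (C i).toNNReal) w H := by
    refine hc.lipschitzOnWith_of_nnnorm_fderiv_le (𝕜 := ℝ) (fun x hx => cdo_dif hH h.cd hx) fun x hx => ?_
    rw [fderiv_sum]
    refine (nnnorm_sum_le _ _).trans (Finset.sum_le_sum fun i _ => ?_)
    rw [← NNReal.coe_le_coe, coe_nnnorm, norm_smul, innerSL_apply_norm]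
    simp only [eb, PiLp.norm_single, norm_one, mul_one, Real.coe_toNNReal']
    exact (hC i x hx).trans (le_max_left _ _)
  obtain ⟨G, hG, e⟩ := hL.extend_real
  exact ⟨G x, (hG.continuous.continuousAt.continuousWithinAt (s := H)).congr' e.symm.eventuallyEq_nhdsWithin⟩
lemma Bd.ext {w : E n → ℝ} (hH : IsOpen H) (hc : Convex ℝ H) (hne : H.Nonempty) (h : Bd H w) :
    ContDiffOn ℝ ∞ (extendFrom H w) (closure H) := by
  have hu : UniqueDiffOn ℝ (closure H) := uniqueDiffOn_convex hc.closure (hne.mono (interior_maximal subset_closure hH))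
  refine contDiffOn_infty.2 fun m => ?_
  induction m generalizing w with
  | zero => exact contDiffOn_zero.2 (continuousOn_extendFrom subset_rfl fun x _ => h.lim hH hc x)
  | succ m ih =>
    push_cast
    rw [contDiffOn_succ_iff_hasFDerivWithinAt_of_uniqueDiffOn hu]
    refine ⟨by simp, fun x => ∑ i, extendFrom H (LC.pd (eb i) w) x • innerSL ℝ (eb i), ?_, fun x hx => ?_⟩
    · exact ContDiffOn.sum fun i _ => (ih (h.pd hH (eb i))).smul contDiffOn_const
    · have e : EqOn (extendFrom H w) w H := fun x hx => extendFrom_extends h.cd.continuousOn x hx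
      refine hasFDerivWithinAt_closure_of_tendsto_fderiv (fun y hy => ?_) hc hH (fun y hy => ?_) ?_
      · exact ((cdo_dif hH h.cd hy).congr_of_eventuallyEq (e.eventuallyEq_of_mem (hH.mem_nhds hy))).differentiableWithinAt
      · exact ((continuousOn_extendFrom subset_rfl fun x _ => h.lim hH hc x) y hy).mono subset_closure
      · have : Tendsto (fun y => ∑ i, LC.pd (eb i) w y • innerSL ℝ (eb i)) (𝓝[H] x)
            (𝓝 (∑ i, extendFrom H (LC.pd (eb i) w) x • innerSL ℝ (eb i))) :=
          tendsto_finsetSum _ fun i _ => (tendsto_extendFrom ((h.pd hH (eb i)).lim hH hc x)).smul_const _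
        refine this.congr' ?_
        filter_upwards [self_mem_nhdsWithin] with y hy
        rw [← fderiv_sum]
        exact ((e.eventuallyEq_of_mem (hH.mem_nhds hy)).fderiv_eq).symm
lemma hb_convex (ν p : E n) (r : ℝ) : Convex ℝ (hb ν p r) := by
  refine (convex_ball p r).inter ?_
  have : {y : E n | ⟪ν, y - p⟫ < 0} = {y | innerSL ℝ ν y < ⟪ν, p⟫} := by
    ext y; simp [inner_sub_right]
  rw [this]
  exact convex_halfSpace_lt (innerSL ℝ ν).isLinear _
lemma hb_cl (hν : ‖ν‖ = 1) {r : ℝ} (hq : q ∈ ball p r) (h : ⟪ν, q - p⟫ ≤ 0) : q ∈ closure (hb ν p r) := by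
  have hinn : ⟪ν, ν⟫ = 1 := by rw [real_inner_self_eq_norm_sq, hν]; norm_num
  have hc : Continuous fun t : ℝ => q - t • ν := by fun_prop
  have ht : Tendsto (fun t : ℝ => q - t • ν) (𝓝[>] 0) (𝓝 q) := by
    have := (hc.tendsto 0).mono_left (nhdsWithin_le_nhds (s := Ioi 0))
    simpa using this
  refine mem_closure_of_tendsto ht ?_
  filter_upwards [ht.eventually (isOpen_ball.mem_nhds hq), self_mem_nhdsWithin] with t h1 h2
  refine ⟨h1, ?_⟩
  have e : q - t • ν - p = (q - p) - t • ν := by abel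
  change ⟪ν, q - t • ν - p⟫ < 0
  rw [e, inner_sub_right, inner_smul_right, hinn]
  have : (0:ℝ) < t := h2
  linarith
lemma bdry (hn : 0 < n) (hOo : IsOpen O) (hO : Bornology.IsBounded O) (S : Sh ν g) (hgp : g p = 0) {R : ℝ} (hR : 0 < R)
    (hW : ∀ y ∈ ball p R, sh ν g y ∈ O ↔ ⟪ν, y - p⟫ < 0) {φ u : E n → ℝ} (hφ : IsTest univ φ) (hp : p ∉ tsupport φ)
    (hu : ContDiffOn ℝ ∞ u (O \ tsupport φ)) (hL : ∀ x ∈ O \ tsupport φ, Lap u x = 0)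
    (hue : ∀ᵐ x, x ∈ O \ tsupport φ → GG O (l2 φ) x = u x) : ContDiffWithinAt ℝ ∞ (O.indicator u) (closure O) p := by
  have hsp : sh ν g p = p := by simp [sh, hgp]
  have hhp : hs ν g p = p := by simp [hs, hgp]
  have hev : ∀ᶠ y in 𝓝 p, sh ν g y ∉ tsupport φ :=
    S.cd_sh.continuous.continuousAt.eventually ((isClosed_tsupport φ).isOpen_compl.mem_nhds (by rw [hsp]; exact hp))
  obtain ⟨R', hR', hRb⟩ := eventually_nhds_iff_ball.1 hev
  set r := min R R' / 3 with hr
  have hr0 : 0 < r := by positivity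
  have hr1 : 3 * r ≤ R := by rw [hr]; linarith [min_le_left R R']
  have hr2 : 3 * r ≤ R' := by rw [hr]; linarith [min_le_right R R']
  have hW' : ∀ y ∈ ball p (3*r), sh ν g y ∈ O ↔ ⟪ν, y - p⟫ < 0 := fun y hy => hW y (ball_subset_ball hr1 hy)
  have hin : ∀ x, hs ν g x ∈ hb ν p r → x ∈ O \ tsupport φ := by
    intro x hx
    have h1 := hW' (hs ν g x) (ball_subset_ball (by linarith) hx.1)
    have h2 := hRb (hs ν g x) (ball_subset_ball (by linarith) hx.1)
    rw [S.sh_hs] at h1 h2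
    exact ⟨h1.2 hx.2, h2⟩
  have hae : ∀ᵐ y, y ∈ hb ν p r → GG O (l2 φ) (sh ν g y) = u (sh ν g y) := by
    filter_upwards [S.mp'.quasiMeasurePreserving.ae hue] with y hy hyN
    exact hy (hin _ (by rwa [S.hs_sh]))
  set w : E n → ℝ := fun y => u (sh ν g y) with hw
  have hcdN := S.cd_comp (hu.mono (s := O \ tsupport φ) (t := hs ν g ⁻¹' hb ν p r) hin)
  have hsub : hb ν p (r/2) ⊆ hb ν p r := inter_subset_inter_left _ (ball_subset_ball (by linarith))
  have hBd : Bd (hb ν p (r/2)) w := ⟨hcdN.mono hsub, reg hn hO S hr0 hW' hφ.m2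
    (fun y hy => image_eq_zero_of_notMem_tsupport (hRb y (Metric.closedBall_subset_ball (by linarith) hy)))
    (hu.mono hin) (fun x hx => hL x (hin x hx)) hae⟩
  set H := hb ν p (r/2) with hH
  have hHo : IsOpen H := hb_open ν p (r/2)
  have hHc : Convex ℝ H := hb_convex ν p (r/2)
  have hHne : H.Nonempty := closure_nonempty_iff.1 ⟨p, hb_cl S.nu (mem_ball_self (by positivity)) (by simp)⟩
  have hext := hBd.ext hHo hHc hHne
  have hex : ∀ y ∈ H, extendFrom H w y = w y := extendFrom_extends hBd.cd.continuousOn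
  have hz : ∀ q ∈ ball p (r/2), ⟪ν, q - p⟫ = 0 → extendFrom H w q = 0 := by
    intro q hq hq0
    by_contra hne
    have ht := tendsto_extendFrom (hBd.lim hHo hHc q)
    have hc : 0 < |extendFrom H w q| / 2 := by positivity
    have h1 : ∀ᶠ y in 𝓝[H] q, |extendFrom H w q| / 2 < |w y| := ht.abs.eventually_const_lt (by linarith)
    rw [eventually_nhdsWithin_iff] at h1
    obtain ⟨ε, hε, hb1⟩ := eventually_nhds_iff_ball.1 (h1.and (isOpen_ball.eventually_mem hq))
    refine vanish hOo (sol O (ContinuousLinearMap.id ℝ _) (l2 φ)) S hW' (ball_subset_ball (by linarith) hq) hq0 hc hε ?_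
    filter_upwards [hae] with y hy hyb hyl
    have h2 := hb1 y hyb
    have hyH : y ∈ H := ⟨h2.2, hyl⟩
    rw [← GG_eq, hy (hsub hyH)]
    exact (h2.1 hyH).le
  have hVo : IsOpen (hs ν g ⁻¹' ball p (r/2)) := isOpen_ball.preimage S.cd_hs.continuous
  have hpV : p ∈ hs ν g ⁻¹' ball p (r/2) := by rw [mem_preimage, hhp]; exact mem_ball_self (by positivity)
  have hle : ∀ x ∈ closure O, hs ν g x ∈ ball p (r/2) → ⟪ν, hs ν g x - p⟫ ≤ 0 := by
    intro x hx hxb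
    by_contra hlt
    push Not at hlt
    have ho : IsOpen (hs ν g ⁻¹' (ball p (r/2) ∩ {y | 0 < ⟪ν, y - p⟫})) :=
      (isOpen_ball.inter (isOpen_lt continuous_const (co2 ν p))).preimage S.cd_hs.continuous
    obtain ⟨z, hz1, hz2⟩ := mem_closure_iff.1 hx _ ho ⟨hxb, hlt⟩
    have h1 := hW' (hs ν g z) (ball_subset_ball (by linarith) hz1.1)
    rw [S.sh_hs] at h1
    have h2 : 0 < ⟪ν, hs ν g z - p⟫ := hz1.2
    linarith [h1.1 hz2]
  have hcl : ∀ x ∈ closure O ∩ hs ν g ⁻¹' ball p (r/2), hs ν g x ∈ closure H := fun x hx => hb_cl S.nu hx.2 (hle x hx.1 hx.2)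
  have hpc : p ∈ closure H := hb_cl S.nu (mem_ball_self (by positivity)) (by simp)
  have h1 : ContDiffWithinAt ℝ ∞ (fun x => extendFrom H w (hs ν g x)) (closure O ∩ hs ν g ⁻¹' ball p (r/2)) p := by
    refine ContDiffWithinAt.comp (g := extendFrom H w) (t := closure H) p ?_ S.cd_hs.contDiffAt.contDiffWithinAt hcl
    rw [hhp]; exact hext p hpc
  have h2 : EqOn (O.indicator u) (fun x => extendFrom H w (hs ν g x)) (closure O ∩ hs ν g ⁻¹' ball p (r/2)) := by
    intro x hx
    have h3 := hW' (hs ν g x) (ball_subset_ball (by linarith) hx.2)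
    rw [S.sh_hs] at h3
    by_cases hxO : x ∈ O
    · simp only [indicator_of_mem hxO]
      rw [hex _ ⟨hx.2, h3.1 hxO⟩, hw]
      simp only [S.sh_hs]
    · simp only [indicator_of_notMem hxO]
      rw [hz _ hx.2 (le_antisymm (hle x hx.1 hx.2) (not_lt.1 fun h => hxO (h3.2 h)))]
  have h4 := h1.congr h2 ?_
  · rwa [contDiffWithinAt_inter (hVo.mem_nhds hpV)] at h4
  · have h3 := hW' p (mem_ball_self (by positivity))
    rw [hsp, sub_self, inner_zero_right] at h3
    rw [indicator_of_notMem (fun h => lt_irrefl _ (h3.1 h)), hhp, hz p (mem_ball_self (by positivity)) (by simp)]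
end ext
section dom
variable {n : ℕ} {Ω Γ O b : Set (E n)} {φ : E n → ℝ}
def Df (O : Set (E n)) (y : E n) : Prop := ∃ (U : Set (E n)) (ρ : E n → ℝ), IsOpen U ∧ y ∈ U ∧
  ContDiffOn ℝ ∞ ρ U ∧ ρ y = 0 ∧ fderiv ℝ ρ y ≠ 0 ∧ ∀ x ∈ U, x ∈ O ↔ ρ x < 0
lemma domain (hΩ : IsOpen Ω) (hc : IsConnected Ω) (hb : Bornology.IsBounded Ω) (hs : HasSmoothBoundary Ω)
    (hΓ : IsClosed Γ) (hΓs : Γ ⊆ frontier Ω) (hΓp : Γ ≠ frontier Ω) :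
    ∃ (O C b : Set (E n)) (b0 : E n), IsOpen O ∧ Bornology.IsBounded O ∧ IsOpen C ∧ IsPreconnected C ∧
      Ω ⊆ C ∧ C ⊆ O ∧ IsOpen b ∧ IsPreconnected b ∧ b0 ∈ b ∧ b ⊆ C ∧ (∀ x ∈ b, x ∉ closure Ω) ∧
      (∀ x ∈ Γ, x ∉ O) ∧ ∀ y ∈ closure Ω, y ∉ O → Df O y := by
  obtain ⟨x0, hx0, hx0'⟩ : ∃ x ∈ frontier Ω, x ∉ Γ := by
    by_contra! h
    exact hΓp (hΓs.antisymm h)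
  obtain ⟨U, ρ, hU, hxU, hρ, hd, h1, h2⟩ := hs x0 hx0
  have hfr : ∀ y ∈ frontier Ω, y ∉ Ω := fun y hy h => (hΩ.frontier_eq ▸ hy).2 h
  have m1 : ∀ x ∈ U, (x ∈ Ω ↔ ρ x < 0) := fun x hx =>
    ⟨fun h => (h1.subset ⟨h, hx⟩).2, fun h => (h1.superset ⟨hx, h⟩).1⟩
  have m2 : ∀ x ∈ U, (x ∈ frontier Ω ↔ ρ x = 0) := fun x hx =>
    ⟨fun h => (h2.subset ⟨h, hx⟩).2, fun h => (h2.superset ⟨hx, h⟩).1⟩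
  obtain ⟨r, hr, hrU⟩ := nhds_basis_closedBall.mem_iff.1 ((hU.inter hΓ.isOpen_compl).mem_nhds ⟨hxU, hx0'⟩)
  have hbU : ball x0 r ⊆ U := fun x hx => (hrU (ball_subset_closedBall hx)).1
  let χ : ContDiffBump x0 := ⟨r / 2, r, by positivity, by linarith⟩
  have χs : ∀ x, χ x ≠ 0 → x ∈ ball x0 r := fun x hx => by
    have : x ∈ Function.support χ := hx
    rwa [χ.support_eq] at this
  have χp : ∀ x ∈ ball x0 r, 0 < χ x := fun x hx => χ.pos_of_mem_ball hx
  let W : Set (E n) := {x ∈ ball x0 r | ρ x - χ x < 0}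
  have hW : IsOpen W :=
    (((hρ.continuousOn.mono hbU).sub χ.continuous.continuousOn).isOpen_inter_preimage isOpen_ball isOpen_Iio)
  have hO : IsOpen (Ω ∪ W) := hΩ.union hW
  have x0O : x0 ∈ Ω ∪ W := by
    refine Or.inr ⟨mem_ball_self hr, ?_⟩
    have := χp x0 (mem_ball_self hr)
    rw [(m2 x0 hxU).1 hx0]; linarith
  obtain ⟨s, hs0, hsO⟩ := Metric.isOpen_iff.1 (hO.inter hU) x0 ⟨x0O, hxU⟩
  obtain ⟨z, hz, hρz⟩ : ∃ z ∈ ball x0 s, 0 < ρ z := by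
    by_contra! h
    refine hd x0 hxU (IsLocalMax.fderiv_eq_zero ?_)
    filter_upwards [ball_mem_nhds x0 hs0] with z hz
    rw [(m2 x0 hxU).1 hx0]; exact h z hz
  have hzc : z ∉ closure Ω := fun h => by
    rw [closure_eq_self_union_frontier] at h
    rcases h with h | h
    · exact lt_asymm hρz ((m1 z (hsO hz).2).1 h)
    · exact hρz.ne' ((m2 z (hsO hz).2).1 h)
  obtain ⟨δ, hδ, hδs⟩ := Metric.isOpen_iff.1 (isOpen_ball.inter isClosed_closure.isOpen_compl) z ⟨hz, hzc⟩
  refine ⟨Ω ∪ W, Ω ∪ ball x0 s, ball z δ, z, hO, hb.union (isBounded_ball.subset fun x hx => hx.1),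
    hΩ.union isOpen_ball, ?_, subset_union_left, union_subset subset_union_left fun x hx => (hsO hx).1,
    isOpen_ball, (convex_ball z δ).isPreconnected, mem_ball_self hδ,
    fun x hx => Or.inr (hδs hx).1, fun x hx => (hδs hx).2, ?_, ?_⟩
  · refine hc.isPreconnected.union' ?_ (convex_ball x0 s).isPreconnected
    obtain ⟨y, hy, hy'⟩ := Metric.mem_closure_iff.1 (frontier_subset_closure hx0) s hs0
    exact ⟨y, hy, by rwa [mem_ball, dist_comm]⟩
  · rintro x hx (h | h)
    · exact hfr x (hΓs hx) h
    · exact (hrU (ball_subset_closedBall h.1)).2 hx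
  · intro y hy hyO
    have hyf : y ∈ frontier Ω := by
      rw [hΩ.frontier_eq]; exact ⟨hy, fun h => hyO (Or.inl h)⟩
    by_cases hyb : y ∈ closedBall x0 r
    · have hyU := (hrU hyb).1
      have hρy := (m2 y hyU).1 hyf
      have hχy : χ y = 0 := by
        by_contra h
        have hb := χs y h
        exact hyO (Or.inr ⟨hb, by have := χp y hb; rw [hρy]; linarith⟩)
      have hdχ : fderiv ℝ χ y = 0 := IsLocalMin.fderiv_eq_zero (Eventually.of_forall fun x => by rw [hχy]; exact χ.nonneg)
      refine ⟨U, fun x => ρ x - χ x, hU, hyU, hρ.sub χ.contDiff.contDiffOn, by simp [hρy, hχy], ?_, fun x hx => ⟨?_, fun h => ?_⟩⟩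
      · rw [fderiv_fun_sub ((hρ.contDiffAt (hU.mem_nhds hyU)).differentiableAt (by simp)) (χ.contDiff (n := 1)|>.differentiable (by simp) y), hdχ, sub_zero]
        exact hd y hyU
      · rintro (h | h)
        · have := (m1 x hx).1 h
          have := χ.nonneg (x := x)
          linarith
        · exact h.2
      · by_cases h0 : χ x = 0
        · exact Or.inl ((m1 x hx).2 (by linarith))
        · exact Or.inr ⟨χs x h0, h⟩
    · obtain ⟨V, σ, hV, hyV, hσ, hdσ, k1, k2⟩ := hs y hyf
      refine ⟨V ∩ (closedBall x0 r)ᶜ, σ, hV.inter isClosed_closedBall.isOpen_compl, ⟨hyV, hyb⟩, hσ.mono inter_subset_left,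
        (k2.subset ⟨hyf, hyV⟩).2, hdσ y hyV, fun x hx => ⟨?_, fun h => Or.inl (k1.superset ⟨hx.1, h⟩).1⟩⟩
      rintro (h | h)
      · exact (k1.subset ⟨h, hx.1⟩).2
      · exact absurd (ball_subset_closedBall h.1) hx.2
lemma sol_ex (hn : 0 < n) (hO : IsOpen O) (hOb : Bornology.IsBounded O) (hΩO : Ω ⊆ O)
    (hbO : ∀ x ∈ b, x ∉ closure Ω) (hΓO : ∀ x ∈ Γ, x ∉ O) (hD : ∀ y ∈ closure Ω, y ∉ O → Df O y) (hφ : IsTest b φ) :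
    ∃ u, (ContDiffOn ℝ ∞ u (closure Ω) ∧ IsHarmonicOn u Ω ∧ ∀ x ∈ Γ, u x = 0) ∧
      ∀ᵐ x, x ∈ Ω → GG O (l2 φ) x = u x := by
  have hT : IsOpen (O \ tsupport φ) := hO.sdiff (isClosed_tsupport φ)
  have hz := K_zero_off hO (sol O (ContinuousLinearMap.id ℝ _) (l2 φ))
  rw [← GG_eq] at hz
  have hi : Integrable (GG O (l2 φ) : E n → ℝ) := by
    have h2 : IntegrableOn (GG O (l2 φ) : E n → ℝ) O := by
      have : IsFiniteMeasure (volume.restrict O) := ⟨by simpa using hOb.measure_lt_top⟩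
      exact ((Lp.memLp (GG O (l2 φ))).restrict O).integrable (by norm_num)
    refine ((integrable_indicator_iff hO.measurableSet).2 h2).congr ?_
    filter_upwards [hz] with x hx
    by_cases h : x ∈ O
    · rw [indicator_of_mem h]
    · rw [indicator_of_notMem h, hx h]
  obtain ⟨u, hu, hue, hL⟩ := weyl hn hT hi fun ψ hψ => by
    rw [GG_weak hn hOb _ (hψ.mono sdiff_subset), neg_eq_zero]
    refine integral_eq_zero_of_ae ?_
    filter_upwards [l2_coe hφ.m2] with x hx
    by_cases h : x ∈ tsupport φ
    · have : ψ x = 0 := image_eq_zero_of_notMem_tsupport fun h' => (hψ.ts h').2 h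
      simp [this]
    · simp [hx, image_eq_zero_of_notMem_tsupport h]
  have hcl : ∀ y ∈ closure Ω, y ∉ tsupport φ := fun y hy h => hbO y (hφ.ts h) hy
  have hin : ∀ y ∈ O, O.indicator u =ᶠ[𝓝 y] u := fun y hy => by
    filter_upwards [hO.mem_nhds hy] with x hx using indicator_of_mem hx u
  have hca : ∀ y ∈ O, y ∉ tsupport φ → ContDiffAt ℝ ∞ (O.indicator u) y := fun y hy hy' =>
    (hu.contDiffAt (hT.mem_nhds ⟨hy, hy'⟩)).congr_of_eventuallyEq (hin y hy)
  refine ⟨O.indicator u, ⟨fun y hy => ?_, ⟨fun y hy => ?_, fun y hy => ?_⟩, fun x hx => indicator_of_notMem (hΓO x hx) u⟩, ?_⟩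
  · by_cases hyO : y ∈ O
    · exact (hca y hyO (hcl y hy)).contDiffWithinAt
    · obtain ⟨U, ρ, hU, hyU, hρ, h0, hd, hm⟩ := hD y hy hyO
      obtain ⟨ν, g, R, hR, S, hg, hW⟩ := straighten hU hyU hρ h0 hd hm
      exact (bdry hn hO hOb S hg hR hW (hφ.mono (subset_univ _)) (hcl y hy) hu hL hue).mono (closure_mono hΩO)
  · exact ((hca y (hΩO hy) (hcl y (subset_closure hy))).of_le (WithTop.coe_le_coe.2 le_top)).contDiffWithinAt
  · rw [lap_eq_Lap ((hca y (hΩO hy) (hcl y (subset_closure hy))).of_le (WithTop.coe_le_coe.2 le_top)),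
      Lap_congr (hin y (hΩO hy))]
    exact hL y ⟨hΩO hy, hcl y (subset_closure hy)⟩
  · filter_upwards [hue] with x hx h
    rw [indicator_of_mem (hΩO h), hx ⟨hΩO h, hcl x (subset_closure h)⟩]
end dom
section dens
variable {α : Type*} [MeasurableSpace α] {μ : Measure α} [IsFiniteMeasure μ]
lemma l1_riesz (T : (α →₁[μ] ℝ) →L[ℝ] ℝ) : ∃ g : α → ℝ, StronglyMeasurable g ∧ (∃ M : ℝ, ∀ x, ‖g x‖ ≤ M) ∧
    ∀ h, MemLp h 2 μ → ∀ hh : Integrable h μ, T (hh.toL1 h) = ∫ x, g x * h x ∂μ := by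
  have hi : ∀ h : Lp ℝ 2 μ, Integrable h μ := fun h => (Lp.memLp h).integrable (by norm_num)
  let t : Lp ℝ 2 μ →ₗ[ℝ] ℝ :=
    { toFun := fun h => T ((hi h).toL1 h)
      map_add' := fun h k => by
        rw [← map_add, ← Integrable.toL1_add]
        congr 1
        exact (Integrable.toL1_eq_toL1_iff _ _ _ _).2 (Lp.coeFn_add h k)
      map_smul' := fun c h => by
        rw [RingHom.id_apply, ← map_smul, ← Integrable.toL1_smul']
        congr 1
        exact (Integrable.toL1_eq_toL1_iff _ _ _ _).2 (Lp.coeFn_smul c h) }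
  let t' : Lp ℝ 2 μ →L[ℝ] ℝ := t.mkContinuous (‖T‖ * (μ univ ^ (1 / (1 : ENNReal).toReal - 1 / (2 : ENNReal).toReal)).toReal) fun h => by
    refine (T.le_opNorm _).trans ?_
    rw [mul_assoc]
    refine mul_le_mul_of_nonneg_left ?_ (norm_nonneg T)
    rw [Integrable.toL1, Lp.norm_toLp, Lp.norm_def, mul_comm, ← ENNReal.toReal_mul]
    refine ENNReal.toReal_mono (ENNReal.mul_ne_top (Lp.eLpNorm_ne_top h) (ENNReal.rpow_ne_top_of_nonneg (by norm_num) (measure_ne_top μ _))) ?_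
    exact eLpNorm_le_eLpNorm_mul_rpow_measure_univ (by norm_num) (Lp.aestronglyMeasurable h)
  let g := (InnerProductSpace.toDual ℝ (Lp ℝ 2 μ)).symm t'
  have hg : ∀ h, MemLp h 2 μ → ∀ hh : Integrable h μ, T (hh.toL1 h) = ∫ x, g x * h x ∂μ := fun h h2 hh => by
    have e : T (hh.toL1 h) = t' (h2.toLp h) := by
      change _ = T ((hi (h2.toLp h)).toL1 _)
      congr 1
      exact (Integrable.toL1_eq_toL1_iff _ _ _ _).2 h2.coeFn_toLp.symm
    rw [e, ← InnerProductSpace.toDual_symm_apply, L2.inner_def]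
    refine integral_congr_ae ?_
    filter_upwards [h2.coeFn_toLp] with x hx
    rw [hx]; exact mul_comm _ _
  have hs : ∀ s, MeasurableSet s → |∫ x in s, g x ∂μ| ≤ ∫ x in s, ‖T‖ ∂μ := fun s hs => by
    have h2 : MemLp (s.indicator fun _ => (1 : ℝ)) 2 μ := (memLp_const 1).indicator hs
    have hh : Integrable (s.indicator fun _ => (1 : ℝ)) μ := (integrable_const 1).indicator hs
    have e : ∫ x in s, g x ∂μ = T (hh.toL1 _) := by
      rw [hg _ h2 hh, ← integral_indicator hs]
      congr 1; ext x
      by_cases hx : x ∈ s <;> simp [hx]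
    rw [e, ← Real.norm_eq_abs]
    refine (T.le_opNorm _).trans_eq ?_
    rw [L1.norm_of_fun_eq_integral_norm, setIntegral_const, smul_eq_mul, mul_comm]
    congr 1
    simp_rw [norm_indicator_eq_indicator_norm, norm_one]
    rw [integral_indicator hs]; simp
  have b1 : (g : α → ℝ) ≤ᵐ[μ] fun _ => ‖T‖ :=
    ae_le_of_forall_setIntegral_le (hi g) (integrable_const _) fun s h _ => (le_abs_self _).trans (hs s h)
  have b2 : -(g : α → ℝ) ≤ᵐ[μ] fun _ => ‖T‖ :=
    ae_le_of_forall_setIntegral_le (hi g).neg (integrable_const _) fun s h _ => by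
      simp_rw [Pi.neg_apply, integral_neg]
      exact (neg_le_abs _).trans (hs s h)
  have hm : MeasurableSet {x | ‖g x‖ ≤ ‖T‖} := measurableSet_le (Lp.stronglyMeasurable g).norm.measurable measurable_const
  refine ⟨{x | ‖g x‖ ≤ ‖T‖}.indicator g, (Lp.stronglyMeasurable g).indicator hm, ⟨‖T‖, fun x => ?_⟩, fun h h2 hh => ?_⟩
  · by_cases hx : ‖g x‖ ≤ ‖T‖
    · rwa [indicator_of_mem (show x ∈ {x | ‖g x‖ ≤ ‖T‖} from hx)]
    · rw [indicator_of_notMem (show x ∉ {x | ‖g x‖ ≤ ‖T‖} from hx), norm_zero]; exact norm_nonneg T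
  · rw [hg h h2 hh]
    refine integral_congr_ae ?_
    filter_upwards [b1, b2] with x h1 h2
    rw [indicator_of_mem (show x ∈ {x | ‖g x‖ ≤ ‖T‖} from abs_le.2 ⟨by simp at h2; linarith, h1⟩)]
lemma l1_dense {P : Set (α → ℝ)} (hP : ∀ p ∈ P, MemLp p 2 μ)
    (key : ∀ g : α → ℝ, StronglyMeasurable g → (∃ M : ℝ, ∀ x, ‖g x‖ ≤ M) → (∀ p ∈ P, ∫ x, g x * p x ∂μ = 0) → g =ᵐ[μ] 0)
    {f : α → ℝ} (hf : Integrable f μ) {ε : ℝ} (hε : 0 < ε) :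
    ∃ g ∈ Submodule.span ℝ P, ∫ x, |f x - g x| ∂μ < ε := by
  let S : Submodule ℝ (α →₁[μ] ℝ) :=
    { carrier := {h | ∃ g ∈ Submodule.span ℝ P, h =ᵐ[μ] g}
      add_mem' := fun {h k} ⟨g, hg, e⟩ ⟨g', hg', e'⟩ =>
        ⟨g + g', Submodule.add_mem _ hg hg', (Lp.coeFn_add h k).trans (e.add e')⟩
      zero_mem' := ⟨0, Submodule.zero_mem _, Lp.coeFn_zero ℝ 1 μ⟩
      smul_mem' := fun c h ⟨g, hg, e⟩ =>
        ⟨c • g, Submodule.smul_mem _ c hg, (Lp.coeFn_smul c h).trans (e.const_smul c)⟩ }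
  by_cases hmem : hf.toL1 f ∈ closure (S : Set (α →₁[μ] ℝ))
  · obtain ⟨h, ⟨g, hg, e⟩, hd⟩ := Metric.mem_closure_iff.1 hmem ε hε
    refine ⟨g, hg, ?_⟩
    rw [dist_eq_norm, L1.norm_eq_integral_norm] at hd
    refine lt_of_eq_of_lt (integral_congr_ae ?_) hd
    filter_upwards [e, hf.coeFn_toL1, Lp.coeFn_sub (hf.toL1 f) h] with x h1 h2 h3
    rw [h3, Pi.sub_apply, h1, h2, Real.norm_eq_abs]
  · exfalso
    obtain ⟨T, s, hT, hs⟩ := geometric_hahn_banach_closed_point S.convex.closure isClosed_closure hmem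
    have s0 : 0 < s := by simpa using hT 0 (subset_closure S.zero_mem)
    have h0 : ∀ h ∈ S, T h = 0 := fun h hh => by
      by_contra hne
      have := hT _ (subset_closure (S.smul_mem (s / T h) hh))
      rw [map_smul, smul_eq_mul, div_mul_cancel₀ _ hne] at this
      exact this.false
    obtain ⟨g, hgm, hgb, hg⟩ := l1_riesz T
    have hz := key g hgm hgb fun p hp => by
      have hi : Integrable p μ := (hP p hp).integrable (by norm_num)
      rw [← hg p (hP p hp) hi]
      exact h0 _ ⟨p, Submodule.subset_span hp, hi.coeFn_toL1⟩
    have : ∀ hh : Integrable f μ, T (hh.toL1 f) = 0 := by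
      refine Integrable.induction (fun h => ∀ hh : Integrable h μ, T (hh.toL1 h) = 0) (fun c s hs _ hh => ?_)
        (fun h k _ hh hk i1 i2 _ => ?_) ?_ (fun h k e hh i hk => ?_) hf
      · rw [hg _ ((memLp_const c).indicator hs) hh]
        refine integral_eq_zero_of_ae ?_
        filter_upwards [hz] with x hx
        simp [hx]
      · rw [Integrable.toL1_add _ _ hh hk, map_add, i1 hh, i2 hk, add_zero]
      · have e : {f : α →₁[μ] ℝ | ∀ hh : Integrable f μ, T (hh.toL1 f) = 0} = {f | T f = 0} := by
          ext f
          exact ⟨fun h => by simpa using h (L1.integrable_coeFn f), fun h hh => by simpa using h⟩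
        rw [e]
        exact isClosed_eq T.continuous continuous_const
      · rw [← i hh]
        congr 1
        exact (Integrable.toL1_eq_toL1_iff _ _ _ _).2 e.symm
    have := this hf
    linarith
end dens
section final
variable {n : ℕ}
lemma final (hn : 2 ≤ n) {Ω Γ : Set (E n)} (hΩ : IsOpen Ω) (hc : IsConnected Ω) (hb : Bornology.IsBounded Ω)
    (hs : HasSmoothBoundary Ω) (hΓ : IsClosed Γ) (hΓs : Γ ⊆ frontier Ω) (hΓp : Γ ≠ frontier Ω)
    {f : E n → ℝ} (hf : Integrable f (volume.restrict Ω)) {ε : ℝ} (hε : 0 < ε) :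
    ∃ g ∈ Submodule.span ℝ (HarmonicProducts Ω Γ), ∫ x in Ω, |f x - g x| < ε := by
  have : IsFiniteMeasure (volume.restrict Ω) := ⟨by simpa using hb.measure_lt_top⟩
  obtain ⟨O, C, b, b0, hO, hOb, hC, hCc, hΩC, hCO, hbo, hbc, hb0, hbC, hbΩ, hΓO, hD⟩ := domain hΩ hc hb hs hΓ hΓs hΓp
  refine l1_dense (fun p hp => ?_) (fun g hgm ⟨M, hM⟩ hg => ?_) hf hε
  · obtain ⟨u, v, hu, -, -, hv, -, -, rfl⟩ := hp
    have hco : ContinuousOn (fun x => u x * v x) (closure Ω) := hu.continuousOn.mul hv.continuousOn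
    obtain ⟨B, hB⟩ := hb.isCompact_closure.exists_bound_of_continuousOn hco
    refine MemLp.of_bound ((hco.mono subset_closure).aestronglyMeasurable hΩ.measurableSet) B ?_
    filter_upwards [ae_restrict_mem hΩ.measurableSet] with x hx using hB x (subset_closure hx)
  · have hM0 : 0 ≤ M := (norm_nonneg _).trans (hM 0)
    have := orth_global hn hOb (f := Ω.indicator g) (Mf := M) (hgm.indicator hΩ.measurableSet).aestronglyMeasurable
      (fun x => (norm_indicator_le_norm_self g x).trans (hM x)) hC hCc hCO hbo hbc hb0 hbC
      (Eventually.of_forall fun x hx => indicator_of_notMem (fun h => hbΩ x hx (subset_closure h)) g) fun φ ψ hφ hψ => by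
        obtain ⟨u, ⟨hu1, hu2, hu3⟩, hu⟩ := sol_ex (by omega) hO hOb (hΩC.trans hCO) hbΩ hΓO hD hφ
        obtain ⟨v, ⟨hv1, hv2, hv3⟩, hv⟩ := sol_ex (by omega) hO hOb (hΩC.trans hCO) hbΩ hΓO hD hψ
        rw [← hg _ ⟨u, v, hu1, hu2, hu3, hv1, hv2, hv3, rfl⟩, ← integral_indicator hΩ.measurableSet]
        refine integral_congr_ae ?_
        filter_upwards [hu, hv] with x h1 h2
        by_cases hx : x ∈ Ω
        · simp [hx, h1 hx, h2 hx]
        · simp [hx]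
    rw [EventuallyEq, ae_restrict_iff' hΩ.measurableSet]
    filter_upwards [this] with x hx h
    simpa [h] using hx (hΩC h)
end final
end LC

/-- **Linearized local Calderón problem, density form.**
If `Ω ⊂ ℝⁿ`, `n ≥ 2`, is a connected bounded open set with smooth boundary and
`Γ ⊊ ∂Ω` is a closed proper subset of the boundary, then the linear span of products of
harmonic functions in `C^∞(Ω̄)` vanishing on `Γ` is dense in `L¹(Ω)`. -/
theorem linearized_calderon_density {n : ℕ} (hn : 2 ≤ n)
    (Ω : Set (EuclideanSpace ℝ (Fin n))) (hΩopen : IsOpen Ω) (hΩconn : IsConnected Ω)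
    (hΩbdd : Bornology.IsBounded Ω) (hΩsmooth : HasSmoothBoundary Ω)
    (Γ : Set (EuclideanSpace ℝ (Fin n))) (hΓclosed : IsClosed Γ)
    (hΓsub : Γ ⊆ frontier Ω) (hΓproper : Γ ≠ frontier Ω)
    (f : EuclideanSpace ℝ (Fin n) → ℝ) (hf : Integrable f (volume.restrict Ω))
    (ε : ℝ) (hε : 0 < ε) :
    ∃ g ∈ Submodule.span ℝ (HarmonicProducts Ω Γ),
      ∫ x in Ω, |f x - g x| < ε := by
  exact LC.final hn hΩopen hΩconn hΩbdd hΩsmooth hΓclosed hΓsub hΓproper hf hε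

end
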